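/- For any permutation w, the Schubert polynomial satisfies 𝔖_w = Σ κ_{des(lift(ρ))}, where the sum is over reduced words ρ ∈ R(w) whose descent tableau 𝔻(ρ) is an increasing Young tableau, and lift(ρ) is the result of the canonical lifting algorithm applied to 𝔻(ρ). -/

import Mathlib

open List

namespace EG

/-! ## Words, permutations, and reduced words.

A word is a list of positive natural numbers `(ρ_ℓ, …, ρ_1)`, read left to right,
representing the product of simple transpositions `s_{ρ_ℓ} ⋯ s_{ρ_1}`. -/

/-- The permutation of `ℕ` represented by a word. -/
def toPerm (ρ : List ℕ) : Equiv.Perm ℕ :=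
  (ρ.map fun i => Equiv.swap i (i + 1)).prod

/-- `ρ` is a reduced word: its letters are positive, and no shorter word represents
the same permutation. -/
def IsReducedWord (ρ : List ℕ) : Prop :=
  (∀ i ∈ ρ, 1 ≤ i) ∧
    ∀ σ : List ℕ, (∀ i ∈ σ, 1 ≤ i) → toPerm σ = toPerm ρ → ρ.length ≤ σ.length

/-- `ρ` is a reduced word for the permutation `w`. -/
def ReducedWordFor (ρ : List ℕ) (w : Equiv.Perm ℕ) : Prop :=
  IsReducedWord ρ ∧ toPerm ρ = w

/-! ## Elementary Coxeter–Knuth relations. -/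

/-- The elementary Coxeter–Knuth move on a consecutive triple
`(a, b, c) = (ρ_{i+1}, ρ_i, ρ_{i−1})`. -/
def ckTriple (a b c : ℕ) : ℕ × ℕ × ℕ :=
  if a = c then (b, a, b)
  else if (c > a ∧ a > b) ∨ (c < a ∧ a < b) then (a, c, b)
  else if (a > c ∧ c > b) ∨ (a < c ∧ c < b) then (b, a, c)
  else (a, b, c)

/-- The elementary Coxeter–Knuth relation `𝔡_i`, acting on the letters
`ρ_{i+1} ρ_i ρ_{i−1}` of a word `ρ = (ρ_ℓ, …, ρ_1)` (indexed from the right). -/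
def ckMove (i : ℕ) (ρ : List ℕ) : List ℕ :=
  if 2 ≤ i ∧ i + 1 ≤ ρ.length then
    let p := ρ.length - i - 1
    let t := ckTriple (ρ.getD p 0) (ρ.getD (p + 1) 0) (ρ.getD (p + 2) 0)
    ((ρ.set p t.1).set (p + 1) t.2.1).set (p + 2) t.2.2
  else ρ

/-- Two words are Coxeter–Knuth equivalent if one is obtained from the other by a
finite sequence of elementary Coxeter–Knuth relations. -/
def CKEquiv (ρ σ : List ℕ) : Prop :=
  ∃ ms : List ℕ, σ = ms.foldl (fun w i => ckMove i w) ρ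

/-! ## Run decompositions and descent tableaux. -/

/-- Split a list into maximal blocks, breaking between consecutive letters `a`, `b`
whenever `brk a b` holds. -/
def splitWhen (brk : ℕ → ℕ → Bool) : List ℕ → List (List ℕ)
  | [] => []
  | [a] => [[a]]
  | a :: b :: rest =>
    match splitWhen brk (b :: rest) with
    | r :: rs => if brk a b then [a] :: r :: rs else (a :: r) :: rs
    | [] => [[a]]

/-- The run decomposition of a word into maximal strictly increasing runs, listed
left to right (so the list is `[ρ⁽ᵏ⁾, …, ρ⁽¹⁾]`, with `ρ⁽¹⁾` the final run). -/
def runs (ρ : List ℕ) : List (List ℕ) := splitWhen (fun a b => decide (b ≤ a)) ρ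

/-- The rows of the descent tableau `𝔻(ρ)`, listed bottom to top:
`[ρ⁽¹⁾, …, ρ⁽ᵏ⁾]`. -/
def rowsOf (ρ : List ℕ) : List (List ℕ) := (runs ρ).reverse

/-- The row reading word of a tableau whose rows are listed bottom to top:
read rows left to right, starting with the top row. -/
def wordOf (R : List (List ℕ)) : List ℕ := R.reverse.flatten

/-- The descent composition `Des(ρ) = (|ρ⁽¹⁾|, …, |ρ⁽ᵏ⁾|)`. -/
def DesComp (ρ : List ℕ) : List ℕ := (rowsOf ρ).map List.length

/-- A list of rows (bottom to top) is an increasing Young tableau of partition shape: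
rows strictly increase left to right, shape is a partition, and columns strictly
increase bottom to top. -/
def IsIncreasingYoungRows (R : List (List ℕ)) : Prop :=
  (∀ r ∈ R, r.Chain' (· < ·)) ∧
    R.Chain' (fun lo hi => hi.length ≤ lo.length ∧
      ∀ j < hi.length, lo.getD j 0 < hi.getD j 0)

/-! ## The drop map on a pair of increasing rows. -/

/-- Increment the first `n` letters of a list by `1`. -/
def incFirst : ℕ → List ℕ → List ℕ
  | 0, l => l
  | _ + 1, [] => []
  | n + 1, a :: l => (a + 1) :: incFirst n l

/-- Decrement the first `n` letters of a list by `1`. -/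
def decFirst : ℕ → List ℕ → List ℕ
  | 0, l => l
  | _ + 1, [] => []
  | n + 1, a :: l => (a - 1) :: decFirst n l

/-- `bCount t1 i [s_i, s_{i+1}, …]` is the largest `b` with `t1 = s_j + j` for all
`i ≤ j < i + b`. -/
def bCount (t1 : ℕ) : ℕ → List ℕ → ℕ
  | _, [] => 0
  | i, s :: rest => if t1 = s + i then bCount t1 (i + 1) rest + 1 else 0

/-- Index of the first failure `τ_j ≤ σ_j` in the drop alignment of `σ` below `τ`. -/
def failIdx (τ σ : List ℕ) : Option ℕ :=
  (τ.zip σ).findIdx? (fun p => decide (p.1 ≤ p.2))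

/-- Fueled computation of the drop of the row `σ` below the row `τ`, returning the
new pair (top row, bottom row). -/
def dropPairAux : ℕ → List ℕ → List ℕ → List ℕ × List ℕ
  | 0, τ, σ => (τ, σ)
  | fuel + 1, τ, σ =>
    match failIdx τ σ with
    | none =>
      if σ.length < τ.length then (τ.take σ.length, σ ++ τ.drop σ.length)
      else (τ, σ)
    | some j =>
      let x := τ.getD j 0
      let τr := τ.drop (j + 1)
      let σr := σ.drop j
      let res := dropPairAux fuel τr σr
      let l1 := (failIdx τr σr).getD τr.length
      let b := if l1 = 0 then 0
               else if x + 1 = τr.headD 0 then bCount (τr.headD 0) 1 (σr.take l1) else 0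
      (τ.take j ++ res.1, σ.take j ++ x :: incFirst b res.2)

/-- The drop of the row `σ` below the row `τ`: the pair (new top row, new bottom row). -/
def dropPair (τ σ : List ℕ) : List ℕ × List ℕ := dropPairAux (τ.length + 1) τ σ

/-- The word `drop(τσ)`. -/
def dropW (τ σ : List ℕ) : List ℕ := (dropPair τ σ).1 ++ (dropPair τ σ).2

/-- Apply `drop` to rows `i` and `i+1` (1-indexed from the bottom) of a list of rows. -/
def dropAt : ℕ → List (List ℕ) → List (List ℕ)
  | 1, σr :: τr :: rest => (dropPair τr σr).2 :: (dropPair τr σr).1 :: rest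
  | n + 2, r :: R => r :: dropAt (n + 1) R
  | _, R => R

/-- The map `drop_i` on words: replace the runs `ρ⁽ⁱ⁺¹⁾ ρ⁽ⁱ⁾` of the run
decomposition by `drop(ρ⁽ⁱ⁺¹⁾ ρ⁽ⁱ⁾)`. -/
def dropWordAt (i : ℕ) (ρ : List ℕ) : List ℕ := wordOf (dropAt i (rowsOf ρ))

/-- One sweep of all the maps `drop_i`. -/
def sweepDrop (ρ : List ℕ) : List ℕ :=
  (List.range (runs ρ).length).foldl (fun w i => dropWordAt (i + 1) w) ρ

/-- The drop `drop(ρ)` of a word: repeatedly apply the maps `drop_i` until reaching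
the fixed point (an increasing Young tableau). -/
def dropFull (ρ : List ℕ) : List ℕ := sweepDrop^[ρ.length * ρ.length + 1] ρ

/-! ## The lift map on a pair of increasing rows. -/

/-- `bCount2 x i τblk σblk` is the largest `b` with `τ_j = σ_j = x + j` for all
`i ≤ j < i + b`. -/
def bCount2 (x : ℕ) : ℕ → List ℕ → List ℕ → ℕ
  | i, t :: ts, s :: ss =>
      if t = x + i ∧ s = x + i then bCount2 x (i + 1) ts ss + 1 else 0
  | _, _, _ => 0

/-- Index of the first failure (from the right) in the lift alignment of `τ` above
`σ`: here both rows are given reversed. -/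
def liftFailIdx (τR σR : List ℕ) : Option ℕ :=
  (τR.zip σR).findIdx? (fun p => decide (p.1 < p.2))

/-- Fueled computation of the lift of the row `τ` above the row `σ`, on reversed
rows; returns the new (top row, bottom row), reversed. -/
def liftPairAuxR : ℕ → List ℕ → List ℕ → List ℕ × List ℕ
  | 0, τR, σR => (τR, σR)
  | fuel + 1, τR, σR =>
    match liftFailIdx τR σR with
    | none => (τR, σR)
    | some j =>
      let x := σR.getD j 0
      let τr := τR.drop j
      let σr := σR.drop (j + 1)
      let res := liftPairAuxR fuel τr σr
      let τblk := (τR.take j).reverse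
      let σblk := (σR.take j).reverse
      let b := if σblk.headD 0 = x + 1 then bCount2 x 1 τblk σblk else 0
      (τR.take j ++ x :: res.1, (decFirst b σblk).reverse ++ res.2)

/-- Check that the lift alignment leaves no unmatched letters of `σ` (no letter of
`σ` other than the `x_j`'s lacks a letter of `τ` above it); when some letter is
left over, the lift acts trivially. -/
def liftOkAux : ℕ → List ℕ → List ℕ → Bool
  | 0, _, _ => true
  | fuel + 1, τR, σR =>
    match liftFailIdx τR σR with
    | none => σR.length ≤ τR.length
    | some j => liftOkAux fuel (τR.drop j) (σR.drop (j + 1))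

/-- The lift of the row `τ` above the row `σ`: the pair (new top row, new bottom row). -/
def liftPair (τ σ : List ℕ) : List ℕ × List ℕ :=
  if liftOkAux (σ.length + 1) τ.reverse σ.reverse then
    let r := liftPairAuxR (σ.length + 1) τ.reverse σ.reverse
    (r.1.reverse, r.2.reverse)
  else (τ, σ)

/-- The word `lift(τσ)`. -/
def liftW (τ σ : List ℕ) : List ℕ := (liftPair τ σ).1 ++ (liftPair τ σ).2

/-- Apply `lift` to rows `i` and `i+1` (1-indexed from the bottom) of a list of rows. -/
def liftAt : ℕ → List (List ℕ) → List (List ℕ)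
  | 1, σr :: τr :: rest => (liftPair τr σr).2 :: (liftPair τr σr).1 :: rest
  | n + 2, r :: R => r :: liftAt (n + 1) R
  | _, R => R

/-- The lifting sequence `lift_{[i,j]} = lift_j ∘ ⋯ ∘ lift_i`. -/
def liftSeq (i j : ℕ) (T : List (List ℕ)) : List (List ℕ) :=
  (List.range' i (j + 1 - i)).foldl (fun t k => liftAt k t) T

/-- Fueled check that `lift_i, lift_{i+1}, …` all act faithfully, for `n` steps. -/
def faithfulAux : ℕ → ℕ → List (List ℕ) → Bool
  | 0, _, _ => false
  | n + 1, i, T =>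
    let T' := liftAt i T
    if T' = T then false
    else if n = 0 then true
    else faithfulAux n (i + 1) T'

/-- The lifting sequence `lift_{[i,j]}` acts faithfully on `T`. -/
def faithfulSeq (i j : ℕ) (T : List (List ℕ)) : Bool :=
  if i ≤ j then faithfulAux (j + 1 - i) i T else false

/-- Find the canonical move: the maximal `j` admitting some `i ≤ j` with
`lift_{[i,j]}` faithful, together with the minimal such `i`. -/
def findMove (T : List (List ℕ)) : Option (ℕ × ℕ) :=
  (List.range (T.length + 1)).reverse.findSome? (fun j =>
    ((List.range' 1 j).find? (fun i => faithfulSeq i j T)).map (fun i => (i, j)))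

/-- Fueled canonical lifting loop. -/
def liftCanonAux : ℕ → List (List ℕ) → List (List ℕ)
  | 0, T => T
  | fuel + 1, T =>
    match findMove T with
    | none => T
    | some ij => liftCanonAux fuel (liftSeq ij.1 ij.2 T)

/-- The canonical lifting algorithm applied to a tableau (rows bottom to top). -/
def liftCanon (T : List (List ℕ)) : List (List ℕ) :=
  liftCanonAux (T.flatten.length * T.length + 1) T

/-- The word `lift(ρ)`: the row reading word of the canonical lift of `𝔻(ρ)`. -/
def liftWord (ρ : List ℕ) : List ℕ := wordOf (liftCanon (rowsOf ρ))

/-! ## Weak descent compositions. -/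

/-- From the list of minima `[r_k, …, r_1]` of the runs (topmost first), compute
`[r̂_k, …, r̂_1]` where `r̂_k = r_k` and `r̂_i = min (r_i, r̂_{i+1} − 1)`. -/
def hatMins (L : List ℤ) : List ℤ :=
  (L.foldl (fun (acc : List ℤ × Option ℤ) r =>
    let v := match acc.2 with
      | none => r
      | some p => min r (p - 1)
    (acc.1 ++ [v], some v)) ([], none)).1

/-- Build the weak composition with value `lens_i` in position `hs_i` and `0`
elsewhere. -/
def buildWeakComp (hs : List ℤ) (lens : List ℕ) : List ℕ :=
  (List.range (hs.headD 0).toNat).map (fun p =>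
    match (hs.zip lens).find? (fun q => decide (q.1 = (p : ℤ) + 1)) with
    | some q => q.2
    | none => 0)

/-- The weak descent composition determined by the minima and lengths of the runs
(topmost run first); `none` means virtual. -/
def desFromBlocks (mins : List ℤ) (lens : List ℕ) : Option (List ℕ) :=
  let hs := hatMins mins
  if hs = [] then some []
  else if hs.getLastD 0 ≤ 0 then none
  else some (buildWeakComp hs lens)

/-- The weak descent composition `des(ρ)` of a word; `none` means `ρ` is virtual. -/
def desWord (ρ : List ℕ) : Option (List ℕ) :=
  desFromBlocks ((runs ρ).map (fun r => ((r.headD 0 : ℕ) : ℤ)))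
    ((runs ρ).map List.length)

/-- Prefix-sum dominance of weak compositions: `domLe a b` means
`a_1 + ⋯ + a_k ≤ b_1 + ⋯ + b_k` for all `k` (i.e. `b ≥ a`). -/
def domLe (a b : List ℕ) : Prop := ∀ k, ((a.take k).sum ≤ (b.take k).sum)

/-- A reduced word is Yamanouchi if it is non-virtual and its weak descent
composition is dominated by that of every non-virtual Coxeter–Knuth equivalent word. -/
def IsYam (ρ : List ℕ) : Prop :=
  IsReducedWord ρ ∧ ∃ d, desWord ρ = some d ∧
    ∀ σ e, CKEquiv ρ σ → desWord σ = some e → domLe d e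

/-! ## Quasisymmetric functions, slide polynomials, and generating functions.

We model formal power series in variables `x_1, x_2, …` (indexed by `ℕ`, with
variable `i` standing for `x_{i+1}`) as functions `(ℕ →₀ ℕ) → ℤ` recording
coefficients of monomials. -/

/-- `β` refines `α`: `β` splits into consecutive blocks with sums the parts of `α`. -/
def Refines (β α : List ℕ) : Prop :=
  ∃ blocks : List (List ℕ), blocks.flatten = β ∧
    List.Forall₂ (fun blk a => blk.sum = a) blocks α

/-- The flattening of a weak composition given as a finitely supported exponent
vector: the list of its nonzero values, in order. -/
def flatOf (b : ℕ →₀ ℕ) : List ℕ :=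
  ((List.range (b.support.sup id + 1)).map b).filter (fun x => decide (x ≠ 0))

open Classical in
/-- The fundamental quasisymmetric function `F_α`. -/
noncomputable def Fqs (α : List ℕ) : (ℕ →₀ ℕ) → ℤ :=
  fun b => if Refines (flatOf b) α then 1 else 0

open Classical in
/-- The fundamental slide polynomial `𝔉_a` of a weak composition `a`. -/
noncomputable def FSlide (a : List ℕ) : (ℕ →₀ ℕ) → ℤ :=
  fun b =>
    if (∀ i, a.length ≤ i → b i = 0) ∧
       (∀ k, (a.take k).sum ≤ ∑ i ∈ Finset.range k, b i) ∧
       Refines (flatOf b) (a.filter (fun x => decide (x ≠ 0))) then 1 else 0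

/-- `𝔉` extended to virtual indices by `𝔉_∅ = 0`. -/
noncomputable def FSlideO : Option (List ℕ) → (ℕ →₀ ℕ) → ℤ
  | none => 0
  | some a => FSlide a

/-- The Stanley symmetric function `S_w`. -/
noncomputable def StanleySym (w : Equiv.Perm ℕ) : (ℕ →₀ ℕ) → ℤ :=
  ∑ᶠ ρ ∈ {ρ : List ℕ | ReducedWordFor ρ w}, Fqs (DesComp ρ)

/-- The Schubert polynomial `𝔖_w`. -/
noncomputable def Schubert (w : Equiv.Perm ℕ) : (ℕ →₀ ℕ) → ℤ :=
  ∑ᶠ ρ ∈ {ρ : List ℕ | ReducedWordFor ρ w}, FSlideO (desWord ρ)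

/-! ## Standard Young tableaux and Schur functions. -/

/-- The (bottom-to-top) row index of the row of `T` containing the entry `e`. -/
def rowOf (T : List (List ℕ)) (e : ℕ) : ℕ := T.findIdx (fun r => r.contains e)

/-- The column index of the entry `e` in `T`. -/
def colOf (T : List (List ℕ)) (e : ℕ) : ℕ :=
  (T.getD (rowOf T e) []).findIdx (fun z => z == e)

/-- `T` (rows listed bottom to top) is a standard Young tableau. -/
def IsSYT (T : List (List ℕ)) : Prop :=
  (∀ r ∈ T, r.Chain' (· < ·)) ∧
    T.Chain' (fun lo hi => hi.length ≤ lo.length ∧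
      ∀ j < hi.length, lo.getD j 0 < hi.getD j 0) ∧
    [] ∉ T ∧
    T.flatten.Perm (List.range' 1 T.flatten.length)

/-- The descent composition of a standard Young tableau: `i` is a descent when
`i+1` lies weakly left of `i`. -/
def sytDes (T : List (List ℕ)) : List ℕ :=
  (splitWhen (fun a _ => decide (colOf T (a + 1) ≤ colOf T a))
    (List.range' 1 T.flatten.length)).map List.length

/-- The Schur function `s_λ`, for a partition `λ` given as the list of row lengths
bottom to top. -/
noncomputable def Schur (lam : List ℕ) : (ℕ →₀ ℕ) → ℤ :=
  ∑ᶠ T ∈ {T : List (List ℕ) | IsSYT T ∧ T.map List.length = lam}, Fqs (sytDes T)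

/-! ## Standard key tableaux and Demazure characters. -/

/-- `T` is a standard key tableau of shape the weak composition `a`: rows (listed
bottom to top, with row `i` of length `a_i`, possibly `0`) strictly decrease left to
right, the entries are `1, …, |a|`, and whenever an entry `i` lies above an entry
`k` in the same column with `i < k`, some entry `j` right of `k` satisfies `i < j`. -/
def IsSKT (a : List ℕ) (T : List (List ℕ)) : Prop :=
  T.map List.length = a ∧
    (∀ r ∈ T, r.Chain' (· > ·)) ∧
    T.flatten.Perm (List.range' 1 a.sum) ∧
    ∀ lo hi, lo < hi → hi < T.length →
      ∀ c, c < (T.getD hi []).length → c < (T.getD lo []).length →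
        (T.getD hi []).getD c 0 < (T.getD lo []).getD c 0 →
        ∃ c', c < c' ∧ c' < (T.getD lo []).length ∧
          (T.getD hi []).getD c 0 < (T.getD lo []).getD c' 0

/-- The runs of the word `n ⋯ 2 1` determined by the descents of a standard key
tableau `T` (where `i` is a descent when `i+1` lies weakly right of `i`). -/
def sktRuns (T : List (List ℕ)) : List (List ℕ) :=
  splitWhen (fun _ b => decide (colOf T b ≤ colOf T (b + 1)))
    ((List.range' 1 T.flatten.length).reverse)

/-- The minimal row (1-indexed from the bottom) among the cells of the entries of
`r` in `T`. -/
def minRow (T : List (List ℕ)) (r : List ℕ) : ℕ :=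
  ((r.map (fun e => rowOf T e + 1)).min?).getD 0

/-- The weak descent composition `des(T)` of a standard key tableau; `none` means
`T` is virtual. -/
def desSKT (T : List (List ℕ)) : Option (List ℕ) :=
  (desFromBlocks ((sktRuns T).map (fun r => ((minRow T r : ℕ) : ℤ)))
    ((sktRuns T).map List.length)).map
      (fun d => d ++ List.replicate (T.length - d.length) 0)

/-- The Demazure character (key polynomial) `κ_a`. -/
noncomputable def KeyPoly (a : List ℕ) : (ℕ →₀ ℕ) → ℤ :=
  ∑ᶠ T ∈ {T : List (List ℕ) | IsSKT a T}, FSlideO (desSKT T)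

/-- `κ` extended to virtual indices by `κ_∅ = 0`. -/
noncomputable def KeyPolyO : Option (List ℕ) → (ℕ →₀ ℕ) → ℤ
  | none => 0
  | some a => KeyPoly a

/-! ## Edelman–Greene insertion and weak insertion. -/

/-- Edelman–Greene insertion of `x` into a single row: either append `x`, or bump
the smallest entry exceeding `x` (suppressing the replacement when that entry is
`x+1` and `x` already occurs in the row). -/
def eginsRow (x : ℕ) (row : List ℕ) : List ℕ × Option ℕ :=
  match row.findIdx? (fun z => decide (x < z)) with
  | none => (row ++ [x], none)
  | some j =>
    let y := row.getD j 0
    (if y = x + 1 ∧ row.contains x then row else row.set j x, some y)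

/-- Edelman–Greene insertion of `x` into a tableau (rows bottom to top). -/
def egins : ℕ → List (List ℕ) → List (List ℕ)
  | x, [] => [[x]]
  | x, row :: rest =>
    match eginsRow x row with
    | (r, none) => r :: rest
    | (r, some y) => r :: egins y rest

/-- The Edelman–Greene insertion tableau `P(ρ)` of a word. -/
def PEG (ρ : List ℕ) : List (List ℕ) := ρ.foldl (fun P x => egins x P) []

/-- One sweep of all the maps `drop_i` on a tableau (rows bottom to top). -/
def sweepDropT (T : List (List ℕ)) : List (List ℕ) :=
  (List.range T.length).foldl (fun t i => dropAt (i + 1) t) T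

/-- The drop of a tableau: repeatedly drop until reaching the increasing Young
tableau of the class. -/
def dropCanon (T : List (List ℕ)) : List (List ℕ) :=
  sweepDropT^[T.flatten.length * T.length + 1] T

/-- Weak insertion of the letter `x` into a Yamanouchi key tableau `P`:
`lift (drop P ← x)`. -/
def winsert (x : ℕ) (P : List (List ℕ)) : List (List ℕ) :=
  liftCanon (egins x (dropCanon P))

/-- The weak insertion tableau `P̃(ρ)` (rows bottom to top). -/
def Pweak (ρ : List ℕ) : List (List ℕ) := ρ.foldl (fun P x => winsert x P) []

/-- The Yamanouchi word of the Coxeter–Knuth class of `ρ`: the row reading word of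
`P̃(ρ)`. -/
def yamWord (ρ : List ℕ) : List ℕ := wordOf (Pweak ρ)

/-- The shape (weak composition) of the weak insertion tableau of the first `m`
letters of `ρ`. -/
def shapeAt (ρ : List ℕ) (m : ℕ) : List ℕ :=
  (desWord (wordOf (Pweak (ρ.take m)))).getD []

/-- Append the entry `e` at the end of row `j` (0-indexed from the bottom),
extending with empty rows as needed. -/
def placeEntry (Q : List (List ℕ)) (j e : ℕ) : List (List ℕ) :=
  let Q' := Q ++ List.replicate (j + 1 - Q.length) []
  Q'.set j (Q'.getD j [] ++ [e])

/-- The (0-indexed) row in which the shape grows from `aold` to `anew`. -/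
def growRow (aold anew : List ℕ) : ℕ :=
  ((List.range anew.length).find?
    (fun j => decide (aold.getD j 0 ≠ anew.getD j 0))).getD 0

/-- The weak recording tableau `Q̃(ρ)`: entry `i` is placed in the cell where the
shape grows at the step inserting `ρ_i` (entries are placed in decreasing order). -/
def Qweak (ρ : List ℕ) : List (List ℕ) :=
  (List.range ρ.length).foldl (fun Q m =>
    placeEntry Q (growRow (shapeAt ρ m) (shapeAt ρ (m + 1))) (ρ.length - m)) []

/-! ## Elementary weak dual equivalence involutions. -/

/-- Column reading order on entries: by column, and bottom to top within a column. -/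
def colKeyLe (T : List (List ℕ)) (x y : ℕ) : Bool :=
  decide (colOf T x < colOf T y ∨ (colOf T x = colOf T y ∧ rowOf T x ≤ rowOf T y))

/-- Sort three values by a boolean order. -/
def sort3 (le : ℕ → ℕ → Bool) (a b c : ℕ) : ℕ × ℕ × ℕ :=
  if le a b then
    if le b c then (a, b, c) else if le a c then (a, c, b) else (c, a, b)
  else
    if le a c then (b, a, c) else if le b c then (b, c, a) else (c, b, a)

/-- Relabel the entries `x, y, z` of `T` as `x', y', z'` respectively. -/
def relabel3 (T : List (List ℕ)) (x y z x' y' z' : ℕ) : List (List ℕ) :=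
  T.map (List.map (fun t =>
    if t = x then x' else if t = y then y' else if t = z then z' else t))

/-- The elementary weak dual equivalence involution `d̃_i` on standard key tableaux:
with `u, v, w` the cells of `i−1, i, i+1` in column reading order, if `u` and `w`
share a row and `v` does not, cycle the three entries so that `i` shares a row with
`i ± 1`; else if `v` holds `i+1` swap `i−1, i`; else if `v` holds `i−1` swap
`i, i+1`; otherwise fix `T`. -/
def wde (i : ℕ) (T : List (List ℕ)) : List (List ℕ) :=
  let s := sort3 (colKeyLe T) (i - 1) i (i + 1)
  let u := s.1
  let v := s.2.1
  let w := s.2.2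
  if rowOf T u = rowOf T w ∧ rowOf T v ≠ rowOf T u then
    let T1 := relabel3 T u v w w u v
    let T2 := relabel3 T u v w v w u
    if rowOf T1 i = rowOf T1 (i - 1) ∨ rowOf T1 i = rowOf T1 (i + 1) then T1 else T2
  else if v = i + 1 then relabel3 T (i - 1) i (i + 1) i (i - 1) (i + 1)
  else if v = i - 1 then relabel3 T (i - 1) i (i + 1) (i - 1) (i + 1) i
  else T

/-- Remove trailing zero parts of a weak composition (two weak compositions are
identified when they differ only in trailing zeros). -/
def trimZeros (a : List ℕ) : List ℕ :=
  (a.reverse.dropWhile (fun x => x == 0)).reverse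

/-- The transposition `s_i` acting on compositions by interchanging the parts in
positions `i` and `i+1` (1-indexed). -/
def swapParts (i : ℕ) (c : List ℕ) : List ℕ :=
  if 1 ≤ i ∧ i < c.length then
    (c.set (i - 1) (c.getD i 0)).set i (c.getD (i - 1) 0)
  else c

end EG

namespace EG

set_option linter.unusedSimpArgs false


abbrev Red := IsReducedWord
abbrev Inc (l : List ℕ) : Prop := l.Pairwise (· < ·)

theorem inc_cons {a : ℕ} {l : List ℕ} : Inc (a :: l) ↔ (∀ b ∈ l, a < b) ∧ Inc l := pairwise_cons
theorem inc_append {l m : List ℕ} : Inc (l ++ m) ↔ Inc l ∧ Inc m ∧ ∀ a ∈ l, ∀ b ∈ m, a < b :=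
  pairwise_append
theorem inc_nil : Inc [] := Pairwise.nil

theorem toPerm_nil : toPerm [] = 1 := by simp [toPerm]
theorem toPerm_cons (x : ℕ) (u : List ℕ) : toPerm (x :: u) = Equiv.swap x (x+1) * toPerm u := by
  simp [toPerm]
theorem toPerm_append (u v : List ℕ) : toPerm (u ++ v) = toPerm u * toPerm v := by
  simp [toPerm]

theorem Red.congr {u v : List ℕ} (h : Red u) (hp : ∀ i ∈ v, 1 ≤ i) (ht : toPerm v = toPerm u)
    (hl : v.length ≤ u.length) : Red v :=
  ⟨hp, fun σ hσ e => hl.trans (h.2 σ hσ (e.trans ht))⟩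

theorem Red.mid {a b c : List ℕ} (h : Red (a ++ (b ++ c))) : Red b := by
  refine ⟨fun i hi => h.1 i (by simp [hi]), fun σ hσ e => ?_⟩
  have := h.2 (a ++ (σ ++ c)) (by
    intro i hi
    simp only [mem_append] at hi
    rcases hi with hi | hi | hi
    · exact h.1 i (by simp [hi])
    · exact hσ i hi
    · exact h.1 i (by simp [hi])) (by simp [toPerm_append, e])
  simp at this; omega
theorem Red.left {a b : List ℕ} (h : Red (a ++ b)) : Red a := by
  have : Red ([] ++ (a ++ b)) := by simpa using h
  exact this.mid
theorem Red.right {a b : List ℕ} (h : Red (a ++ b)) : Red b := by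
  have : Red (a ++ (b ++ [])) := by simpa using h
  exact this.mid
theorem red_nil : Red [] := ⟨by simp, by simp⟩

theorem toPerm_comm (x : ℕ) (u : List ℕ) (h : ∀ e ∈ u, e ≠ x ∧ e ≠ x+1 ∧ e+1 ≠ x) :
    toPerm u * Equiv.swap x (x+1) = Equiv.swap x (x+1) * toPerm u := by
  induction u with
  | nil => simp [toPerm_nil]
  | cons e u ih =>
    rw [toPerm_cons, mul_assoc, ih (fun e he => h e (by simp [he])), ← mul_assoc, ← mul_assoc]
    congr 1
    have := h e (by simp)
    refine Equiv.ext fun i => ?_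
    simp only [Equiv.Perm.mul_apply, Equiv.swap_apply_def]
    grind

theorem not_red {A B u : List ℕ} {x : ℕ} (h : ∀ e ∈ u, e ≠ x ∧ e ≠ x+1 ∧ e+1 ≠ x) :
    ¬ Red (A ++ (x :: (u ++ x :: B))) := by
  intro hr
  have h1 : Red ((x :: u ++ [x]) ++ B) := by
    have := hr.right; simpa using this
  have h2 := h1.left
  have := h2.2 u (fun i hi => h2.1 i (by simp [hi])) (by
    rw [toPerm_append, toPerm_cons, ← toPerm_comm x u h, mul_assoc, toPerm_cons]; simp [toPerm_nil])
  simp at this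

theorem red_next {A B l : List ℕ} {a : ℕ} (hr : Red (A ++ (a :: (l ++ a :: B)))) (hi : Inc (a :: l)) :
    ∃ l', l = (a+1) :: l' := by
  rw [inc_cons] at hi
  cases l with
  | nil => exact absurd hr (not_red (u := []) (by simp))
  | cons b l =>
    by_cases hb : b = a+1
    · exact ⟨l, by rw [hb]⟩
    · exfalso
      refine not_red (u := b :: l) ?_ hr
      have h1 := hi.1 b (by simp)
      have h2 := (inc_cons.1 hi.2).1
      intro e he
      rcases mem_cons.1 he with rfl | he
      · omega
      · have := h2 e he; omega

theorem red_prev {A B row : List ℕ} {y : ℕ} (hr : Red (A ++ (y :: (row ++ B)))) (hi : Inc row)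
    (hy : y ∈ row) : y - 1 ∈ row ∧ 1 ≤ y := by
  have hy1 : 1 ≤ y := hr.1 y (by simp)
  refine ⟨?_, hy1⟩
  by_contra hn
  obtain ⟨s, t, rfl⟩ := append_of_mem hy
  rw [inc_append] at hi
  refine not_red (A := A) (B := t ++ B) (u := s) (x := y) ?_ (by simpa using hr)
  intro e he
  have := hi.2.2 e he y (by simp)
  have : e ≠ y - 1 := by rintro rfl; exact hn (by simp [he])
  omega

/-- exchange -/
theorem exchange (u : List ℕ) {i j : ℕ} (hij : i < j) (h : toPerm u j < toPerm u i) :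
    ∃ u' : List ℕ, u'.length + 1 = u.length ∧ (∀ e ∈ u', e ∈ u) ∧
      toPerm u' = toPerm u * Equiv.swap i j := by
  induction u with
  | nil => simp [toPerm_nil] at h; omega
  | cons x v ih =>
    by_cases hv : toPerm v j < toPerm v i
    · obtain ⟨u', h1, h2, h3⟩ := ih hv
      exact ⟨x :: u', by simp [h1], by intro e he; simp at he ⊢; rcases he with h | h
                                       · exact Or.inl h
                                       · exact Or.inr (h2 e h), by rw [toPerm_cons, h3, toPerm_cons, mul_assoc]⟩
    · have hne : toPerm v i ≠ toPerm v j := fun e => by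
        have := (toPerm v).injective e; omega
      refine ⟨v, by simp, by intro e he; simp [he], ?_⟩
      have hx : toPerm v i = x ∧ toPerm v j = x+1 := by
        rw [toPerm_cons, Equiv.Perm.mul_apply, Equiv.Perm.mul_apply] at h
        simp only [Equiv.swap_apply_def] at h
        grind
      have e := Equiv.mul_swap_eq_swap_mul (toPerm v) i j
      rw [hx.1, hx.2] at e
      rw [toPerm_cons, ← e, mul_assoc]; simp

theorem persist (A C : List ℕ) (hr : Red (A ++ C)) {i j : ℕ} (hij : i < j)
    (h : toPerm C j < toPerm C i) : toPerm (A ++ C) j < toPerm (A ++ C) i := by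
  induction A with
  | nil => simpa using h
  | cons x A ih =>
    have hr' : Red (A ++ C) := Red.right (a := [x]) (by simpa using hr)
    have h1 := ih hr'
    by_contra hn
    obtain ⟨u', h2, h3, h4⟩ := exchange _ hij h1
    have hx : toPerm (A ++ C) j = x ∧ toPerm (A ++ C) i = x+1 := by
      rw [cons_append, toPerm_cons, Equiv.Perm.mul_apply, Equiv.Perm.mul_apply] at hn
      have hne : toPerm (A++C) i ≠ toPerm (A++C) j := fun e => by
        have := (toPerm (A++C)).injective e; omega
      simp only [Equiv.swap_apply_def] at hn
      grind
    have := hr.2 u' (fun e he => hr'.1 e (h3 e he)) (by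
      have e := Equiv.mul_swap_eq_swap_mul (toPerm (A ++ C)) i j
      rw [hx.1, hx.2] at e
      rw [h4, cons_append, toPerm_cons, e, Equiv.swap_comm])
    simp at this h2; omega

theorem toPerm_le (u : List ℕ) (M : ℕ) (h : ∀ e ∈ u, e < M) (i : ℕ) :
    (i ≤ M → toPerm u i ≤ M) ∧ (M < i → toPerm u i = i) := by
  induction u with
  | nil => simp [toPerm_nil]
  | cons x u ih =>
    have hx := h x (by simp)
    obtain ⟨h1, h2⟩ := ih (fun e he => h e (by simp [he]))
    rw [toPerm_cons, Equiv.Perm.mul_apply]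
    simp only [Equiv.swap_apply_def]
    grind

theorem max_moved (ρ : List ℕ) (hr : Red ρ) (M : ℕ) (hM : M ∈ ρ) (hmax : ∀ e ∈ ρ, e ≤ M) :
    toPerm ρ (M+1) ≠ M+1 := by
  obtain ⟨s, t, h1, h2⟩ : ∃ s t, ρ = s ++ M :: t ∧ M ∉ t := by
    have := List.mem_iff_append.1 (mem_reverse.2 hM)
    clear hr hmax this
    induction ρ with
    | nil => simp at hM
    | cons a l ih =>
      by_cases hl : M ∈ l
      · obtain ⟨s, t, h, h'⟩ := ih hl
        exact ⟨a :: s, t, by simp [h], h'⟩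
      · have : M = a := by simpa [hl] using hM
        exact ⟨[], l, by simp [this], hl⟩
  subst h1
  have ht : ∀ e ∈ t, e < M := fun e he => lt_of_le_of_ne (hmax e (by simp [he])) (by rintro rfl; exact h2 he)
  set i := (toPerm t).symm M with hi
  have hiM : toPerm t i = M := by simp [hi]
  have h3 : i ≤ M := by
    by_contra h
    have := (toPerm_le t M ht i).2 (by omega); omega
  have h4 : toPerm (M :: t) (M+1) = M := by
    rw [toPerm_cons, Equiv.Perm.mul_apply, (toPerm_le t M ht (M+1)).2 (by omega)]; simp
  have h5 : toPerm (M :: t) i = M+1 := by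
    rw [toPerm_cons, Equiv.Perm.mul_apply, hiM]; simp
  have := persist s (M :: t) hr (i := i) (j := M+1) (by omega) (by omega)
  intro h6
  have := (toPerm_le (s ++ M :: t) (M+1) (fun e he => Nat.lt_succ_of_le (hmax e he)) i).1 (by omega)
  omega

theorem finite_red (w : Equiv.Perm ℕ) : {ρ : List ℕ | ReducedWordFor ρ w}.Finite := by
  rcases Set.eq_empty_or_nonempty {ρ : List ℕ | ReducedWordFor ρ w} with h | ⟨ρ0, h0⟩
  · rw [h]; exact Set.finite_empty
  · obtain ⟨M0, hM0⟩ : ∃ M0, ∀ e ∈ ρ0, e < M0 := ⟨ρ0.sum + 1, fun e he => by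
      have := List.single_le_sum (fun x _ => Nat.zero_le x) e he; omega⟩
    have hfin : Set.Finite ((fun l : List (Fin (M0+1)) => l.map Fin.val) '' {l | l.length = ρ0.length}) :=
      (List.finite_length_eq _ _).image _
    refine hfin.subset ?_
    rintro ρ ⟨hr, hw⟩
    have hlen : ρ.length = ρ0.length :=
      le_antisymm (hr.2 ρ0 h0.1.1 (h0.2.trans hw.symm)) (h0.1.2 ρ hr.1 (hw.trans h0.2.symm))
    have hb : ∀ e ∈ ρ, e < M0 + 1 := by
      by_contra hcon
      push Not at hcon
      obtain ⟨e, he, hge⟩ := hcon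
      obtain ⟨M, hM⟩ : ∃ M, ρ.max? = some M := by
        cases h : ρ.max? with
        | none => rw [List.max?_eq_none_iff] at h; simp [h] at he
        | some M => exact ⟨M, rfl⟩
      rw [List.max?_eq_some_iff] at hM
      have h1 := max_moved ρ hr M hM.1 hM.2
      have h2 := hM.2 e he
      rw [hw, ← h0.2] at h1
      exact h1 ((toPerm_le ρ0 M0 hM0 (M+1)).2 (by omega))
    refine ⟨ρ.pmap (fun e h => (⟨e, h⟩ : Fin (M0+1))) hb, by simp [hlen], ?_⟩
    simp [List.map_pmap]


inductive CK : List ℕ → List ℕ → Prop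
  | refl (u) : CK u u
  | symm {u v} : CK u v → CK v u
  | trans {u v w} : CK u v → CK v w → CK u w
  | cons (x) {u v} : CK u v → CK (x :: u) (x :: v)
  | k1 {x y z : ℕ} (s : List ℕ) : x < y → y < z → CK (x :: z :: y :: s) (z :: x :: y :: s)
  | k2 {x y z : ℕ} (s : List ℕ) : x < y → y < z → CK (y :: x :: z :: s) (y :: z :: x :: s)
  | br (i : ℕ) (s : List ℕ) : CK (i :: (i+1) :: i :: s) ((i+1) :: i :: (i+1) :: s)

theorem CK.left {u v : List ℕ} (s : List ℕ) (h : CK u v) : CK (s ++ u) (s ++ v) := by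
  induction s with
  | nil => exact h
  | cons x s ih => exact CK.cons x ih

theorem CK.right {u v : List ℕ} (s : List ℕ) (h : CK u v) : CK (u ++ s) (v ++ s) := by
  induction h with
  | refl u => exact CK.refl _
  | symm _ ih => exact ih.symm
  | trans _ _ ih1 ih2 => exact ih1.trans ih2
  | cons x _ ih => exact CK.cons x ih
  | k1 s h1 h2 => exact CK.k1 _ h1 h2
  | k2 s h1 h2 => exact CK.k2 _ h1 h2
  | br i s => exact CK.br i _

theorem CK.mem {u v : List ℕ} (h : CK u v) (e : ℕ) : e ∈ u ↔ e ∈ v := by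
  induction h with
  | refl u => rfl
  | symm _ ih => exact ih.symm
  | trans _ _ ih1 ih2 => exact ih1.trans ih2
  | cons x _ ih => simp [ih]
  | k1 s h1 h2 => simp; tauto
  | k2 s h1 h2 => simp; tauto
  | br i s => simp; tauto

theorem CK.length {u v : List ℕ} (h : CK u v) : u.length = v.length := by
  induction h with
  | refl u => rfl
  | symm _ ih => exact ih.symm
  | trans _ _ ih1 ih2 => exact ih1.trans ih2
  | cons x _ ih => simp [ih]
  | _ => simp

theorem swap_comm' (x z : ℕ) (h : x + 1 < z) : Equiv.swap x (x+1) * Equiv.swap z (z+1) =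
    Equiv.swap z (z+1) * Equiv.swap x (x+1) := by
  have := toPerm_comm z [x] (by simp; omega)
  simpa [toPerm] using this

theorem CK.perm {u v : List ℕ} (h : CK u v) : toPerm u = toPerm v := by
  induction h with
  | refl u => rfl
  | symm _ ih => exact ih.symm
  | trans _ _ ih1 ih2 => exact ih1.trans ih2
  | cons x _ ih => simp only [toPerm_cons, ih]
  | k1 s h1 h2 =>
    simp only [toPerm_cons, ← mul_assoc]; rw [swap_comm' _ _ (by omega)]
  | @k2 x y z s h1 h2 => 
    simp only [toPerm_cons, ← mul_assoc]; rw [mul_assoc (Equiv.swap y (y+1)), swap_comm' _ _ (by omega)]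
    simp only [mul_assoc]
  | br i s => 
    simp only [toPerm_cons, ← mul_assoc]
    congr 1
    refine Equiv.ext fun j => ?_
    simp only [Equiv.Perm.mul_apply, Equiv.swap_apply_def]
    grind

theorem CK.red {u v : List ℕ} (h : CK u v) (hr : Red u) : Red v :=
  hr.congr (fun i hi => hr.1 i ((h.mem i).2 hi)) h.perm.symm h.length.symm.le

def ri (x : ℕ) : List ℕ → List ℕ × Option ℕ
  | [] => ([x], none)
  | a :: l => if x < a then (x :: l, some a) else if x = a then (a :: l, some (a+1))
      else (a :: (ri x l).1, (ri x l).2)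

theorem ri_none {x : ℕ} {l : List ℕ} (h : (ri x l).2 = none) : (ri x l).1 = l ++ [x] ∧ ∀ e ∈ l, e < x := by
  induction l with
  | nil => simp [ri]
  | cons a l ih =>
    simp only [ri] at h ⊢
    split_ifs at h ⊢ with h1 h2
    simp only at h ⊢
    obtain ⟨h3, h4⟩ := ih h
    refine ⟨by simp [h3], ?_⟩
    intro e he
    rcases mem_cons.1 he with rfl | he
    · omega
    · exact h4 e he

theorem ri_head (x : ℕ) (l : List ℕ) : ∃ h l', (ri x l).1 = h :: l' ∧ h ≤ x := by
  cases l with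
  | nil => exact ⟨x, [], by simp [ri]⟩
  | cons a l =>
    simp only [ri]
    split_ifs with h1 h2
    · exact ⟨x, l, rfl, le_rfl⟩
    · exact ⟨a, l, rfl, h2.ge⟩
    · exact ⟨a, _, rfl, by omega⟩

theorem ri_mem {x e : ℕ} {l : List ℕ} (h : e ∈ (ri x l).1) : e = x ∨ e ∈ l := by
  induction l with
  | nil => simpa [ri] using h
  | cons a l ih =>
    simp only [ri] at h
    split_ifs at h with h1 h2 <;> simp only [mem_cons] at h ⊢
    · tauto
    · tauto
    · rcases h with h | h
      · tauto
      · have := ih h; tauto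

theorem ri_inc {x : ℕ} {l : List ℕ} (h : Inc l) : Inc (ri x l).1 := by
  induction l with
  | nil => simp [ri, Inc]
  | cons a l ih =>
    have h' := inc_cons.1 h
    simp only [ri]
    split_ifs with h1 h2
    · exact inc_cons.2 ⟨fun b hb => h1.trans (h'.1 b hb), h'.2⟩
    · exact h
    · refine inc_cons.2 ⟨fun b hb => ?_, ih h'.2⟩
      rcases ri_mem hb with rfl | hb
      · omega
      · exact h'.1 b hb

theorem ri_out_gt {x y : ℕ} {l : List ℕ} (h : (ri x l).2 = some y) : x < y := by
  induction l with
  | nil => simp [ri] at h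
  | cons a l ih =>
    simp only [ri] at h
    split_ifs at h with h1 h2
    · simp at h; omega
    · simp at h; omega
    · exact ih h

theorem ck_small {x a : ℕ} {l : List ℕ} (hx : x < a) (h : Inc (a :: l)) :
    CK (a :: (l ++ [x])) (a :: x :: l) := by
  induction l generalizing a with
  | nil => exact CK.refl _
  | cons b l ih =>
    have h' := inc_cons.1 h
    have hab := h'.1 b (by simp)
    have := (ih (hx.trans hab) h'.2).cons a
    exact this.trans (CK.k2 l hx hab).symm

theorem ri_ck {x y : ℕ} {l : List ℕ} (hi : Inc l) (hr : Red (l ++ [x])) (h : (ri x l).2 = some y) :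
    CK (l ++ [x]) (y :: (ri x l).1) := by
  induction l with
  | nil => simp [ri] at h
  | cons a l ih =>
    have hi' := inc_cons.1 hi
    simp only [ri] at h ⊢
    split_ifs at h ⊢ with h1 h2
    · simp only [Option.some.injEq] at h
      subst h
      exact ck_small h1 hi
    · simp only [Option.some.injEq] at h
      subst h h2
      obtain ⟨l', rfl⟩ := red_next (A := []) (B := []) (by simpa using hr) hi
      have h3 := (ck_small (x := x) (by omega) hi'.2).cons x
      exact h3.trans (CK.br x l')
    · have h3 := (ih hi'.2 (Red.right (a := [a]) (by simpa using hr)) h).cons a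
      refine h3.trans ?_
      have h4 := ri_out_gt h
      obtain ⟨c, l', h5, h6⟩ := ri_head x l
      simp only [h5]
      refine CK.k1 l' ?_ (by omega)
      rcases ri_mem (x := x) (l := l) (e := c) (by simp [h5]) with rfl | h7
      · omega
      · exact hi'.1 c h7


def Dom : List ℕ → List ℕ → Prop
  | _, [] => True
  | [], _ :: _ => False
  | a :: lo, b :: hi => a < b ∧ Dom lo hi

@[simp] theorem dom_nil (l : List ℕ) : Dom l [] := by cases l <;> trivial
@[simp] theorem dom_cons (a b : ℕ) (l m : List ℕ) : Dom (a :: l) (b :: m) ↔ a < b ∧ Dom l m := Iff.rfl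
@[simp] theorem dom_nil_cons (b : ℕ) (m : List ℕ) : ¬ Dom [] (b :: m) := id

theorem Dom.len {l m : List ℕ} (h : Dom l m) : m.length ≤ l.length := by
  induction l generalizing m with
  | nil => cases m <;> simp_all
  | cons a l ih =>
    cases m with
    | nil => simp
    | cons b m => simpa using ih h.2

def Tab : List (List ℕ) → Prop
  | [] => True
  | r :: R => Inc r ∧ Dom r (R.headD []) ∧ Tab R
def NE (P : List (List ℕ)) : Prop := ∀ r ∈ P, r ≠ []

def ins : ℕ → List (List ℕ) → List (List ℕ)
  | x, [] => [[x]]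
  | x, r :: R => (ri x r).1 :: (match (ri x r).2 with | none => R | some y => ins y R)
def gc : ℕ → List (List ℕ) → ℕ
  | _, [] => 0
  | x, r :: R => (match (ri x r).2 with | none => r.length | some y => gc y R)

theorem ins_none {x : ℕ} {r : List ℕ} {R} (h : (ri x r).2 = none) : ins x (r :: R) = (ri x r).1 :: R := by
  simp [ins, h]
theorem ins_some {x y : ℕ} {r : List ℕ} {R} (h : (ri x r).2 = some y) :
    ins x (r :: R) = (ri x r).1 :: ins y R := by
  simp [ins, h]
theorem gc_none {x : ℕ} {r : List ℕ} {R} (h : (ri x r).2 = none) : gc x (r :: R) = r.length := by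
  simp [gc, h]
theorem gc_some {x y : ℕ} {r : List ℕ} {R} (h : (ri x r).2 = some y) :
    gc x (r :: R) = gc y R := by
  simp [gc, h]

theorem ins_headD (x : ℕ) (P : List (List ℕ)) : (ins x P).headD [] = (ri x (P.headD [])).1 := by
  cases P <;> simp [ins, ri]

theorem ri_dom_lower {x : ℕ} {l t : List ℕ} (h : Dom l t) : Dom (ri x l).1 t := by
  induction l generalizing t with
  | nil => cases t <;> simp_all
  | cons a l ih =>
    cases t with
    | nil => simp
    | cons b t =>
      simp only [ri]
      split_ifs with h1 h2
      · exact ⟨h1.trans h.1, h.2⟩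
      · exact h
      · exact ⟨h.1, ih h.2⟩

theorem ri_dom {x y : ℕ} {r s : List ℕ} (h : Dom r s) (hy : (ri x r).2 = some y) :
    Dom (ri x r).1 (ri y s).1 := by
  induction r generalizing s with
  | nil => simp [ri] at hy
  | cons a l ih =>
    cases s with
    | nil =>
      obtain ⟨c, l', h5, h6⟩ := ri_head x (a :: l)
      have := ri_out_gt hy
      rw [h5]
      simp only [ri, dom_cons]
      exact ⟨by omega, by simp⟩
    | cons b t =>
      obtain ⟨hab, h⟩ := h
      have hlow := ri_dom_lower (x := x) h
      simp only [ri] at hy ⊢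
      by_cases h1 : x < a
      · simp only [if_pos h1, Option.some.injEq] at hy ⊢
        subst hy; simp only [if_pos hab]; exact ⟨h1, h⟩
      · by_cases h2 : x = a
        · simp only [if_neg h1, if_pos h2, Option.some.injEq] at hy ⊢
          subst hy
          split_ifs
          · exact ⟨by omega, h⟩
          · exact ⟨by omega, h⟩
          · omega
        · simp only [if_neg h1, if_neg h2] at hy ⊢
          have := ri_out_gt hy
          split_ifs
          · exact ⟨by omega, hlow⟩
          · exact ⟨by omega, hlow⟩
          · exact ⟨by omega, ih h hy⟩

theorem tab_ins {P : List (List ℕ)} (x : ℕ) (h : Tab P) : Tab (ins x P) := by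
  induction P generalizing x with
  | nil => simp [ins, Tab, Inc]
  | cons r R ih =>
    obtain ⟨h1, h2, h3⟩ := h
    cases ho : (ri x r).2 with
    | none => rw [ins_none ho]; exact ⟨ri_inc h1, ri_dom_lower h2, h3⟩
    | some y => rw [ins_some ho]; exact ⟨ri_inc h1, by rw [ins_headD]; exact ri_dom h2 ho, ih y h3⟩

theorem ins_ne_nil (x : ℕ) (P : List (List ℕ)) : ins x P ≠ [] := by cases P <;> simp [ins]

theorem ne_ins {P : List (List ℕ)} (x : ℕ) (h : NE P) : NE (ins x P) := by
  induction P generalizing x with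
  | nil => simp [ins, NE]
  | cons r R ih =>
    have hR : NE R := fun s hs => h s (by simp [hs])
    obtain ⟨c, l', h5, h6⟩ := ri_head x r
    cases ho : (ri x r).2 with
    | none => rw [ins_none ho, h5]; intro s hs; rcases mem_cons.1 hs with rfl | hs
              · simp
              · exact hR s hs
    | some y => rw [ins_some ho, h5]; intro s hs; rcases mem_cons.1 hs with rfl | hs
                · simp
                · exact ih y hR s hs

theorem gc_lt {P : List (List ℕ)} (x : ℕ) (h : Tab P) : gc x P < ((ins x P).headD []).length := by
  induction P generalizing x with
  | nil => simp [gc, ins]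
  | cons r R ih =>
    have hT := tab_ins x h
    obtain ⟨h1, h2, h3⟩ := h
    cases ho : (ri x r).2 with
    | none => rw [ins_none ho, gc_none ho]; simp [(ri_none ho).1]
    | some y =>
      rw [ins_some ho] at hT ⊢
      rw [gc_some ho]
      exact (ih y h3).trans_le hT.2.1.len

theorem wordOf_cons (r : List ℕ) (R) : wordOf (r :: R) = wordOf R ++ r := by simp [wordOf]
theorem wordOf_nil : wordOf [] = [] := rfl

theorem ins_ck {P : List (List ℕ)} {x : ℕ} (h : Tab P) (hr : Red (wordOf P ++ [x])) :
    CK (wordOf P ++ [x]) (wordOf (ins x P)) := by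
  induction P generalizing x with
  | nil => simp [ins, wordOf]; exact CK.refl _
  | cons r R ih =>
    obtain ⟨h1, h2, h3⟩ := h
    rw [wordOf_cons, append_assoc] at hr ⊢
    cases ho : (ri x r).2 with
    | none => rw [ins_none ho, wordOf_cons, (ri_none ho).1]; exact CK.refl _
    | some y =>
      have hc := (ri_ck h1 hr.right ho).left (wordOf R)
      have hr' := hc.red hr
      have e : wordOf R ++ y :: (ri x r).1 = (wordOf R ++ [y]) ++ (ri x r).1 := by simp
      rw [e] at hc hr'
      rw [ins_some ho, wordOf_cons]
      exact hc.trans ((ih h3 hr'.left).right _)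

def PT (u : List ℕ) : List (List ℕ) := u.foldr ins []
theorem PT_cons (x : ℕ) (u : List ℕ) : PT (x :: u) = ins x (PT u) := rfl
theorem PT_nil : PT [] = [] := rfl
theorem PT_tab (u : List ℕ) : Tab (PT u) := by
  induction u with
  | nil => trivial
  | cons x u ih => exact tab_ins x ih
theorem PT_ne (u : List ℕ) : NE (PT u) := by
  induction u with
  | nil => simp [PT_nil, NE]
  | cons x u ih => exact ne_ins x ih
theorem PT_ck {u : List ℕ} (h : Red u.reverse) : CK u.reverse (wordOf (PT u)) := by
  induction u with
  | nil => exact CK.refl _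
  | cons x u ih =>
    rw [reverse_cons] at h ⊢
    have h1 := (ih h.left).right [x]
    exact h1.trans (ins_ck (PT_tab u) (h1.red h))
theorem PT_red {u : List ℕ} {x : ℕ} (h : Red (x :: u).reverse) : Red (wordOf (PT u) ++ [x]) := by
  rw [reverse_cons] at h
  exact ((PT_ck h.left).right [x]).red h

/-! Pieri -/
theorem ri_out_gt' {x y b : ℕ} {l : List ℕ} (hb : ∀ e ∈ l, b < e) (h : (ri x l).2 = some y) : b < y := by
  induction l with
  | nil => simp [ri] at h
  | cons a l ih =>
    have := hb a (by simp)
    simp only [ri] at h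
    split_ifs at h with h1 h2
    · simp at h; omega
    · simp at h; omega
    · exact ih (fun e he => hb e (by simp [he])) h

theorem ri_lt {x1 x2 : ℕ} {r : List ℕ} (h : Inc r) (hx : x1 < x2) :
    ((ri x1 r).2 = none → (ri x2 (ri x1 r).1).2 = none) ∧
    ∀ y1 y2, (ri x1 r).2 = some y1 → (ri x2 (ri x1 r).1).2 = some y2 → y1 < y2 := by
  induction r with
  | nil => simp only [ri]; rw [if_neg (by omega), if_neg (by omega)]; simp
  | cons a l ih =>
    have h' := inc_cons.1 h
    have ih := ih h'.2
    simp only [ri]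
    by_cases h1 : x1 < a
    · rw [if_pos h1]
      simp only [ri, if_neg (show ¬ x2 < x1 by omega), if_neg (show ¬ x2 = x1 by omega)]
      refine ⟨by simp, fun y1 y2 e1 e2 => ?_⟩
      simp at e1; subst e1
      exact ri_out_gt' h'.1 e2
    · rw [if_neg h1]
      by_cases h2 : x1 = a
      · rw [if_pos h2]
        simp only [ri, if_neg (show ¬ x2 < a by omega), if_neg (show ¬ x2 = a by omega)]
        refine ⟨by simp, fun y1 y2 e1 e2 => ?_⟩
        simp at e1
        have := ri_out_gt e2; omega
      · rw [if_neg h2]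
        simp only [ri, if_neg (show ¬ x2 < a by omega), if_neg (show ¬ x2 = a by omega)]
        exact ih

theorem ri_ge {x1 x2 : ℕ} {r : List ℕ} (hx : x2 ≤ x1) :
    ∃ y2, (ri x2 (ri x1 r).1).2 = some y2 ∧ ∀ y1, (ri x1 r).2 = some y1 → y2 ≤ y1 := by
  induction r with
  | nil => simp only [ri]; split_ifs <;> simp; omega
  | cons a l ih =>
    by_cases h1 : x1 < a
    · simp only [ri, if_pos h1]
      split_ifs <;> simp <;> omega
    · by_cases h2 : x1 = a
      · simp only [ri, if_neg h1, if_pos h2]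
        split_ifs <;> simp; omega
      · simp only [ri, if_neg h1, if_neg h2]
        split_ifs with h3 h4
        · refine ⟨a, rfl, fun y1 hy => ?_⟩
          have := ri_out_gt hy; omega
        · refine ⟨a+1, rfl, fun y1 hy => ?_⟩
          have := ri_out_gt hy; omega
        · exact ih

theorem pieri_lt {P : List (List ℕ)} {x1 x2 : ℕ} (h : Tab P) (hx : x1 < x2) :
    gc x1 P < gc x2 (ins x1 P) := by
  induction P generalizing x1 x2 with
  | nil =>
    simp only [gc, ins, ri, if_neg (show ¬ x2 < x1 by omega), if_neg (show ¬ x2 = x1 by omega)]; simp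
  | cons r R ih =>
    have hT := tab_ins x1 h
    obtain ⟨h1, h2, h3⟩ := h
    obtain ⟨a1, a2⟩ := ri_lt h1 hx
    cases ho : (ri x1 r).2 with
    | none =>
      rw [ins_none ho, gc_none ho, gc_none (a1 ho), (ri_none ho).1]; simp
    | some y1 =>
      rw [ins_some ho, gc_some ho]
      rw [ins_some ho] at hT
      cases ho2 : (ri x2 (ri x1 r).1).2 with
      | none => rw [gc_none ho2]; exact (gc_lt y1 h3).trans_le hT.2.1.len
      | some y2 => rw [gc_some ho2]; exact ih h3 (a2 _ _ ho ho2)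

theorem ri_len {x : ℕ} {r : List ℕ} : (ri x r).1.length = r.length + (if (ri x r).2 = none then 1 else 0) := by
  induction r with
  | nil => simp [ri]
  | cons a l ih => simp only [ri]; split_ifs <;> simp_all

theorem ri_len_none {x : ℕ} {r : List ℕ} (h : (ri x r).2 = none) : (ri x r).1.length = r.length + 1 := by
  rw [ri_len, if_pos h]
theorem ri_len_some {x y : ℕ} {r : List ℕ} (h : (ri x r).2 = some y) : (ri x r).1.length = r.length := by
  rw [ri_len, if_neg (by simp [h])]; rfl

theorem pieri_ge {P : List (List ℕ)} {x1 x2 : ℕ} (h : Tab P) (hx : x2 ≤ x1) :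
    gc x2 (ins x1 P) ≤ gc x1 P := by
  induction P generalizing x1 x2 with
  | nil =>
    simp only [gc, ins, ri]; split_ifs <;> simp; omega
  | cons r R ih =>
    have hT := tab_ins x2 (tab_ins x1 h)
    obtain ⟨h1, h2, h3⟩ := h
    obtain ⟨y2, ho2, a2⟩ := ri_ge (r := r) hx
    cases ho : (ri x1 r).2 with
    | none =>
      rw [ins_none ho, gc_none ho, gc_some ho2]
      rw [ins_none ho, ins_some ho2] at hT
      have := (gc_lt y2 h3).trans_le hT.2.1.len
      rw [ri_len_some ho2, ri_len_none ho] at this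
      omega
    | some y1 =>
      rw [ins_some ho, gc_some ho, gc_some ho2]
      exact ih h3 (a2 _ ho)

/-! injectivity -/
theorem red_gd {A r : List ℕ} {x : ℕ} (hi : Inc r) (hr : Red (A ++ (r ++ [x]))) (hx : x ∈ r) : x + 1 ∈ r := by
  obtain ⟨s, t, rfl⟩ := append_of_mem hx
  obtain ⟨l', h⟩ := red_next (A := A ++ s) (B := []) (a := x) (l := t) (by simpa using hr) (inc_append.1 hi).2.1
  simp [h]

theorem ri_inj {x x' y : ℕ} {r r' : List ℕ} (hi : Inc r) (hi' : Inc r') (hg : x ∈ r → x+1 ∈ r)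
    (hg' : x' ∈ r' → x' + 1 ∈ r') (h1 : (ri x r).1 = (ri x' r').1) (h2 : (ri x r).2 = some y)
    (h3 : (ri x' r').2 = some y) : x = x' ∧ r = r' := by
  induction r generalizing r' with
  | nil => simp [ri] at h2
  | cons a l ih =>
    cases r' with
    | nil => simp [ri] at h3
    | cons a' l' =>
      have hi1 := inc_cons.1 hi
      have hi1' := inc_cons.1 hi'
      simp only [ri] at h1 h2 h3
      split_ifs at h1 h2 h3 with c1 c2 c3 c4 c5 c6 c7 c8 <;> simp only [cons.injEq, Option.some.injEq] at h1 h2 h3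
      · grind
      · exfalso
        have := hg' (by simp [c3])
        have := hi1.1 (x'+1)
        grind
      · exfalso
        obtain ⟨c, m, e1, e2⟩ := ri_head x' l'
        have := ri_out_gt h3
        have := hi1.1 c (by rw [h1.2, e1]; simp)
        omega
      · exfalso
        have := hg (by simp [c4])
        have := hi1'.1 (x+1)
        grind
      · grind
      · exfalso
        have := ri_out_gt h3
        omega
      · exfalso
        obtain ⟨c, m, e1, e2⟩ := ri_head x l
        have := ri_out_gt h2
        have := hi1'.1 c (by rw [← h1.2, e1]; simp)
        omega
      · exfalso
        have := ri_out_gt h2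
        omega
      · have := ih hi1.2 hi1'.2 (fun hx => by
            have := hg (by simp [hx])
            rcases mem_cons.1 this with h | h
            · omega
            · exact h) (fun hx => by
            have := hg' (by simp [hx])
            rcases mem_cons.1 this with h | h
            · omega
            · exact h) h1.2 h2 h3
        simp [h1.1, this]

theorem ins_inj_aux {x x' : ℕ} {r r' : List ℕ} {R R'} (hP : Tab (r :: R)) (hP' : Tab (r' :: R'))
    (ho : (ri x r).2 = none) (ho' : (ri x' r').2 ≠ none)
    (h : ins x (r :: R) = ins x' (r' :: R')) (hg : gc x (r :: R) = gc x' (r' :: R')) : False := by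
  cases ho2 : (ri x' r').2 with
  | none => exact ho' ho2
  | some y' =>
    rw [ins_none ho, ins_some ho2, cons.injEq] at h
    rw [gc_none ho, gc_some ho2] at hg
    have h1 := gc_lt y' hP'.2.2
    rw [← h.2] at h1
    have := hP.2.1.len
    omega

theorem ins_inj {x x' : ℕ} {P P' : List (List ℕ)} (hP : Tab P) (hP' : Tab P') (hn : NE P) (hn' : NE P')
    (hr : Red (wordOf P ++ [x])) (hr' : Red (wordOf P' ++ [x']))
    (h : ins x P = ins x' P') (hg : gc x P = gc x' P') : x = x' ∧ P = P' := by
  induction P generalizing x x' P' with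
  | nil =>
    cases P' with
    | nil => simpa [ins] using h
    | cons r' R' =>
      exfalso
      cases ho' : (ri x' r').2 with
      | none =>
        rw [ins_none ho', (ri_none ho').1] at h
        have := congrArg (fun l => (l.headD []).length) h
        simp [ins] at this
        exact hn' r' (by simp) this
      | some y' =>
        rw [ins_some ho'] at h
        simp [ins] at h
        exact absurd h.2 (by simpa using (ins_ne_nil y' R').symm)
  | cons r R ih =>
    cases P' with
    | nil =>
      exfalso
      cases ho : (ri x r).2 with
      | none =>
        rw [ins_none ho, (ri_none ho).1] at h
        have := congrArg (fun l => (l.headD []).length) h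
        simp [ins] at this
        exact hn r (by simp) this
      | some y =>
        rw [ins_some ho] at h
        simp [ins] at h
        exact ins_ne_nil _ _ h.2
    | cons r' R' =>
      cases ho : (ri x r).2 with
      | none =>
        cases ho' : (ri x' r').2 with
        | some y' => exact (ins_inj_aux hP hP' ho (by simp [ho']) h hg).elim
        | none =>
          rw [ins_none ho, ins_none ho', (ri_none ho).1, (ri_none ho').1, cons.injEq] at h
          have := append_inj' h.1 rfl
          simp at this
          simp [this, h.2]
      | some y =>
        cases ho' : (ri x' r').2 with
        | none => exact (ins_inj_aux hP' hP ho' (by simp [ho]) h.symm hg.symm).elim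
        | some y' =>
          rw [ins_some ho, ins_some ho', cons.injEq] at h
          rw [gc_some ho, gc_some ho'] at hg
          rw [wordOf_cons, append_assoc] at hr hr'
          have a1 := ((ri_ck hP.1 hr.right ho).left (wordOf R)).red hr
          have a1' := ((ri_ck hP'.1 hr'.right ho').left (wordOf R')).red hr'
          obtain ⟨rfl, rfl⟩ := ih hP.2.2 hP'.2.2 (fun s hs => hn s (by simp [hs])) (fun s hs => hn' s (by simp [hs]))
            (Red.left (b := (ri x r).1) (by simpa using a1)) (Red.left (b := (ri x' r').1) (by simpa using a1')) h.2 hg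
          obtain ⟨rfl, rfl⟩ := ri_inj hP.1 hP'.1 (red_gd hP.1 hr) (red_gd hP'.1 hr') h.1 ho ho'
          exact ⟨rfl, rfl⟩

/-! inverse -/
theorem ri_inv {y a : ℕ} {l : List ℕ} (hi : Inc (a :: l)) (hr : Red (y :: a :: l)) (ha : a < y) :
    ∃ x r, Inc r ∧ (ri x r).1 = a :: l ∧ (ri x r).2 = some y ∧ Red (r ++ [x]) ∧
      CK (y :: a :: l) (r ++ [x]) ∧ (∀ e ∈ r, e ∈ a :: l ∨ e = y) := by
  suffices H : ∃ x r, Inc r ∧ (ri x r).1 = a :: l ∧ (ri x r).2 = some y ∧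
      CK (y :: a :: l) (r ++ [x]) ∧ (∀ e ∈ r, e ∈ a :: l ∨ e = y) by
    obtain ⟨x, r, h1, h2, h3, h4, h5⟩ := H
    exact ⟨x, r, h1, h2, h3, h4.red hr, h4, h5⟩
  have hi' := inc_cons.1 hi
  induction l generalizing a with
  | nil =>
    exact ⟨a, [y], by simp [Inc], by simp [ri, ha], by simp [ri, ha], CK.refl _, by simp⟩
  | cons b l ih =>
    have hab := hi'.1 b (by simp)
    have hib := inc_cons.1 hi'.2
    rcases lt_trichotomy y b with hyb | rfl | hyb
    · have hy : Inc (y :: b :: l) := inc_cons.2 ⟨by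
        intro e he; rcases mem_cons.1 he with rfl | he
        · exact hyb
        · exact hyb.trans (hib.1 e he), hi'.2⟩
      refine ⟨a, y :: b :: l, hy, by simp [ri, ha], by simp [ri, ha], (ck_small ha hy).symm, ?_⟩
      intro e he; simp at he ⊢; tauto
    · have := red_prev (A := []) (B := []) (y := y) (row := a :: y :: l) (by simpa using hr) hi (by simp)
      have hay : y = a + 1 := by
        have h0 := this.1
        simp only [mem_cons] at h0
        rcases h0 with h | h | h
        · omega
        · omega
        · have := hib.1 _ h; omega
      subst hay
      refine ⟨a, a :: (a+1) :: l, hi, by simp [ri], by simp [ri], ?_, by intro e he; exact Or.inl he⟩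
      exact (CK.br a l).symm.trans ((ck_small ha hi'.2).symm.cons a)
    · have hc : CK (y :: a :: b :: l) (a :: y :: b :: l) := (CK.k1 l hab hyb).symm
      obtain ⟨x, r, h1, h2, h3, h4, h5⟩ := ih hi'.2 (Red.right (a := [a]) (hc.red hr)) hyb hib
      have hbx : b ≤ x := by
        obtain ⟨c, m, e1, e2⟩ := ri_head x r
        rw [h2] at e1
        simp at e1; omega
      refine ⟨x, a :: r, ?_, ?_, ?_, hc.trans (h4.cons a), ?_⟩
      · refine inc_cons.2 ⟨fun e he => ?_, h1⟩
        rcases h5 e he with h | rfl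
        · exact hi'.1 e h
        · omega
      · simp only [ri, if_neg (show ¬ x < a by omega), if_neg (show ¬ x = a by omega), h2]
      · simp only [ri, if_neg (show ¬ x < a by omega), if_neg (show ¬ x = a by omega), h3]
      · intro e he
        rcases mem_cons.1 he with rfl | he
        · simp
        · have := h5 e he; simp at this ⊢; tauto

theorem dom_inv {x y : ℕ} {r s : List ℕ} (hi : Inc r) (his : Inc s) (hg : y ∈ s → y + 1 ∈ s)
    (hy : (ri x r).2 = some y) (h : Dom (ri x r).1 (ri y s).1) : Dom r s := by
  induction r generalizing s with
  | nil => simp [ri] at hy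
  | cons a l ih =>
    have hi' := inc_cons.1 hi
    cases s with
    | nil => simp
    | cons b t =>
      have his' := inc_cons.1 his
      simp only [ri] at hy h
      by_cases h1 : x < a
      · simp only [if_pos h1, Option.some.injEq] at hy h
        subst hy
        rcases lt_trichotomy a b with hab | rfl | hab
        · simp only [if_pos hab, dom_cons] at h; exact ⟨hab, h.2⟩
        · exfalso
          simp only [lt_irrefl, if_false, if_true, dom_cons] at h
          have := hg (by simp)
          cases t with
          | nil => simp at this
          | cons c t =>
            cases l with
            | nil => exact h.2
            | cons d l =>
              have h3 := h.2.1
              have h4 := hi'.1 d (by simp)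
              have h5 := his'.1 c (by simp)
              have h6 := (inc_cons.1 his'.2).1
              simp only [mem_cons] at this
              rcases this with h | h | h
              · omega
              · omega
              · have := h6 _ h; omega
        · exfalso
          simp only [if_neg (show ¬ a < b by omega), if_neg (show ¬ a = b by omega), dom_cons] at h
          obtain ⟨c, m, e1, e2⟩ := ri_head a t
          rw [e1] at h
          cases l with
          | nil => exact h.2
          | cons d l =>
            have := hi'.1 d (by simp)
            have := h.2.1
            omega
      · by_cases h2 : x = a
        · simp only [if_neg h1, if_pos h2, Option.some.injEq] at hy h
          subst hy
          split_ifs at h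
          · exact ⟨by omega, h.2⟩
          · exact h
          · have := h.1; omega
        · simp only [if_neg h1, if_neg h2] at hy h
          by_cases hyb : b < y
          · simp only [if_neg (show ¬ y < b by omega), if_neg (show ¬ y = b by omega), dom_cons] at h
            refine ⟨h.1, ih hi'.2 his'.2 (fun hh => ?_) hy h.2⟩
            have := hg (by simp [hh])
            rcases mem_cons.1 this with h | h
            · omega
            · exact h
          · have hd : Dom (ri x l).1 t ∧ a < b := by
              split_ifs at h
              · exact ⟨h.2, by have := h.1; omega⟩
              · exact ⟨h.2, by have := h.1; omega⟩
              · omega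
            refine ⟨hd.2, ?_⟩
            cases t with
            | nil => simp
            | cons c t =>
              have hbc := his'.1 c (by simp)
              refine ih hi'.2 his'.2 (fun hh => ?_) hy ?_
              · rcases mem_cons.1 hh with h | h
                · omega
                · have := (inc_cons.1 his'.2).1 _ h; omega
              · obtain ⟨d, m, e1, e2⟩ := ri_head x l
                have := ri_out_gt hy
                simp only [e1, ri, if_pos (show y < c by omega)] at hd ⊢
                exact ⟨by omega, hd.1.2⟩

theorem ri_append {x : ℕ} {r : List ℕ} (h : ∀ e ∈ r, e < x) : ri x r = (r ++ [x], none) := by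
  induction r with
  | nil => simp [ri]
  | cons a l ih =>
    have := h a (by simp)
    simp only [ri, if_neg (show ¬ x < a by omega), if_neg (show ¬ x = a by omega),
      ih (fun e he => h e (by simp [he]))]
    simp

theorem dom_take {r t s : List ℕ} (h : Dom (r ++ t) s) (hl : s.length ≤ r.length) : Dom r s := by
  induction r generalizing s with
  | nil => cases s <;> simp_all
  | cons a r ih =>
    cases s with
    | nil => simp
    | cons b s => exact ⟨h.1, ih h.2 (by simpa using hl)⟩

theorem ins_inv {Q : List (List ℕ)} {j : ℕ} (hT : Tab Q) (hn : NE Q) (hr : Red (wordOf Q))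
    (hj : ∃ r ∈ Q, r.length = j + 1) :
    ∃ x P, Tab P ∧ NE P ∧ ins x P = Q ∧ gc x P = j ∧ Red (wordOf P ++ [x]) := by
  induction Q with
  | nil => simp at hj
  | cons q Q ih =>
    obtain ⟨h1, h2, h3⟩ := hT
    have hnQ : NE Q := fun s hs => hn s (by simp [hs])
    rw [wordOf_cons] at hr
    by_cases hQ : ∃ r ∈ Q, r.length = j + 1
    · obtain ⟨y, P, a1, a2, a3, a4, a5⟩ := ih h3 hnQ hr.left hQ
      have hck := (ins_ck a1 a5)
      rw [a3] at hck
      have hr2 : Red (wordOf P ++ [y] ++ q) := (hck.symm.right q).red hr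
      have hr3 : Red (wordOf P ++ (y :: q)) := by simpa using hr2
      have hhd := ins_headD y P
      rw [a3] at hhd
      rw [hhd] at h2
      cases q with
      | nil => exact absurd rfl (hn [] (by simp))
      | cons a l =>
        obtain ⟨c, m, e1, e2⟩ := ri_head y (P.headD [])
        have hay : a < y := by
          rw [e1] at h2; have := h2.1; omega
        obtain ⟨x, r, b1, b2, b3, b4, b5, b6⟩ := ri_inv h1 hr3.right hay
        have hincP : Inc (P.headD []) := by
          cases P with
          | nil => exact inc_nil
          | cons p P => exact a1.1
        refine ⟨x, r :: P, ⟨b1, ?_, a1⟩, ?_, ?_, ?_, ?_⟩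
        · refine dom_inv b1 hincP ?_ b3 (by rw [b2]; exact h2)
          cases P with
          | nil => simp
          | cons p P =>
            rw [wordOf_cons, append_assoc] at a5
            exact red_gd a1.1 a5
        · intro s hs
          rcases mem_cons.1 hs with rfl | hs
          · rintro rfl; simp [ri] at b3
          · exact a2 s hs
        · rw [ins_some b3, b2, a3]
        · rw [gc_some b3, a4]
        · rw [wordOf_cons, append_assoc]
          exact (b5.left (wordOf P)).red hr3
    · obtain ⟨r0, hr0, hlen⟩ := hj
      have hq : q.length = j + 1 := by
        rcases mem_cons.1 hr0 with rfl | h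
        · exact hlen
        · exact absurd ⟨r0, h, hlen⟩ hQ
      obtain ⟨r, x, rfl⟩ : ∃ r x, q = r ++ [x] := by
        rcases eq_nil_or_concat q with h | ⟨r, x, h⟩
        · simp [h] at hq
        · exact ⟨r, x, by simpa using h⟩
      have hlt : ∀ e ∈ r, e < x := fun e he => (inc_append.1 h1).2.2 e he x (by simp)
      have hrl : r.length = j := by simpa using hq
      by_cases hre : r = []
      · subst hre
        have hQn : Q = [] := by
          cases Q with
          | nil => rfl
          | cons s Q =>
            exfalso
            have := h2.len
            have h4 := hnQ s (by simp)
            refine hQ ⟨s, by simp, ?_⟩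
            have : 0 < s.length := length_pos_iff.2 h4
            simp at *; omega
        subst hQn
        exact ⟨x, [], trivial, by simp [NE], rfl, by simpa [gc] using hrl, by simpa [wordOf] using hr⟩
      · refine ⟨x, r :: Q, ⟨(inc_append.1 h1).1, ?_, h3⟩, ?_, ?_, ?_, ?_⟩
        · refine dom_take h2 ?_
          have := h2.len
          cases Q with
          | nil => simp
          | cons s Q =>
            have : s.length ≠ j + 1 := fun h => hQ ⟨s, by simp, h⟩
            simp at *; omega
        · intro s hs
          rcases mem_cons.1 hs with rfl | hs
          · exact hre
          · exact hnQ s hs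
        · rw [ins_none (by rw [ri_append hlt]), ri_append hlt]
        · rw [gc_none (by rw [ri_append hlt]), hrl]
        · rw [wordOf_cons, append_assoc]; exact hr


def rwd : List ℕ → List ℕ → List ℕ × List ℕ
  | r, [] => (r, [])
  | r, x :: w => ((rwd (ri x r).1 w).1, (ri x r).2.toList ++ (rwd (ri x r).1 w).2)

def T3 (u v : List ℕ) : Prop :=
  (∃ x y z, x < y ∧ y < z ∧ u = [x,z,y] ∧ v = [z,x,y]) ∨
  (∃ x y z, x < y ∧ y < z ∧ u = [y,x,z] ∧ v = [y,z,x]) ∨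
  (∃ i, u = [i,i+1,i] ∧ v = [i+1,i,i+1])
def Eq3 (u v : List ℕ) : Prop := u = v ∨ T3 u v ∨ T3 v u

theorem T3.ck {u v : List ℕ} (h : T3 u v) : CK u v := by
  rcases h with ⟨x, y, z, h1, h2, rfl, rfl⟩ | ⟨x, y, z, h1, h2, rfl, rfl⟩ | ⟨i, rfl, rfl⟩
  · exact CK.k1 [] h1 h2
  · exact CK.k2 [] h1 h2
  · exact CK.br i []

theorem ri_c1 {x a : ℕ} {l} (h : x < a) : ri x (a :: l) = (x :: l, some a) := by simp [ri, h]
theorem ri_c2 {a : ℕ} {l} : ri a (a :: l) = (a :: l, some (a+1)) := by simp [ri]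
theorem ri_c3 {x a : ℕ} {l} (h : a < x) : ri x (a :: l) = (a :: (ri x l).1, (ri x l).2) := by
  simp [ri, show ¬ x < a by omega, show ¬ x = a by omega]

theorem rwd_big {a : ℕ} {l u : List ℕ} (h : ∀ e ∈ u, a < e) :
    rwd (a :: l) u = (a :: (rwd l u).1, (rwd l u).2) := by
  induction u generalizing l with
  | nil => simp [rwd]
  | cons x u ih =>
    have := h x (by simp)
    simp [rwd, ri_c3 this, ih (fun e he => h e (by simp [he]))]

theorem ri_gt {x1 x2 : ℕ} {r : List ℕ} (hx : x2 < x1) {y1 y2} (h1 : (ri x1 r).2 = some y1)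
     (h2 : (ri x2 (ri x1 r).1).2 = some y2) : y2 < y1 := by
  induction r with
  | nil => simp [ri] at h1
  | cons a l ih =>
    rcases lt_trichotomy x1 a with h | rfl | h
    · simp [ri_c1 h, ri_c1 hx] at h1 h2; omega
    · simp [ri_c2, ri_c1 hx] at h1 h2; omega
    · simp only [ri_c3 h] at h1 h2
      have := ri_out_gt h1
      rcases lt_trichotomy x2 a with h' | rfl | h'
      · simp [ri_c1 h'] at h2; omega
      · simp [ri_c2] at h2; omega
      · simp only [ri_c3 h'] at h2; exact ih h1 h2

theorem rwd_ck {r u : List ℕ} (hi : Inc r) (hr : Red (r ++ u)) :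
    CK (r ++ u) ((rwd r u).2 ++ (rwd r u).1) ∧ Inc (rwd r u).1 := by
  induction u generalizing r with
  | nil => simp [rwd]; exact ⟨CK.refl _, hi⟩
  | cons x u ih =>
    have e : r ++ x :: u = (r ++ [x]) ++ u := by simp
    rw [e] at hr ⊢
    cases ho : (ri x r).2 with
    | none =>
      have := (ri_none ho).1
      have h2 := ih (ri_inc hi) (by rw [this]; exact hr)
      simp only [rwd, ho, Option.toList]
      rw [this] at h2 ⊢
      exact h2
    | some y =>
      have h1 := (ri_ck hi hr.left ho).right u
      have hr1 := h1.red hr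
      have h2 := ih (ri_inc hi) (Red.right (a := [y]) hr1)
      simp only [rwd, ho, Option.toList]
      exact ⟨h1.trans (h2.1.cons y), h2.2⟩

theorem row_triple {r u v : List ℕ} (hi : Inc r) (hr : Red (r ++ u)) (h : T3 u v) :
    (rwd r u).1 = (rwd r v).1 ∧ Eq3 (rwd r u).2 (rwd r v).2 ∧ (r = [] → (rwd r u).2 = (rwd r v).2) := by
  induction r with
  | nil =>
    rcases h with ⟨x, y, z, h1, h2, rfl, rfl⟩ | ⟨x, y, z, h1, h2, rfl, rfl⟩ | ⟨i, rfl, rfl⟩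
    · have h3 := h1.trans h2
      simp [rwd, ri, h1, h2, h3, not_lt_of_gt, h1.ne', h3.ne', Eq3]
    · have h3 := h1.trans h2
      simp [rwd, ri, h1, h2, h3, not_lt_of_gt, h2.ne', h3.ne', Eq3]
    · simp [rwd, ri, Eq3]
  | cons a l ih =>
    have hi' := inc_cons.1 hi
    have hrl : Red (l ++ u) := Red.right (a := [a]) hr
    by_cases hbig : ∀ e ∈ u, a < e
    · have hbv : ∀ e ∈ v, a < e := fun e he => hbig e ((h.ck.mem e).2 he)
      rw [rwd_big hbig, rwd_big hbv]
      have := ih hi'.2 hrl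
      simp [this]
    simp only [reduceCtorEq, false_imp_iff, and_true]
    rcases h with ⟨x, y, z, h1, h2, rfl, rfl⟩ | ⟨x, y, z, h1, h2, rfl, rfl⟩ | ⟨i, rfl, rfl⟩
    · have h3 := h1.trans h2
      rcases lt_trichotomy x a with hx | rfl | hx
      · rcases lt_trichotomy z a with hz | rfl | hz
        · cases l with
          | nil => simp [rwd, ri_c1, ri_c2, ri_c3, ri, *, Eq3]
          | cons b l =>
            have hb := hi'.1 b (by simp)
            have h5 : z < b := by omega
            have h6 : y < b := by omega
            simp [rwd, ri_c1, ri_c2, ri_c3, *]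
            exact Or.inr (Or.inr (Or.inr (Or.inl ⟨z, a, b, by simp [*]⟩)))
        · obtain ⟨l', rfl⟩ : ∃ l', l = (z+1) :: l' := by
            cases l with
            | nil => exact absurd hr (not_red (A := []) (u := [x]) (B := [y]) (by simp; omega))
            | cons b l =>
              by_cases hb : b = z + 1
              · exact ⟨l, by rw [hb]⟩
              · exfalso
                refine not_red (A := []) (u := b :: l ++ [x]) (x := z) (B := [y]) ?_ (by simpa using hr)
                intro e he
                have hb1 := hi'.1 b (by simp)
                have hb2 := (inc_cons.1 hi'.2).1 e
                simp only [mem_append, mem_cons, not_mem_nil, or_false] at he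
                rcases he with (rfl | he) | rfl
                · omega
                · have := hb2 he; omega
                · omega
          have h5 : z < z + 1 := by omega
          have h6 : y < z + 1 := by omega
          simp [rwd, ri_c1, ri_c2, ri_c3, *]
          exact Or.inr (Or.inl (Or.inr (Or.inr ⟨z, by simp⟩)))
        · simp [rwd, ri_c1, ri_c2, ri_c3, *]
          cases hoz : (ri z l).2 with
          | none => exact Or.inl (by simp)
          | some oz =>
            obtain ⟨oy, hoy, -⟩ := ri_ge (r := l) h2.le
            have h7 := ri_gt h2 hoz hoy
            have h8 : a < oy := ri_out_gt' (fun e he => by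
              rcases ri_mem he with rfl | he
              · exact hz
              · exact hi'.1 e he) hoy
            refine Or.inr (Or.inl (Or.inl ⟨a, oy, oz, h8, h7, by simp [hoy]⟩))
      · simp [rwd, ri_c1, ri_c2, ri_c3, *]
        cases hoz : (ri z l).2 with
        | none => exact Or.inl (by simp)
        | some oz =>
          obtain ⟨oy, hoy, -⟩ := ri_ge (r := l) h2.le
          have h7 := ri_gt h2 hoz hoy
          have h8 := ri_out_gt hoy
          refine Or.inr (Or.inl (Or.inl ⟨x+1, oy, oz, by omega, h7, by simp [hoy]⟩))
      · exact absurd (by simp; omega) hbig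
    · have h3 := h1.trans h2
      rcases lt_trichotomy x a with hx | rfl | hx
      · rcases lt_trichotomy y a with hy | rfl | hy
        · simp [rwd, ri_c1, ri_c2, ri_c3, *]
          cases hoz : (ri z l).2 with
          | none => exact Or.inl (by simp)
          | some oz => exact Or.inr (Or.inl (Or.inr (Or.inl ⟨y, a, oz, hy, ri_out_gt' hi'.1 hoz, by simp⟩)))
        · simp [rwd, ri_c1, ri_c2, ri_c3, *]
          cases hoz : (ri z l).2 with
          | none => exact Or.inl (by simp)
          | some oz => exact Or.inr (Or.inl (Or.inr (Or.inl ⟨y, y+1, oz, by omega, by have := ri_out_gt hoz; omega, by simp⟩)))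
        · have h5 : a < z := by omega
          simp [rwd, ri_c1, ri_c2, ri_c3, *]
          cases hoz : (ri z (ri y l).1).2 with
          | none => exact Or.inl (by simp)
          | some oz =>
            cases hoy : (ri y l).2 with
            | none => simp [(ri_lt hi'.2 h2).1 hoy] at hoz
            | some oy =>
              exact Or.inr (Or.inl (Or.inr (Or.inl ⟨a, oy, oz, by have := ri_out_gt hoy; omega, (ri_lt hi'.2 h2).2 _ _ hoy hoz, by simp⟩)))
      · simp [rwd, ri_c1, ri_c2, ri_c3, *]
        cases hoz : (ri z (ri y l).1).2 with
        | none => exact Or.inl (by simp)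
        | some oz =>
          cases hoy : (ri y l).2 with
          | none => simp [(ri_lt hi'.2 h2).1 hoy] at hoz
          | some oy =>
            exact Or.inr (Or.inl (Or.inr (Or.inl ⟨x+1, oy, oz, by have := ri_out_gt hoy; omega, (ri_lt hi'.2 h2).2 _ _ hoy hoz, by simp⟩)))
      · exact absurd (by simp; omega) hbig
    · have h0 : i < i + 1 := by omega
      rcases lt_trichotomy i a with hx | rfl | hx
      · rcases lt_or_eq_of_le (show i + 1 ≤ a from hx) with hy | rfl
        · cases l with
          | nil => simp [rwd, ri_c1, ri_c2, ri_c3, ri, hx, hy, Eq3]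
          | cons b l =>
            have hb := hi'.1 b (by simp)
            have h5 : i + 1 < b := by omega
            simp [rwd, ri_c1, ri_c2, ri_c3, hx, hy, h5]
            exact Or.inr (Or.inr (Or.inr (Or.inl ⟨i+1, a, b, by simp [*]⟩)))
        · have hr2 : Red ((i+1) :: l ++ [i+1,i,i+1]) := ((CK.br i []).left _).red hr
          obtain ⟨l', rfl⟩ := red_next (A := []) (B := [i,i+1]) (by simpa using hr2) hi
          have h5 : i + 1 < i+1+1 := by omega
          simp [rwd, ri_c1, ri_c2, ri_c3]
          exact Or.inr (Or.inl (Or.inr (Or.inr ⟨i+1, by simp⟩)))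
      · obtain ⟨l', rfl⟩ := red_next (A := []) (B := [i+1,i]) (by simpa using hr) hi
        simp [rwd, ri_c1, ri_c2, ri_c3]
        exact Or.inr (Or.inl (Or.inr (Or.inr ⟨i+1, by simp⟩)))
      · exact absurd (by simp; omega) hbig

def insW (P : List (List ℕ)) (u : List ℕ) : List (List ℕ) := u.foldl (fun P x => ins x P) P
theorem insW_cons (P : List (List ℕ)) (x : ℕ) (u : List ℕ) : insW P (x :: u) = insW (ins x P) u := rfl
theorem insW_append (P : List (List ℕ)) (u v : List ℕ) : insW P (u ++ v) = insW (insW P u) v := by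
  simp [insW]
theorem insW_row (r : List ℕ) (R) (u : List ℕ) : insW (r :: R) u = (rwd r u).1 :: insW R (rwd r u).2 := by
  induction u generalizing r R with
  | nil => simp [insW, rwd]
  | cons x u ih =>
    rw [insW_cons]
    cases ho : (ri x r).2 with
    | none => rw [ins_none ho, ih]; simp [rwd, ho]
    | some y => rw [ins_some ho, ih]; simp [rwd, ho, insW_cons]

theorem insW_nil {u : List ℕ} (h : u ≠ []) : insW [] u = insW [[]] u := by
  cases u with
  | nil => exact absurd rfl h
  | cons x u => rfl

theorem insW_triple {P : List (List ℕ)} {u v : List ℕ} (hT : Tab P) (hr : Red (wordOf P ++ u)) (h : T3 u v) :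
    insW P u = insW P v := by
  induction P generalizing u v with
  | nil =>
    have hu : u ≠ [] := by
      rcases h with ⟨x, y, z, h1, h2, rfl, rfl⟩ | ⟨x, y, z, h1, h2, rfl, rfl⟩ | ⟨i, rfl, rfl⟩ <;> simp
    have hv : v ≠ [] := by
      rcases h with ⟨x, y, z, h1, h2, rfl, rfl⟩ | ⟨x, y, z, h1, h2, rfl, rfl⟩ | ⟨i, rfl, rfl⟩ <;> simp
    rw [insW_nil hu, insW_nil hv, insW_row, insW_row]
    have := row_triple inc_nil (by simpa [wordOf] using hr) h
    rw [this.1, this.2.2 rfl]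
  | cons r R ih =>
    rw [insW_row, insW_row]
    rw [wordOf_cons, append_assoc] at hr
    obtain ⟨h1, h2, -⟩ := row_triple hT.1 hr.right h
    have hr1 := ((rwd_ck hT.1 hr.right).1.left (wordOf R)).red hr
    have hr2 : Red (r ++ v) := (h.ck.left r).red hr.right
    have hr3 := ((rwd_ck hT.1 hr2).1.left (wordOf R)).red (((h.ck.left r).left (wordOf R)).red hr)
    rw [← append_assoc] at hr1 hr3
    rw [h1]
    rcases h2 with h2 | h2 | h2
    · rw [h2]
    · rw [ih hT.2.2 hr1.left h2]
    · rw [ih hT.2.2 hr3.left h2]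

theorem insW_ck {u v : List ℕ} (h : CK u v) : ∀ P, Tab P → Red (wordOf P ++ u) → insW P u = insW P v := by
  induction h with
  | refl u => intros; rfl
  | symm h ih => intro P hT hr; exact (ih P hT ((h.symm.left _).red hr)).symm
  | trans h1 _ ih1 ih2 => intro P hT hr; exact (ih1 P hT hr).trans (ih2 P hT ((h1.left _).red hr))
  | @cons x u v h ih =>
    intro P hT hr
    rw [insW_cons, insW_cons]
    have e : wordOf P ++ x :: u = (wordOf P ++ [x]) ++ u := by simp
    rw [e] at hr
    exact ih _ (tab_ins x hT) (((ins_ck hT hr.left).right u).red hr)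
  | @k1 x y z s h1 h2 =>
    intro P hT hr
    have h := insW_triple (P := P) (u := [x,z,y]) (v := [z,x,y]) hT (Red.left (b := s) (by simpa using hr))
      (Or.inl ⟨x,y,z,h1,h2,rfl,rfl⟩)
    exact (insW_append P [x,z,y] s).trans (by rw [h]; exact (insW_append P [z,x,y] s).symm)
  | @k2 x y z s h1 h2 =>
    intro P hT hr
    have h := insW_triple (P := P) (u := [y,x,z]) (v := [y,z,x]) hT (Red.left (b := s) (by simpa using hr))
      (Or.inr (Or.inl ⟨x,y,z,h1,h2,rfl,rfl⟩))
    exact (insW_append P [y,x,z] s).trans (by rw [h]; exact (insW_append P [y,z,x] s).symm)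
  | br i s =>
    intro P hT hr
    have h := insW_triple (P := P) (u := [i,i+1,i]) (v := [i+1,i,i+1]) hT (Red.left (b := s) (by simpa using hr))
      (Or.inr (Or.inr ⟨i,rfl,rfl⟩))
    exact (insW_append P [i,i+1,i] s).trans (by rw [h]; exact (insW_append P [i+1,i,i+1] s).symm)

theorem PT_reverse (u : List ℕ) : PT u.reverse = insW [] u := by simp [PT, insW, foldr_reverse]

/-- insertion tableau of a (forward) word -/
theorem PT_inv {u v : List ℕ} (h : CK u v) (hr : Red u) : PT u.reverse = PT v.reverse := by
  rw [PT_reverse, PT_reverse]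
  exact insW_ck h [] trivial (by simpa [wordOf] using hr)

theorem tab_PT_word {n : ℕ} {P : List (List ℕ)} (hn : (wordOf P).length = n) (hT : Tab P) (hN : NE P) (hr : Red (wordOf P)) :
    PT (wordOf P).reverse = P := by
  induction n generalizing P with
  | zero =>
    cases P with
    | nil => rfl
    | cons r R =>
      rw [wordOf_cons] at hn
      have := hN r (by simp)
      have := length_pos_iff.2 this
      rw [length_append] at hn; omega
  | succ n ih =>
    cases P with
    | nil => simp [wordOf] at hn
    | cons r R =>
      have h0 := length_pos_iff.2 (hN r (by simp))
      obtain ⟨x, P', a1, a2, a3, a4, a5⟩ := ins_inv (j := r.length - 1) hT hN hr ⟨r, by simp, by omega⟩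
      have hc := ins_ck a1 a5
      rw [a3] at hc
      rw [← PT_inv hc a5, reverse_append, reverse_singleton, singleton_append, PT_cons,
        ih (by have := hc.length; simp [hn] at this; omega) a1 a2 a5.left, a3]


def up (s : Finset ℕ) (z : ℕ) : ℕ := (s.filter (fun e => z ≤ e)).card

theorem up_succ (s : Finset ℕ) (z : ℕ) : up s z = up s (z+1) + (if z ∈ s then 1 else 0) := by
  have : s.filter (fun e => z ≤ e) = s.filter (fun e => z + 1 ≤ e) ∪ (if z ∈ s then {z} else ∅) := by
    ext e
    split_ifs with h <;> simp only [Finset.mem_filter, Finset.mem_union, Finset.mem_singleton, Finset.notMem_empty, or_false]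
    · constructor
      · rintro ⟨h1, h2⟩
        by_cases e = z
        · exact Or.inr ‹_›
        · exact Or.inl ⟨h1, by omega⟩
      · rintro (⟨h1, h2⟩ | rfl)
        · exact ⟨h1, by omega⟩
        · exact ⟨h, le_rfl⟩
    · constructor
      · rintro ⟨h1, h2⟩
        refine ⟨h1, ?_⟩
        have : e ≠ z := by rintro rfl; exact h h1
        omega
      · rintro ⟨h1, h2⟩; exact ⟨h1, by omega⟩
  unfold up
  rw [this, Finset.card_union_of_disjoint]
  · split_ifs <;> simp
  · split_ifs
    · rw [Finset.disjoint_singleton_right]; simp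
    · simp

theorem up_mono (s : Finset ℕ) {z w : ℕ} (h : z ≤ w) : up s w ≤ up s z :=
  Finset.card_le_card (fun e he => by simp only [Finset.mem_filter] at he ⊢; exact ⟨he.1, h.trans he.2⟩)

theorem up_subset {s t : Finset ℕ} (h : s ⊆ t) {z w : ℕ} (hzw : z ≤ w) : up s z + up t w ≤ up t z + up s w := by
  induction w, hzw using Nat.le_induction with
  | base => omega
  | succ w hw ih =>
    have h1 := up_succ s w
    have h2 := up_succ t w
    split_ifs at h1 h2 with a b
    all_goals first | omega | exact absurd (h a) b

theorem up_large (s : Finset ℕ) : ∃ N, ∀ z, N ≤ z → up s z = 0 := by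
  refine ⟨s.sup id + 1, fun z hz => ?_⟩
  unfold up
  rw [Finset.card_eq_zero, Finset.filter_eq_empty_iff]
  intro e he h
  have : e ≤ s.sup id := Finset.le_sup (f := id) he
  omega

theorem up_ext {s t : Finset ℕ} (h : ∀ z, up s z = up t z) : s = t := by
  ext z
  have h1 := up_succ s z
  have h2 := up_succ t z
  rw [h, h] at h1
  split_ifs at h1 h2 <;> simp_all

theorem up_zero (s : Finset ℕ) : up s 0 = s.card := by simp [up]

theorem up_insert {s : Finset ℕ} {a : ℕ} (h : a ∉ s) (z : ℕ) :
    up (insert a s) z = up s z + (if z ≤ a then 1 else 0) := by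
  unfold up
  rw [Finset.filter_insert]
  split_ifs with h1
  · rw [Finset.card_insert_of_notMem (by simp [h])]
  · rfl

theorem up_erase {s : Finset ℕ} {a : ℕ} (h : a ∈ s) (z : ℕ) :
    up s z = up (s.erase a) z + (if z ≤ a then 1 else 0) := by
  conv_lhs => rw [← Finset.insert_erase h]
  exact up_insert (by simp) z

theorem up_lip (s : Finset ℕ) {p q : ℕ} (h : p ≤ q) : up s p ≤ up s q + (q - p) := by
  induction q, h using Nat.le_induction with
  | base => omega
  | succ w hw ih =>
    have h1 := up_succ s w
    split_ifs at h1 <;> omega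

theorem up_full (s : Finset ℕ) {p q : ℕ} (h : p ≤ q) (hs : ∀ t, p ≤ t → t < q → t ∈ s) :
    up s p = up s q + (q - p) := by
  induction q, h using Nat.le_induction with
  | base => omega
  | succ w hw ih =>
    have h1 := up_succ s w
    rw [if_pos (hs w hw (by omega))] at h1
    have := ih (fun t a b => hs t a (by omega))
    omega

open Classical in
noncomputable def L (u v : Finset ℕ) : Finset ℕ :=
  u.filter (fun e => ∃ w, e < w ∧ up u e + up v (w+1) ≤ up u w + up v (e+1))

theorem mem_L {u v : Finset ℕ} {e : ℕ} : e ∈ L u v ↔ e ∈ u ∧ ∃ w, e < w ∧ up u e + up v (w+1) ≤ up u w + up v (e+1) := by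
  simp [L]
theorem L_sub (u v : Finset ℕ) : L u v ⊆ u := fun _ he => (mem_L.1 he).1
theorem L_mono (u : Finset ℕ) {v v' : Finset ℕ} (h : v ⊆ v') : L u v ⊆ L u v' := by
  intro e he
  rw [mem_L] at he ⊢
  obtain ⟨h1, w, h2, h3⟩ := he
  have := up_subset h (show e + 1 ≤ w + 1 by omega)
  exact ⟨h1, w, h2, by omega⟩

theorem L_up0 (u v : Finset ℕ) (w : ℕ) : up (L u v) w ≤ up v (w+1) := by
  obtain ⟨N, hN⟩ := up_large (L u v)
  induction hd : N - w using Nat.strong_induction_on generalizing w with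
  | _ d ih =>
    by_cases hw : N ≤ w
    · rw [hN w hw]; omega
    by_cases hm : w ∈ L u v
    · obtain ⟨-, w', h2, h3⟩ := mem_L.1 hm
      have h4 := ih (N - w') (by omega) w' rfl
      have := up_subset (L_sub u v) h2.le
      omega
    · have h4 := ih (N - (w+1)) (by omega) (w+1) rfl
      have h5 := up_succ (L u v) w
      rw [if_neg hm] at h5
      have := up_mono v (show w+1 ≤ w+1+1 by omega)
      omega

theorem L_le (u v : Finset ℕ) {z w : ℕ} (h : z ≤ w) : up (L u v) z + up u w ≤ up u z + up v (w+1) := by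
  have := L_up0 u v w
  have := up_subset (L_sub u v) h
  omega

theorem L_ge (u v : Finset ℕ) (z : ℕ) : ∃ w, z ≤ w ∧ up u z + up v (w+1) ≤ up (L u v) z + up u w := by
  obtain ⟨N1, hN1⟩ := up_large u
  obtain ⟨N2, hN2⟩ := up_large v
  induction hd : (N1 + N2) - z using Nat.strong_induction_on generalizing z with
  | _ d ih =>
    by_cases hz : N1 + N2 ≤ z
    · exact ⟨z, le_rfl, by rw [hN2 (z+1) (by omega)]; omega⟩
    obtain ⟨w, hw, h⟩ := ih (N1 + N2 - (z+1)) (by omega) (z+1) rfl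
    have h1 := up_succ u z
    have h2 := up_succ (L u v) z
    by_cases hu : z ∈ u
    · by_cases hm : z ∈ L u v
      · rw [if_pos hu] at h1
        rw [if_pos hm] at h2
        exact ⟨w, by omega, by omega⟩
      · rw [if_pos hu] at h1
        rw [if_neg hm] at h2
        have : ¬ (up u z + up v (w+1) ≤ up u w + up v (z+1)) := fun hc => hm (mem_L.2 ⟨hu, w, by omega, hc⟩)
        exact ⟨z, le_rfl, by omega⟩
    · have hm : z ∉ L u v := fun hc => hu (L_sub _ _ hc)
      rw [if_neg hu] at h1
      rw [if_neg hm] at h2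
      exact ⟨w, by omega, by omega⟩

/-- column domination -/
def DomC (c v : Finset ℕ) : Prop := ∀ w, up v 0 + up c w ≤ up c 0 + up v (w+1)

theorem L_card {c V B : Finset ℕ} (h : DomC c V) (hB : B ⊆ V) : (L c B).card = B.card := by
  rw [← up_zero, ← up_zero]
  apply le_antisymm
  · exact (L_up0 c B 0).trans (up_mono B (by omega))
  · obtain ⟨w, -, hw⟩ := L_ge c B 0
    have := h w
    have := up_subset hB (show 0 ≤ w+1 by omega)
    omega

theorem L_beta {c V A B : Finset ℕ} {r : ℕ} (h : DomC c V) (hB : insert r B ⊆ V) (hr : r ∉ B) (hA : A ⊆ B)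
    (hlt : ∀ b ∈ B, b ∉ A → r < b) :
    ∃ r', r' ∉ L c B ∧ L c (insert r B) = insert r' (L c B) ∧ ∀ e ∈ L c B, e ∉ L c A → r' < e := by
  have hsub : L c B ⊆ L c (insert r B) := L_mono c (Finset.subset_insert r B)
  have hc : (L c (insert r B) \ L c B).card = 1 := by
    rw [Finset.card_sdiff_of_subset hsub, L_card h hB, L_card h ((Finset.subset_insert r B).trans hB),
      Finset.card_insert_of_notMem hr]; omega
  obtain ⟨r', hr'⟩ := Finset.card_eq_one.1 hc
  have hm : r' ∈ L c (insert r B) \ L c B := by rw [hr']; simp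
  rw [Finset.mem_sdiff] at hm
  refine ⟨r', hm.2, ?_, ?_⟩
  · rw [Finset.insert_eq r', ← hr', Finset.sdiff_union_of_subset hsub]
  · intro e he heA
    by_contra hn
    have hne : r' ≠ e := by rintro rfl; exact hm.2 he
    obtain ⟨hrc, w1, hw1, h1⟩ := mem_L.1 hm.1
    have hB1 : ∀ w, r' < w → up c w + up B (r'+1) < up c r' + up B (w+1) := by
      intro w hw
      by_contra hcon
      exact hm.2 (mem_L.2 ⟨hrc, w, hw, by omega⟩)
    rw [up_insert hr, up_insert hr] at h1
    have h2 := hB1 w1 hw1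
    have hrr : r' < r := by
      by_contra hcon
      split_ifs at h1 <;> omega
    obtain ⟨hec, w, hw, h3⟩ := mem_L.1 he
    have hA1 : ∀ w, e < w → up c w + up A (e+1) < up c e + up A (w+1) := by
      intro w hw
      by_contra hcon
      exact heA (mem_L.2 ⟨hec, w, hw, by omega⟩)
    have hAB : ∀ p q, p ≤ q → q ≤ r + 1 → up B p + up A q = up A p + up B q := by
      intro p q hpq hq
      induction q, hpq using Nat.le_induction with
      | base => omega
      | succ q hpq ih =>
        have e1 := up_succ A q
        have e2 := up_succ B q
        have : q ∈ A ↔ q ∈ B := ⟨fun h => hA h, fun h => by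
          by_contra hc; have := hlt q h hc; omega⟩
        simp only [this] at e1
        have := ih (by omega)
        split_ifs at e1 e2 <;> omega
    by_cases hwr : r' < w
    · have a1 := hB1 w hwr
      have a2 := hA1 r' (by omega)
      have a3 := hAB (e+1) (r'+1) (by omega) (by omega)
      omega
    · have a2 := hA1 w hw
      have a3 := hAB (e+1) (w+1) (by omega) (by omega)
      omega

theorem L_swap {c V X : Finset ℕ} {y y' : ℕ} (hyy : y ≤ y') (hyV : y ∈ V) (hc : y' ∉ c)
    (hL : ∀ w, w < y → up V (y+1) + up c w + 1 ≤ up V (w+1) + up c y)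
    (hR : ∀ w, y' ≤ w → up c w + up V (y'+1) ≤ up c y' + up V (w+1)) :
    L (insert y' c) (L (V.erase y) X) = L c (L V X) := by
  apply up_ext
  intro z
  apply le_antisymm
  · obtain ⟨w, hw, h1⟩ := L_ge c (L V X) z
    obtain ⟨w', hw', h2⟩ := L_ge V X (w+1)
    by_cases hcase : z ≤ y' ∧ y' < w
    · have a1 := L_le (insert y' c) (L (V.erase y) X) hcase.1
      have a2 := L_le (V.erase y) X (show y' + 1 ≤ w' by omega)
      have a3 := hR w (by omega)
      rw [up_insert hc, up_insert hc] at a1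
      have e1 := up_erase hyV (y'+1)
      have e2 := up_erase hyV w'
      split_ifs at * <;> omega
    · have a1 := L_le (insert y' c) (L (V.erase y) X) hw
      have a2 := L_le (V.erase y) X hw'
      rw [up_insert hc, up_insert hc] at a1
      have e1 := up_erase hyV (w+1)
      have e2 := up_erase hyV w'
      split_ifs at * <;> omega
  · obtain ⟨w, hw, h1⟩ := L_ge (insert y' c) (L (V.erase y) X) z
    obtain ⟨w', hw', h2⟩ := L_ge (V.erase y) X (w+1)
    rw [up_insert hc, up_insert hc] at h1
    have e1 := up_erase hyV (w+1)
    have e2 := up_erase hyV w'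
    by_cases hcase : w < y ∧ y < w'
    · by_cases hzy : z ≤ y
      · have a1 := L_le c (L V X) hzy
        have a2 := L_le V X (show y + 1 ≤ w' by omega)
        have a3 := hL w hcase.1
        split_ifs at * <;> omega
      · omega
    · have a1 := L_le c (L V X) hw
      have a2 := L_le V X hw'
      split_ifs at * <;> omega

theorem L_full {V U : Finset ℕ} (h : U ⊆ V) : L U (V.image (· + 1)) = U := by
  refine Finset.Subset.antisymm (L_sub _ _) fun e he => mem_L.2 ⟨he, e + 1, by omega, ?_⟩
  have h1 := up_succ U e
  have h2 := up_succ (V.image (· + 1)) (e+1)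
  rw [if_pos he] at h1
  rw [if_pos (Finset.mem_image.2 ⟨e, h he, rfl⟩)] at h2
  omega

theorem L_swap' {c V : Finset ℕ} {y y' : ℕ} (hyy : y ≤ y') (hyV : y ∈ V) (hc : y' ∉ c)
    (hL : ∀ w, w < y → up V (y+1) + up c w + 1 ≤ up V (w+1) + up c y)
    (hR : ∀ w, y' ≤ w → up c w + up V (y'+1) ≤ up c y' + up V (w+1)) :
    L (insert y' c) (V.erase y) = L c V := by
  have := L_swap (X := V.image (· + 1)) hyy hyV hc hL hR
  rwa [L_full (Finset.erase_subset _ _), L_full (Finset.Subset.refl V)] at this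

noncomputable def Kc : ℕ → (ℕ → Finset ℕ) → Finset ℕ
  | 0, f => f 0
  | j+1, f => L (f 0) (Kc j (fun i => f (i+1)))

theorem Kc_succ (j : ℕ) (f : ℕ → Finset ℕ) : Kc (j+1) f = L (f 0) (Kc j (fun i => f (i+1))) := rfl
theorem Kc_zero (f : ℕ → Finset ℕ) : Kc 0 f = f 0 := rfl

theorem Kc_sub (j : ℕ) (f : ℕ → Finset ℕ) : Kc j f ⊆ f 0 := by
  cases j with
  | zero => exact Finset.Subset.refl _
  | succ j => exact L_sub _ _

theorem Kc_nest (j : ℕ) (f : ℕ → Finset ℕ) : Kc (j+1) f ⊆ Kc j f := by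
  induction j generalizing f with
  | zero => exact L_sub _ _
  | succ j ih => exact L_mono _ (ih _)

theorem Kc_card (j : ℕ) (f : ℕ → Finset ℕ) (h : ∀ i, DomC (f i) (f (i+1))) : (Kc j f).card = (f j).card := by
  induction j generalizing f with
  | zero => rfl
  | succ j ih =>
    rw [Kc_succ, L_card (h 0) (Kc_sub j _), ih _ (fun i => h (i+1))]


def col : List (List ℕ) → ℕ → Finset ℕ
  | [], _ => ∅
  | r :: R, j => r[j]?.toFinset ∪ col R j

theorem col_nil (j : ℕ) : col [] j = ∅ := rfl
theorem col_ncons (R) (j : ℕ) : col ([] :: R) j = col R j := by simp [col]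
theorem col_zero (a : ℕ) (l : List ℕ) (R) : col ((a :: l) :: R) 0 = insert a (col R 0) := by
  ext; simp [col]
theorem col_succ (P : List (List ℕ)) (j : ℕ) : col P (j+1) = col (P.map tail) j := by
  induction P with
  | nil => rfl
  | cons r R ih => cases r <;> simp [col, ih]
theorem col_cons_succ (a : ℕ) (l : List ℕ) (R) (j : ℕ) : col ((a :: l) :: R) (j+1) = l[j]?.toFinset ∪ col R (j+1) := by
  simp [col]
theorem col_one (a b : ℕ) (l : List ℕ) (R) : col ((a :: b :: l) :: R) 1 = insert b (col R 1) := by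
  ext; simp [col]
theorem up_empty (z : ℕ) : up ∅ z = 0 := by simp [up]

theorem dom_tail {r s : List ℕ} (h : Dom r s) : Dom r.tail s.tail := by
  cases r <;> cases s <;> simp_all
theorem inc_tail {r : List ℕ} (h : Inc r) : Inc r.tail := by
  cases r with
  | nil => exact h
  | cons a l => exact (inc_cons.1 h).2
theorem tab_tail {P : List (List ℕ)} (h : Tab P) : Tab (P.map tail) := by
  induction P with
  | nil => trivial
  | cons r R ih =>
    refine ⟨inc_tail h.1, ?_, ih h.2.2⟩
    have := dom_tail h.2.1
    cases R <;> simpa using this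
theorem tab_nil {R : List (List ℕ)} (h : Tab ([] :: R)) (j : ℕ) : col R j = ∅ := by
  induction R with
  | nil => rfl
  | cons r R ih =>
    have h2 := h.2.1
    have h3 := h.2.2
    cases r with
    | nil => rw [col_ncons]; exact ih h3
    | cons a l => simp at h2
theorem tab_col_lt {a : ℕ} {l : List ℕ} {R} (h : Tab ((a :: l) :: R)) : ∀ e ∈ col R 0, a < e := by
  induction R generalizing a l with
  | nil => simp [col]
  | cons r R ih =>
    have h2 := h.2.1
    cases r with
    | nil => rw [col_ncons, tab_nil h.2.2]; simp
    | cons b l' =>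
      simp only [headD_cons, dom_cons] at h2
      rw [col_zero]
      intro e he
      rw [Finset.mem_insert] at he
      rcases he with rfl | he
      · exact h2.1
      · exact h2.1.trans (ih h.2.2 e he)
theorem tab_domC0 {P : List (List ℕ)} (h : Tab P) : DomC (col P 0) (col P 1) := by
  induction P with
  | nil => intro w; simp [col, up_empty]
  | cons r R ih =>
    cases r with
    | nil => intro w; rw [col_ncons, col_ncons, tab_nil h, tab_nil h]; simp [up_empty]
    | cons a l =>
      intro w
      have ha := tab_col_lt h
      have hT := tab_tail h
      have h0 := up_insert (s := col R 0) (a := a) (fun h => (ha a h).false)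
      cases l with
      | nil =>
        have : col ([a] :: R) 1 = ∅ := by
          rw [col_succ]
          simp only [map_cons, tail_cons, col_ncons] at hT ⊢
          exact tab_nil hT 0
        rw [this, up_empty, up_empty]
        have := up_mono (col ([a] :: R) 0) (Nat.zero_le w)
        omega
      | cons b l =>
        have hb : ∀ e ∈ col R 1, b < e := by
          rw [col_succ]
          exact tab_col_lt hT
        have hab : a < b := (inc_cons.1 h.1).1 b (by simp)
        have h1 := up_insert (s := col R 1) (a := b) (fun h => (hb b h).false)
        rw [col_zero, col_one, h0, h0, h1, h1]
        have := ih h.2.2 w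
        split_ifs <;> omega
theorem tab_domC {P : List (List ℕ)} (h : Tab P) (j : ℕ) : DomC (col P j) (col P (j+1)) := by
  induction j generalizing P with
  | zero => exact tab_domC0 h
  | succ j ih => rw [col_succ, col_succ P (j+1)]; exact ih (tab_tail h)

def Gd : ℕ → List (List ℕ) → Prop
  | _, [] => True
  | x, r :: R => (x ∈ r → x + 1 ∈ r) ∧ ∀ y, (ri x r).2 = some y → Gd y R

theorem gd_of_red {P : List (List ℕ)} {x : ℕ} (h : Tab P) (hr : Red (wordOf P ++ [x])) : Gd x P := by
  induction P generalizing x with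
  | nil => trivial
  | cons r R ih =>
    rw [wordOf_cons, append_assoc] at hr
    refine ⟨red_gd h.1 hr, fun y hy => ih h.2.2 ?_⟩
    have := ((ri_ck h.1 hr.right hy).left (wordOf R)).red hr
    rw [show wordOf R ++ y :: (ri x r).1 = (wordOf R ++ [y]) ++ (ri x r).1 by simp] at this
    exact this.left

theorem gd_small {P : List (List ℕ)} {x : ℕ} (h : Tab P) (hx : ∀ e ∈ P.headD [], x < e) : Gd x P := by
  induction P generalizing x with
  | nil => trivial
  | cons r R ih =>
    simp only [headD_cons] at hx
    refine ⟨fun hm => absurd (hx x hm) (by omega), fun y hy => ih h.2.2 ?_⟩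
    cases r with
    | nil => simp [ri] at hy
    | cons a l =>
      have ha := hx a (by simp)
      simp only [ri, if_pos ha, Option.some.injEq] at hy
      subst hy
      intro e he
      cases hR : R with
      | nil => simp [hR] at he
      | cons s R' =>
        subst hR
        cases s with
        | nil => simp at he
        | cons b m =>
          have h2 := h.2.1
          have h3 := (inc_cons.1 h.2.2.1).1
          simp only [headD_cons, dom_cons, mem_cons] at h2 he
          rcases he with rfl | he
          · exact h2.1
          · exact h2.1.trans (h3 e he)

theorem gd_tail {P : List (List ℕ)} {x : ℕ} (h : Tab P) (hg : Gd x P) : Gd x (P.map tail) := by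
  induction P generalizing x with
  | nil => trivial
  | cons r R ih =>
    cases r with
    | nil => exact ⟨by simp, by simp [ri]⟩
    | cons a l =>
      have hl := (inc_cons.1 h.1).1
      by_cases hx : x ≤ a
      · refine gd_small (tab_tail h) ?_
        simp only [map_cons, headD_cons, tail_cons]
        intro e he
        have := hl e he
        omega
      · obtain ⟨h1, h2⟩ := hg
        have hr : ri x (a :: l) = (a :: (ri x l).1, (ri x l).2) := by
          rw [ri, if_neg (by omega), if_neg (by omega)]
        rw [hr] at h2
        refine ⟨fun hm => ?_, fun y hy => ih h.2.2 (h2 y hy)⟩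
        have := h1 (by simp; right; exact hm)
        simp only [mem_cons] at this
        rcases this with h | h
        · omega
        · exact h

theorem up_all {c : Finset ℕ} {x w : ℕ} (h : ∀ e ∈ c, x ≤ e) (hw : w ≤ x) : up c w = up c x := by
  unfold up
  congr 1
  apply Finset.filter_congr
  intro e he
  have := h e he
  omega

theorem s_lemma {P : List (List ℕ)} {x : ℕ} (h : Tab P) (hg : Gd x P) (hx : ∀ e ∈ P.headD [], x ≤ e) :
    ∃ y', x ≤ y' ∧ y' ∉ col P 0 ∧ col (ins x P) 0 = insert y' (col P 0) ∧
      (∀ j, col (ins x P) (j+1) = col P (j+1)) ∧ gc x P = 0 ∧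
      ((∀ e ∈ P.headD [], x < e) → y' = x) ∧ (∀ e ∈ col P 0, x ≤ e) ∧
      (∀ t, x < t → t ≤ y' → t ∈ col P 1) ∧
      (∀ w, y' ≤ w → up (col P 0) w + up (col P 1) (y'+1) ≤ up (col P 0) y' + up (col P 1) (w+1)) := by
  induction P generalizing x with
  | nil => exact ⟨x, le_rfl, by simp [col], by simp [col, ins], by simp [col, ins], rfl, by simp, by simp [col],
      by intros; omega, by simp [col, up_empty]⟩
  | cons r R ih =>
    cases r with
    | nil =>
      have hc := tab_nil h
      refine ⟨x, le_rfl, ?_, ?_, ?_, by simp [gc, ri], by simp, ?_, by intros; omega, ?_⟩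
      all_goals simp [col, ins, ri, hc, up_empty]
    | cons a l =>
      have hl := (inc_cons.1 h.1).1
      have hac := tab_col_lt h
      have hd : ∀ e ∈ R.headD [], a < e := by
        intro e he
        cases hR : R with
        | nil => simp [hR] at he
        | cons s R' =>
          subst hR
          cases s with
          | nil => simp at he
          | cons b m =>
            have h2 := h.2.1
            have h3 := (inc_cons.1 h.2.2.1).1
            simp only [headD_cons, dom_cons, mem_cons] at h2 he
            rcases he with rfl | he
            · exact h2.1
            · exact h2.1.trans (h3 e he)
      have hxa := hx a (by simp)
      have hall : ∀ e ∈ col ((a :: l) :: R) 0, x ≤ e := by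
        rw [col_zero]
        intro e he
        rw [Finset.mem_insert] at he
        rcases he with rfl | he
        · exact hxa
        · exact hxa.trans (hac e he).le
      by_cases hlt : x < a
      · have hr : ri x (a :: l) = (x :: l, some a) := by rw [ri, if_pos hlt]
        obtain ⟨y', -, h1, h2, h3, h4, h5, -⟩ := ih h.2.2 (hg.2 a (by rw [hr])) (fun e he => (hd e he).le)
        obtain rfl := h5 hd
        rw [ins_some (y := y') (by rw [hr]), gc_some (y := y') (by rw [hr]), hr]
        refine ⟨x, le_rfl, fun hm => ?_, ?_, ?_, h4, fun _ => rfl, hall, by intros; omega, ?_⟩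
        · rw [col_zero, Finset.mem_insert] at hm
          rcases hm with rfl | hm
          · omega
          · have := hac x hm; omega
        · rw [col_zero, h2, col_zero]
        · intro j
          rw [col_cons_succ, h3, col_cons_succ]
        · intro w hw
          have := tab_domC0 h w
          have := up_all hall (Nat.zero_le x)
          have := up_mono (col ((y' :: l) :: R) 1) (Nat.zero_le (x+1))
          omega
      · obtain rfl : x = a := by omega
        have hr : ri x (x :: l) = (x :: l, some (x+1)) := by rw [ri, if_neg hlt, if_pos rfl]
        have hm : x + 1 ∈ l := by simpa using hg.1 (by simp)
        cases l with
        | nil => simp at hm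
        | cons b l =>
          have hb : b = x + 1 := by
            have h1 := hl b (by simp)
            rw [mem_cons] at hm
            rcases hm with hm | hm
            · exact hm.symm
            · have := (inc_cons.1 (inc_cons.1 h.1).2).1 _ hm
              omega
          obtain ⟨y', h0, h1, h2, h3, h4, h5, h6, h7, h8⟩ := ih h.2.2 (hg.2 (x+1) (by rw [hr])) (fun e he => hd e he)
          rw [ins_some (y := x+1) (by rw [hr]), gc_some (y := x+1) (by rw [hr]), hr]
          refine ⟨y', by omega, fun hm => ?_, ?_, ?_, h4, ?_, hall, ?_, ?_⟩
          · rw [col_zero, Finset.mem_insert] at hm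
            rcases hm with rfl | hm
            · omega
            · exact h1 hm
          · rw [col_zero, h2, col_zero, Finset.insert_comm]
          · intro j
            rw [col_cons_succ, h3, col_cons_succ]
          · intro hh
            have := hh x (by simp)
            omega
          · intro t ht1 ht2
            rw [col_one, Finset.mem_insert]
            by_cases ht : t = x + 1
            · left; omega
            · right; exact h7 t (by omega) ht2
          · intro w hw
            have hbc : ∀ e ∈ col R 1, b < e := by
              rw [col_succ]
              exact tab_col_lt (tab_tail h)
            have e0 := up_insert (s := col R 0) (a := x) (fun h => (hac x h).false)
            have e1 := up_insert (s := col R 1) (a := b) (fun h => (hbc b h).false)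
            rw [col_zero, col_one, e0, e0, e1, e1]
            have := h8 w hw
            split_ifs <;> omega

def ColC (x : ℕ) (P : List (List ℕ)) : Prop :=
    (col (ins x P) 0 = col P 0 ∧ (∀ j, col (ins x P) (j+1) = col (ins x (P.map tail)) j) ∧
      gc x P = gc x (P.map tail) + 1) ∨
    ∃ y y', y ≤ y' ∧ y ∈ col (ins x (P.map tail)) 0 ∧ y' ∉ col P 0 ∧
      col (ins x P) 0 = insert y' (col P 0) ∧
      col (ins x P) 1 = (col (ins x (P.map tail)) 0).erase y ∧
      (∀ j, col (ins x P) (j+2) = col (ins x (P.map tail)) (j+1)) ∧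
      gc x P = 0 ∧ gc x (P.map tail) = 0 ∧
      (∀ w, w < y → up (col (ins x (P.map tail)) 0) (y+1) + up (col P 0) w + 1 ≤
        up (col (ins x (P.map tail)) 0) (w+1) + up (col P 0) y) ∧
      (∀ w, w < y' → up (col (ins x (P.map tail)) 0) (y'+1) + up (col P 0) w ≤
        up (col (ins x (P.map tail)) 0) (w+1) + up (col P 0) y') ∧
      (∀ w, y' ≤ w → up (col P 0) w + up (col (ins x (P.map tail)) 0) (y'+1) ≤
        up (col P 0) y' + up (col (ins x (P.map tail)) 0) (w+1))

theorem col_small {P : List (List ℕ)} {x : ℕ} (h : Tab P) (hg : Gd x P) (hx : ∀ e ∈ P.headD [], x ≤ e) : ColC x P := by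
  right
  obtain ⟨y', h0, h1, h2, h3, h4, -, h6, h7, h8⟩ := s_lemma h hg hx
  have hlt : ∀ e ∈ (P.map tail).headD [], x < e := by
    intro e he
    cases P with
    | nil => simp at he
    | cons r R =>
      cases r with
      | nil => simp at he
      | cons a l =>
        have := hx a (by simp)
        have := (inc_cons.1 h.1).1 e (by simpa using he)
        omega
  obtain ⟨y, -, k1, k2, k3, k4, k5, -⟩ := s_lemma (tab_tail h) (gd_tail h hg) (fun e he => (hlt e he).le)
  obtain rfl := k5 hlt
  rw [← col_succ, zero_add] at k1 k2
  have e1 := up_insert k1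
  rw [k2]
  refine ⟨y, y', h0, by simp, h1, h2, ?_, ?_, h4, k4, ?_, ?_, ?_⟩
  · rw [h3, Finset.erase_insert k1]
  · intro j; rw [h3, col_succ, k3]
  · intro w hw
    have := up_all h6 hw.le
    rw [e1, e1, if_neg (by omega), if_pos (by omega)]
    have := up_mono (col P 1) (show w + 1 ≤ y + 1 by omega)
    omega
  · intro w hw
    rw [e1, e1, if_neg (by omega)]
    by_cases hwy : w < y
    · have a1 := up_all h6 hwy.le
      have a2 := up_lip (col P 0) h0
      have a3 := up_full (col P 1) (show y + 1 ≤ y' + 1 by omega) (fun t t1 t2 => h7 t (by omega) (by omega))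
      have := up_mono (col P 1) (show w + 1 ≤ y + 1 by omega)
      rw [if_pos (by omega)]
      omega
    · have a2 := up_lip (col P 0) hw.le
      have a3 := up_full (col P 1) (show w + 1 ≤ y' + 1 by omega) (fun t t1 t2 => h7 t (by omega) (by omega))
      omega
  · intro w hw
    rw [e1, e1, if_neg (by omega), if_neg (by omega)]
    exact h8 w hw

theorem col_lemma {P : List (List ℕ)} {x : ℕ} (h : Tab P) (hg : Gd x P) : ColC x P := by
  induction P generalizing x with
  | nil => exact col_small h hg (by simp)
  | cons r R ih =>
    cases r with
    | nil => exact col_small h hg (by simp)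
    | cons a l =>
      by_cases hx : x ≤ a
      · refine col_small h hg ?_
        intro e he
        simp only [headD_cons, mem_cons] at he
        rcases he with rfl | he
        · exact hx
        · exact hx.trans ((inc_cons.1 h.1).1 e he).le
      have hr : ri x (a :: l) = (a :: (ri x l).1, (ri x l).2) := by
        rw [ri, if_neg (by omega), if_neg (by omega)]
      have hr1 : (ri x (a :: l)).1 = a :: (ri x l).1 := by rw [hr]
      have hr2 : (ri x (a :: l)).2 = (ri x l).2 := by rw [hr]
      cases ho : (ri x l).2 with
      | none =>
        left
        rw [map_cons, tail_cons, ins_none (hr2.trans ho), ins_none ho, gc_none (hr2.trans ho), gc_none ho, hr1]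
        refine ⟨by rw [col_zero, col_zero], fun j => ?_, by simp⟩
        rw [col_succ]; simp
      | some y0 =>
        have hT := tab_ins x h
        have hTQ := tab_ins x (tab_tail h)
        have hac := tab_col_lt h
        rcases ih h.2.2 (hg.2 y0 (hr2.trans ho)) with hA | hB
        · left
          rw [map_cons, tail_cons, ins_some (hr2.trans ho), ins_some ho, gc_some (hr2.trans ho), gc_some ho, hr1]
          obtain ⟨h1, h2, h3⟩ := hA
          refine ⟨by rw [col_zero, col_zero, h1], fun j => ?_, h3⟩
          rw [col_cons_succ, h2]; rfl
        · right
          obtain ⟨hh, l1, hl1, -⟩ := ri_head x l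
          rw [ins_some (hr2.trans ho), hr1, hl1] at hT
          rw [map_cons, tail_cons, ins_some ho, hl1] at hTQ
          rw [map_cons, tail_cons, ins_some (hr2.trans ho), hr1, ins_some ho, gc_some (hr2.trans ho), gc_some ho, hl1]
          obtain ⟨y, y', h0, h1, h2, h3, h4, h5, h6, h7, hL, hM, hR⟩ := hB
          have hah : a < hh := (inc_cons.1 hT.1).1 hh (by simp)
          have hhV := tab_col_lt hTQ
          have hhy := hhV y h1
          have e0 := up_insert (s := col R 0) (a := a) (fun h => (hac a h).false)
          have e1 := up_insert (s := col (ins y0 (map tail R)) 0) (a := hh) (fun h => (hhV hh h).false)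
          refine ⟨y, y', h0, ?_, ?_, ?_, ?_, ?_, h6, h7, ?_, ?_, ?_⟩
          · rw [col_zero]; exact Finset.mem_insert_of_mem h1
          · rw [col_zero, Finset.mem_insert]
            rintro (h | h)
            · omega
            · exact h2 h
          · rw [col_zero, h3, col_zero, Finset.insert_comm]
          · rw [col_one, h4, col_zero, Finset.erase_insert_of_ne (by omega)]
          · intro j
            rw [col_cons_succ, h5, col_cons_succ]; simp
          · intro w hw
            rw [col_zero, col_zero, e0, e0, e1, e1]
            have := hL w hw
            split_ifs <;> omega
          · intro w hw
            rw [col_zero, col_zero, e0, e0, e1, e1]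
            have := hM w hw
            split_ifs <;> omega
          · intro w hw
            rw [col_zero, col_zero, e0, e0, e1, e1]
            have := hR w hw
            split_ifs <;> omega

theorem stepB {P : List (List ℕ)} {x : ℕ} (h : Tab P) (hg : Gd x P) (h0 : gc x P = 0) :
    (∃ r, r ∉ Kc 0 (col P) ∧ Kc 0 (col (ins x P)) = insert r (Kc 0 (col P)) ∧
      ∀ e ∈ Kc 0 (col P), e ∉ Kc (0+1) (col P) → r < e) ∧ Kc 1 (col (ins x P)) = Kc 1 (col P) := by
  rcases col_lemma h hg with ⟨h1, h2, h3⟩ | ⟨y, y', h0, h1, h2, h3, h4, h5, h6, h7, hL, hM, hR⟩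
  · omega
  have hsw := L_swap' h0 h1 h2 hL hR
  have hc1 : (L (col P 0) (col P 1)).card = (col P 1).card := L_card (tab_domC0 h) (Finset.Subset.refl _)
  have hc2 := L_card (tab_domC0 (tab_ins x h)) (Finset.Subset.refl _)
  rw [h3, h4, hsw, Finset.card_erase_of_mem h1] at hc2
  rcases col_lemma (tab_tail h) (gd_tail h hg) with ⟨k1, k2, k3⟩ | ⟨z, z', -, -, k2, k3, -⟩
  · omega
  rw [← col_succ, zero_add] at k2 k3
  have hLL : L (col P 0) (col P 1) = L (col P 0) (col (ins x (P.map tail)) 0) := by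
    apply Finset.eq_of_subset_of_card_le
    · apply L_mono; rw [k3]; exact Finset.subset_insert _ _
    · rw [hc1, hc2, k3, Finset.card_insert_of_notMem k2]; omega
  refine ⟨⟨y', h2, h3, ?_⟩, ?_⟩
  · intro e he hne
    rw [Kc_succ, Kc_zero, zero_add, hLL, mem_L] at hne
    rw [Kc_zero] at he
    by_contra hlt
    have hney : e ≠ y' := by rintro rfl; exact h2 he
    have := hM e (by omega)
    exact hne ⟨he, y', by omega, by omega⟩
  · have e1 : Kc 1 (col (ins x P)) = L (col (ins x P) 0) (col (ins x P) 1) := rfl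
    have e2 : Kc 1 (col P) = L (col P 0) (col P 1) := rfl
    rw [e1, e2, h3, h4, hsw, hLL]

theorem one_step (N : ℕ) {P : List (List ℕ)} {x : ℕ} (h : Tab P) (hg : Gd x P) (hN : gc x P ≤ N) :
    (∃ r, r ∉ Kc (gc x P) (col P) ∧ Kc (gc x P) (col (ins x P)) = insert r (Kc (gc x P) (col P)) ∧
      ∀ e ∈ Kc (gc x P) (col P), e ∉ Kc (gc x P + 1) (col P) → r < e) ∧
    ∀ i ≤ N, i ≠ gc x P → Kc i (col (ins x P)) = Kc i (col P) := by
  induction N generalizing P x with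
  | zero =>
    have hN0 : gc x P = 0 := by omega
    refine ⟨?_, fun i hi h0 => absurd (Nat.le_zero.1 hi) (by omega)⟩
    rw [hN0]
    exact (stepB h hg hN0).1
  | succ N ih =>
    rcases col_lemma h hg with ⟨h1, h2, h3⟩ | hB
    · obtain ⟨⟨r, k1, k2, k3⟩, k4⟩ := ih (tab_tail h) (gd_tail h hg) (by omega)
      have hf : (fun i => col P (i+1)) = col (P.map tail) := by funext i; exact col_succ P i
      have hg' : (fun i => col (ins x P) (i+1)) = col (ins x (P.map tail)) := by funext i; exact h2 i
      have hK : ∀ i, Kc (i+1) (col (ins x P)) = L (col P 0) (Kc i (col (ins x (P.map tail)))) := by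
        intro i; rw [Kc_succ, hg', h1]
      have hK' : ∀ i, Kc (i+1) (col P) = L (col P 0) (Kc i (col (P.map tail))) := by
        intro i; rw [Kc_succ, hf]
      have hD := tab_domC0 (tab_ins x h)
      rw [h1, h2 0] at hD
      obtain ⟨r', l1, l2, l3⟩ := L_beta hD (by rw [← k2]; exact Kc_sub _ _) k1 (Kc_nest _ _) k3
      refine ⟨?_, ?_⟩
      · rw [h3, hK, hK', hK', k2]
        exact ⟨r', l1, l2, l3⟩
      · rintro (_ | i) hi hne
        · exact h1
        · rw [hK, hK', k4 i (by omega) (by omega)]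
    · have hN0 : gc x P = 0 := by obtain ⟨_, _, _, _, _, _, _, _, h, _⟩ := hB; exact h
      refine ⟨?_, ?_⟩
      · rw [hN0]; exact (stepB h hg hN0).1
      obtain ⟨y, y', h0, h1, h2, h3, h4, h5, h6, h7, hL, hM, hR⟩ := hB
      have k4 := (ih (tab_tail h) (gd_tail h hg) (by omega)).2
      rintro (_ | _ | i) hi hne
      · omega
      · exact (stepB h hg hN0).2
      · have hf : (fun i => col P (i+1)) = col (P.map tail) := by funext i; exact col_succ P i
        have hg' : (fun i => col (ins x P) (i+2)) = (fun i => col (ins x (P.map tail)) (i+1)) := by funext i; exact h5 i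
        have e1 : Kc (i+2) (col (ins x P)) = L (col (ins x P) 0) (L (col (ins x P) 1) (Kc i (fun i => col (ins x P) (i+2)))) := rfl
        rw [e1, hg', h3, h4, L_swap h0 h1 h2 hL hR, ← Kc_succ, k4 (i+1) (by omega) (by omega), Kc_succ (i+1) (col P), hf]

noncomputable def aP (P : List (List ℕ)) (r : ℕ) : ℕ := sInf {j | r ∉ Kc j (col P)}

theorem col_large {P : List (List ℕ)} (h : Tab P) {j : ℕ} (hj : (P.headD []).length ≤ j) : col P j = ∅ := by
  induction j generalizing P with
  | zero =>
    cases P with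
    | nil => rfl
    | cons r R =>
      have : r = [] := by simpa using hj
      subst this
      rw [col_ncons]; exact tab_nil h 0
  | succ j ih =>
    rw [col_succ]
    apply ih (tab_tail h)
    cases P with
    | nil => simp
    | cons r R => simp at hj ⊢; exact hj

theorem kc_card {P : List (List ℕ)} (h : Tab P) (j : ℕ) : (Kc j (col P)).card = (col P j).card :=
  Kc_card j _ (tab_domC h)

theorem kc_anti {f : ℕ → Finset ℕ} {i j : ℕ} (h : i ≤ j) : Kc j f ⊆ Kc i f := by
  induction j, h using Nat.le_induction with
  | base => exact Finset.Subset.refl _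
  | succ j _ ih => exact (Kc_nest j f).trans ih

theorem mem_Kc_iff {P : List (List ℕ)} (h : Tab P) {r j : ℕ} : r ∈ Kc j (col P) ↔ j < aP P r := by
  have hne : {j | r ∉ Kc j (col P)}.Nonempty := by
    refine ⟨(P.headD []).length, ?_⟩
    have : Kc (P.headD []).length (col P) = ∅ := by
      rw [← Finset.card_eq_zero, kc_card h, col_large h le_rfl]; rfl
    rw [Set.mem_setOf_eq, this]; exact Finset.notMem_empty _
  constructor
  · intro hm
    by_contra hn
    exact Nat.sInf_mem hne (kc_anti (by unfold aP at hn; omega) hm)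
  · intro hj
    by_contra hn
    have : aP P r ≤ j := Nat.sInf_le hn
    omega

theorem aP_pos {P : List (List ℕ)} (h : Tab P) {r : ℕ} : 0 < aP P r ↔ r ∈ col P 0 := (mem_Kc_iff h).symm

theorem aP_step {P : List (List ℕ)} {x : ℕ} (h : Tab P) (hr : Red (wordOf P ++ [x])) :
    ∃ r, aP (ins x P) = Function.update (aP P) r (gc x P + 1) ∧ aP P r = gc x P ∧
      ∀ r' < r, aP (ins x P) r' ≠ gc x P + 1 := by
  have hg := gd_of_red h hr
  have hT := tab_ins x h
  obtain ⟨⟨r, h1, h2, h3⟩, -⟩ := one_step (gc x P) h hg le_rfl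
  have h4 : ∀ i, i ≠ gc x P → Kc i (col (ins x P)) = Kc i (col P) := fun i hi =>
    (one_step (max i (gc x P)) h hg (le_max_right _ _)).2 i (le_max_left _ _) hi
  have a1 : aP P r = gc x P := by
    rw [mem_Kc_iff h] at h1
    cases hj : gc x P with
    | zero => omega
    | succ j =>
      have h5 : r ∈ Kc (j+1) (col (ins x P)) := by rw [← hj, h2]; simp
      have h6 := Kc_nest _ _ h5
      rw [h4 j (by omega), mem_Kc_iff h] at h6
      omega
  have a2 : aP (ins x P) r = gc x P + 1 := by
    have h5 : r ∈ Kc (gc x P) (col (ins x P)) := by rw [h2]; simp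
    rw [mem_Kc_iff hT] at h5
    have h6 : r ∉ Kc (gc x P + 1) (col (ins x P)) := by
      rw [h4 _ (by omega), mem_Kc_iff h]; omega
    rw [mem_Kc_iff hT] at h6
    omega
  have a3 : ∀ r', r' ≠ r → aP (ins x P) r' = aP P r' := by
    intro r' hne
    have : ∀ i, i < aP (ins x P) r' ↔ i < aP P r' := by
      intro i
      rw [← mem_Kc_iff hT, ← mem_Kc_iff h]
      by_cases hi : i = gc x P
      · rw [hi, h2, Finset.mem_insert]; simp [hne]
      · rw [h4 i hi]
    have p1 := this (aP P r')
    have p2 := this (aP (ins x P) r')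
    omega
  refine ⟨r, ?_, a1, ?_⟩
  · funext r'
    by_cases hne : r' = r
    · subst hne; rw [Function.update_self, a2]
    · rw [Function.update_of_ne hne, a3 r' hne]
  · intro r' hlt heq
    rw [a3 r' (by omega)] at heq
    have := h3 r' ((mem_Kc_iff h).2 (by omega)) (by rw [mem_Kc_iff h]; omega)
    omega


theorem col_card_step {P : List (List ℕ)} {x : ℕ} (h : Tab P) (hr : Red (wordOf P ++ [x])) (i : ℕ) :
    (col (ins x P) i).card = (col P i).card + if gc x P = i then 1 else 0 := by
  have hg := gd_of_red h hr
  have hT := tab_ins x h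
  rw [← kc_card h, ← kc_card hT]
  obtain ⟨⟨r, h1, h2, h3⟩, h4⟩ := one_step (max i (gc x P)) h hg (le_max_right _ _)
  split_ifs with hi
  · subst hi; rw [h2, Finset.card_insert_of_notMem h1]
  · rw [h4 i (le_max_left _ _) (Ne.symm hi)]; rfl

noncomputable def gr : List ℕ → List ℕ
  | [] => []
  | x :: u => sInf {r | aP (PT (x :: u)) r ≠ aP (PT u) r} :: gr u

theorem gr_length (u : List ℕ) : (gr u).length = u.length := by
  induction u with
  | nil => rfl
  | cons x u ih => simp [gr, ih]

theorem gr_eq {x : ℕ} {u : List ℕ} {r v : ℕ} (h : aP (PT (x :: u)) = Function.update (aP (PT u)) r v)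
    (h2 : aP (PT u) r ≠ v) : gr (x :: u) = r :: gr u := by
  have : {r | aP (PT (x :: u)) r ≠ aP (PT u) r} = {r} := by
    ext r'
    rw [Set.mem_singleton_iff]
    show aP (PT (x :: u)) r' ≠ aP (PT u) r' ↔ _
    rw [h]
    by_cases hr : r' = r
    · subst hr; simp [Ne.symm h2]
    · simp [hr]
  rw [gr, this]; simp

theorem gr_step {x : ℕ} {u : List ℕ} (h : Red (x :: u).reverse) :
    ∃ r, gr (x :: u) = r :: gr u ∧ aP (PT (x :: u)) = Function.update (aP (PT u)) r (gc x (PT u) + 1) ∧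
      aP (PT u) r = gc x (PT u) ∧ ∀ r' < r, aP (PT (x :: u)) r' ≠ gc x (PT u) + 1 := by
  obtain ⟨r, h1, h2, h3⟩ := aP_step (PT_tab u) (PT_red h)
  exact ⟨r, gr_eq h1 (by omega), h1, h2, h3⟩

theorem red_tail {x : ℕ} {u : List ℕ} (h : Red (x :: u).reverse) : Red u.reverse := by
  rw [reverse_cons] at h; exact h.left

theorem aP_nil (r : ℕ) : aP [] r = 0 := by
  by_contra h
  have := (aP_pos (P := []) trivial (r := r)).1 (by omega)
  simp [col] at this

theorem gr_count {u : List ℕ} (h : Red u.reverse) (r : ℕ) : (gr u).count r = aP (PT u) r := by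
  induction u generalizing r with
  | nil => simp [gr, PT_nil, aP_nil]
  | cons x u ih =>
    obtain ⟨r0, h1, h2, h3, -⟩ := gr_step h
    rw [h1, h2, count_cons, ih (red_tail h)]
    by_cases hr : r = r0
    · subst hr; simp [h3]
    · simp [hr, Ne.symm hr]

def Adm : List ℕ → Prop
  | [] => True
  | r :: g => (∀ r' < r, g.count r' ≠ g.count r + 1) ∧ Adm g

theorem gr_adm {u : List ℕ} (h : Red u.reverse) : Adm (gr u) := by
  induction u with
  | nil => trivial
  | cons x u ih =>
    obtain ⟨r, h1, h2, h3, h4⟩ := gr_step h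
    rw [h1]
    refine ⟨fun r' hr' => ?_, ih (red_tail h)⟩
    rw [gr_count (red_tail h), gr_count (red_tail h), h3]
    have := h4 r' hr'
    rwa [h2, Function.update_of_ne (by omega)] at this

theorem gr_gc {x : ℕ} {u : List ℕ} {r : ℕ} {g : List ℕ} (h : Red (x :: u).reverse) (hg : gr (x :: u) = r :: g) :
    gc x (PT u) = g.count r := by
  obtain ⟨r', h1, h2, h3, h4⟩ := gr_step h
  rw [h1] at hg
  obtain ⟨rfl, rfl⟩ := cons.inj hg
  rw [gr_count (red_tail h), h3]

theorem gr_inj {u u' : List ℕ} (h : Red u.reverse) (h' : Red u'.reverse) (hP : PT u = PT u')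
    (hg : gr u = gr u') : u = u' := by
  induction u generalizing u' with
  | nil =>
    have := gr_length u'
    rw [← hg] at this
    exact (length_eq_zero_iff.1 (by simpa [gr] using this.symm)).symm
  | cons x u ih =>
    cases u' with
    | nil => simp [gr] at hg
    | cons x' u' =>
      obtain ⟨r, h1, -⟩ := gr_step h
      obtain ⟨r', h1', -⟩ := gr_step h'
      have e1 := gr_gc h h1
      have e2 := gr_gc h' h1'
      rw [h1, h1'] at hg
      obtain ⟨hrr, hg2⟩ := cons.inj hg
      subst hrr
      obtain ⟨rfl, hP'⟩ := ins_inj (PT_tab u) (PT_tab u') (PT_ne u) (PT_ne u') (PT_red h) (PT_red h') hP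
        (by rw [e1, e2, hg2])
      rw [ih (red_tail h) (red_tail h') hP' hg2]

theorem col_card {P : List (List ℕ)} (h : Tab P) (j : ℕ) : (col P j).card = P.countP (fun r => j < r.length) := by
  induction j generalizing P with
  | zero =>
    induction P with
    | nil => rfl
    | cons r R ih =>
      cases r with
      | nil => rw [col_ncons, ih h.2.2]; simp
      | cons a l =>
        rw [col_zero, Finset.card_insert_of_notMem (fun hm => (tab_col_lt h a hm).false), ih h.2.2]; simp
  | succ j ih =>
    rw [col_succ, ih (tab_tail h), countP_map]
    congr 1
    funext r
    simp; omega

theorem col_nil_of {P : List (List ℕ)} (hn : NE P) (h : col P 0 = ∅) : P = [] := by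
  cases P with
  | nil => rfl
  | cons r R =>
    cases r with
    | nil => exact absurd rfl (hn [] (by simp))
    | cons a l => rw [col_zero] at h; simp at h

theorem corner {P : List (List ℕ)} (h : Tab P) {r j : ℕ} (hr : aP P r = j + 1) : ∃ s ∈ P, s.length = j + 1 := by
  by_contra hc
  push Not at hc
  have h1 : (Kc (j+1) (col P)).card < (Kc j (col P)).card := by
    apply Finset.card_lt_card
    refine ⟨Kc_nest _ _, fun hs => ?_⟩
    have := hs ((mem_Kc_iff h (r := r)).2 (by omega))
    rw [mem_Kc_iff h] at this
    omega
  rw [kc_card h, kc_card h, col_card h, col_card h] at h1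
  have : P.countP (fun r => j < r.length) = P.countP (fun r => j + 1 < r.length) := by
    apply countP_congr
    intro s hs
    have := hc s hs
    simp; omega
  omega

theorem gr_surj {g : List ℕ} {P : List (List ℕ)} (hg : Adm g) (hT : Tab P) (hn : NE P) (hr : Red (wordOf P))
    (ha : ∀ r, g.count r = aP P r) : ∃ u, Red u.reverse ∧ PT u = P ∧ gr u = g := by
  induction g generalizing P with
  | nil =>
    have : P = [] := by
      apply col_nil_of hn
      ext r
      rw [← aP_pos hT, ← ha]; simp
    subst this
    exact ⟨[], red_nil, rfl, rfl⟩
  | cons r g ih =>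
    have hj : aP P r = g.count r + 1 := by rw [← ha]; simp
    obtain ⟨x, P', hT', hn', hins, hgc, hr'⟩ := ins_inv hT hn hr (corner hT hj)
    obtain ⟨r0, h1, h2, h3⟩ := aP_step hT' hr'
    rw [hins, hgc] at h1 h3
    have hr0 : r = r0 := by
      have e0 : aP P r0 = g.count r + 1 := by rw [h1]; simp
      by_contra hne
      rcases Nat.lt_or_gt_of_ne hne with hlt | hlt
      · exact h3 r hlt hj
      · apply hg.1 r0 hlt
        rw [← e0, ← ha, count_cons_of_ne (Ne.symm (by omega))]
    subst hr0
    obtain ⟨u, k1, k2, k3⟩ := ih hg.2 hT' hn' hr'.left (fun r' => by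
      have := ha r'
      rw [h1] at this
      by_cases hne : r' = r
      · subst hne; rw [h2, hgc]
      · rw [Function.update_of_ne hne, count_cons_of_ne (Ne.symm hne)] at this
        exact this)
    refine ⟨x :: u, ?_, ?_, ?_⟩
    · rw [reverse_cons]
      have := (PT_ck k1).right [x]
      rw [k2] at this
      exact this.symm.red hr'
    · rw [PT_cons, k2, hins]
    · rw [gr_eq (r := r) (v := g.count r + 1), k3]
      · rw [PT_cons, k2, hins, h1]
      · rw [k2, h2, hgc]; omega

theorem gr_app (u v : List ℕ) : ∃ g, gr (v ++ u) = g ++ gr u ∧ g.length = v.length := by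
  induction v with
  | nil => exact ⟨[], rfl, rfl⟩
  | cons x v ih =>
    obtain ⟨g, h1, h2⟩ := ih
    exact ⟨_ :: g, by rw [cons_append, gr, h1]; rfl, by simp [h2]⟩

theorem mem_wordOf {P : List (List ℕ)} {e : ℕ} : e ∈ wordOf P ↔ ∃ r ∈ P, e ∈ r := by simp [wordOf]

theorem col0_mem {P : List (List ℕ)} {e : ℕ} (h : e ∈ col P 0) : e ∈ wordOf P := by
  induction P with
  | nil => simp [col] at h
  | cons r R ih =>
    rw [wordOf_cons, mem_append]
    cases r with
    | nil => rw [col_ncons] at h; exact Or.inl (ih h)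
    | cons a l =>
      rw [col_zero, Finset.mem_insert] at h
      rcases h with rfl | h
      · right; simp
      · exact Or.inl (ih h)

theorem col0_le {P : List (List ℕ)} (hT : Tab P) {e : ℕ} (h : e ∈ wordOf P) : ∃ a ∈ col P 0, a ≤ e := by
  induction P with
  | nil => simp [wordOf] at h
  | cons r R ih =>
    rw [wordOf_cons, mem_append] at h
    cases r with
    | nil => rw [col_ncons]; simp at h; exact ih hT.2.2 h
    | cons a l =>
      rw [col_zero]
      rcases h with h | h
      · obtain ⟨b, hb, hbe⟩ := ih hT.2.2 h
        exact ⟨b, Finset.mem_insert_of_mem hb, hbe⟩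
      · refine ⟨a, by simp, ?_⟩
        rw [mem_cons] at h
        rcases h with rfl | h
        · exact le_rfl
        · exact ((inc_cons.1 hT.1).1 e h).le

theorem gr_mem {u : List ℕ} (h : Red u.reverse) {r : ℕ} : r ∈ gr u ↔ r ∈ col (PT u) 0 := by
  rw [← aP_pos (PT_tab u), ← gr_count h, count_pos_iff]

theorem pt_mem {u : List ℕ} (h : Red u.reverse) {e : ℕ} : e ∈ u ↔ e ∈ wordOf (PT u) := by
  rw [← (PT_ck h).mem, mem_reverse]

theorem gr_bd {u : List ℕ} (h : Red u.reverse) (m : ℕ) : (∀ e ∈ u, m ≤ e) ↔ ∀ r ∈ gr u, m ≤ r := by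
  constructor
  · intro hu r hr
    exact hu r ((pt_mem h).2 (col0_mem ((gr_mem h).1 hr)))
  · intro hu e he
    obtain ⟨a, ha, hae⟩ := col0_le (PT_tab u) ((pt_mem h).1 he)
    exact (hu a ((gr_mem h).2 ha)).trans hae

theorem gr_perm {u u' : List ℕ} (h : Red u.reverse) (h' : Red u'.reverse) (hP : PT u = PT u') : gr u ~ gr u' := by
  rw [perm_iff_count]
  intro r
  rw [gr_count h, gr_count h', hP]

/-- (i): a prefix all of whose letters are `≥ m` is short. -/
theorem pre_le {v u w : List ℕ} {m : ℕ} (h : Red (v ++ u).reverse) (hw : Red w.reverse) (hP : PT (v ++ u) = PT w)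
    (hm : ∀ e ∈ u, m ≤ e) : u.length ≤ (gr w).countP (fun r => m ≤ r) := by
  obtain ⟨g, h1, -⟩ := gr_app u v
  rw [← (gr_perm h hw hP).countP_eq, h1, countP_append]
  have hu : Red u.reverse := by rw [reverse_append] at h; exact h.left
  have : (gr u).countP (fun r => m ≤ r) = (gr u).length := by
    rw [countP_eq_length]
    intro r hr
    simpa using (gr_bd hu m).1 hm r hr
  rw [this, gr_length]; omega

theorem adm_sorted {g : List ℕ} (h : g.Pairwise (· ≤ ·)) : Adm g := by
  induction g with
  | nil => trivial
  | cons r g ih =>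
    rw [pairwise_cons] at h
    refine ⟨fun r' hr' => ?_, ih h.2⟩
    rw [count_eq_zero_of_not_mem]
    · omega
    · intro hm; have := h.1 r' hm; omega

/-! growth columns -/
def gs : List ℕ → List (List ℕ) → List ℕ
  | [], _ => []
  | x :: v, P => gc x (v.foldr ins P) :: gs v P

theorem gs_append (v u : List ℕ) (P) : gs (v ++ u) P = gs v (u.foldr ins P) ++ gs u P := by
  induction v with
  | nil => rfl
  | cons x v ih => simp [gs, ih]
theorem gs_length (v : List ℕ) (P) : (gs v P).length = v.length := by
  induction v with
  | nil => rfl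
  | cons x v ih => simp [gs, ih]
theorem tab_fold {P} (h : Tab P) (v : List ℕ) : Tab (v.foldr ins P) := by
  induction v with
  | nil => exact h
  | cons x v ih => exact tab_ins x ih

theorem gs_dec {P} (h : Tab P) {v : List ℕ} (hv : v.Pairwise (· > ·)) : (gs v P).Pairwise (· > ·) := by
  rw [← isChain_iff_pairwise] at hv ⊢
  induction v with
  | nil => simp [gs]
  | cons x v ih =>
    cases v with
    | nil => simp [gs]
    | cons y v =>
      rw [isChain_cons_cons] at hv
      have := ih hv.2
      simp only [gs] at this ⊢
      rw [isChain_cons_cons]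
      exact ⟨pieri_lt (tab_fold h v) hv.1, this⟩

theorem gs_inj {u u' : List ℕ} (h : Red u.reverse) (h' : Red u'.reverse) (hP : PT u = PT u')
    (hg : gs u [] = gs u' []) : u = u' := by
  induction u generalizing u' with
  | nil => cases u' <;> simp_all [gs]
  | cons x u ih =>
    cases u' with
    | nil => simp [gs] at hg
    | cons x' u' =>
      simp only [gs, cons.injEq] at hg
      obtain ⟨rfl, hP'⟩ := ins_inj (PT_tab u) (PT_tab u') (PT_ne u) (PT_ne u') (PT_red h) (PT_red h') hP hg.1
      rw [ih (red_tail h) (red_tail h') hP' hg.2]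

theorem gs_count {u : List ℕ} (h : Red u.reverse) (i : ℕ) : (gs u []).count i = (col (PT u) i).card := by
  induction u with
  | nil => simp [gs, PT_nil, col]
  | cons x u ih =>
    rw [PT_cons, col_card_step (PT_tab u) (PT_red h), ← ih (red_tail h)]
    simp only [gs, count_cons, PT, beq_iff_eq]
    congr 1

theorem dec_countP {s : List ℕ} (h : s.Pairwise (· > ·)) (j : ℕ) : s.countP (fun e => e < j) ≤ min j s.length := by
  refine le_min ?_ countP_le_length
  rw [countP_eq_length_filter]
  have hn : (s.filter (fun e => decide (e < j))).Nodup := ((h.imp (fun h => (ne_of_gt h))).filter _)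
  have := hn.subperm (l₂ := range j) (fun e he => by simpa using (mem_filter.1 he).2)
  simpa using this.length_le

theorem dec_eq {s : List ℕ} (h : s.Pairwise (· > ·)) (hs : ∀ e ∈ s, e < s.length) : s = (range s.length).reverse := by
  induction s with
  | nil => rfl
  | cons a s ih =>
    rw [pairwise_cons] at h
    have ha := hs a (by simp)
    have hb : ∀ e ∈ s, e < s.length := fun e he => by
      have h1 := h.1 e he
      simp only [length_cons] at ha
      omega
    have hs' := ih h.2 hb
    have hlen : a = s.length := by
      by_contra hne
      simp only [length_cons] at ha
      have hpos : s.length - 1 ∈ s := by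
        rw [hs']; simp; omega
      have := h.1 _ hpos
      omega
    rw [length_cons, range_succ, reverse_append, ← hs', hlen]; simp

theorem sum_min (l : List ℕ) (j : ℕ) : (l.map (fun c => min j c)).sum = ∑ i ∈ Finset.range j, l.countP (fun c => i < c) := by
  induction l with
  | nil => simp
  | cons a l ih =>
    simp only [map_cons, sum_cons, ih, countP_cons, Finset.sum_add_distrib]
    rw [add_comm]
    congr 1
    simp only [decide_eq_true_eq, Finset.sum_boole, Nat.cast_id]
    rw [show (Finset.range j).filter (fun i => i < a) = Finset.range (min j a) by ext; simp]
    simp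

theorem countP_lt_sum (l : List ℕ) (j : ℕ) : l.countP (fun e => e < j) = ∑ i ∈ Finset.range j, l.count i := by
  induction l with
  | nil => simp
  | cons a l ih =>
    simp only [countP_cons, count_cons, Finset.sum_add_distrib, ih]
    congr 1
    simp [Finset.sum_ite_eq]

/-- reversed word of a list of rows -/
def ub (B : List (List ℕ)) : List ℕ := (B.map reverse).flatten
theorem ub_rev (B : List (List ℕ)) : (ub B).reverse = wordOf B := by
  induction B with
  | nil => rfl
  | cons r B ih => rw [wordOf_cons, ← ih]; simp [ub]
theorem ub_cons (r) (B : List (List ℕ)) : ub (r :: B) = r.reverse ++ ub B := rfl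

theorem pw_rev {r : List ℕ} (h : Inc r) : r.reverse.Pairwise (· > ·) := by
  rw [pairwise_reverse]; exact h

/-- (F) -/
theorem f_le {B : List (List ℕ)} (hB : ∀ r ∈ B, Inc r) (j : ℕ) :
    (gs (ub B) []).countP (fun e => e < j) ≤ ((B.map length).map (fun c => min j c)).sum := by
  induction B with
  | nil => simp [ub, gs]
  | cons r B ih =>
    rw [ub_cons, gs_append, countP_append]
    have h1 := dec_countP (gs_dec (PT_tab (ub B)) (pw_rev (hB r (by simp)))) j
    rw [gs_length, length_reverse] at h1
    have h2 := ih (fun r hr => hB r (by simp [hr]))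
    simp only [map_cons, sum_cons]
    exact Nat.add_le_add h1 h2

theorem f_eq {B : List (List ℕ)} (hB : ∀ r ∈ B, Inc r)
    (h : ∀ j, (gs (ub B) []).countP (fun e => e < j) = ((B.map length).map (fun c => min j c)).sum) :
    gs (ub B) [] = (B.map (fun r => (range r.length).reverse)).flatten := by
  induction B with
  | nil => simp [ub, gs]
  | cons r B ih =>
    have hd := gs_dec (PT_tab (ub B)) (pw_rev (hB r (by simp)))
    have hB' : ∀ r ∈ B, Inc r := fun r hr => hB r (by simp [hr])
    have hl : (gs r.reverse (PT (ub B))).length = r.length := by rw [gs_length, length_reverse]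
    have key : ∀ j, (gs r.reverse (PT (ub B))).countP (fun e => e < j) = min j r.length ∧
        (gs (ub B) []).countP (fun e => e < j) = ((B.map length).map (fun c => min j c)).sum := by
      intro j
      have h0 := h j
      rw [ub_cons, gs_append, countP_append] at h0
      have h1 := dec_countP hd j
      rw [hl] at h1
      have h2 := f_le hB' j
      simp only [map_cons, sum_cons] at h0
      have h3 : countP (fun e => decide (e < j)) (gs r.reverse (foldr ins [] (ub B))) =
        countP (fun e => decide (e < j)) (gs r.reverse (PT (ub B))) := rfl
      omega
    rw [ub_cons, gs_append, map_cons, flatten_cons, ih hB' (fun j => (key j).2)]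
    congr 1
    have := dec_eq hd (by
      have := (key r.length).1
      rw [min_self, ← hl, countP_eq_length] at this
      intro e he
      simpa using this e he)
    rw [hl] at this
    exact this

theorem colsum {P : List (List ℕ)} (hT : Tab P) (j : ℕ) :
    ∑ i ∈ Finset.range j, (col P i).card = ((P.map length).map (fun c => min j c)).sum := by
  rw [sum_min]
  apply Finset.sum_congr rfl
  intro i _
  rw [col_card hT, countP_map]
  rfl

/-- (U) -/
theorem u_uniq {B B' : List (List ℕ)} (hB : ∀ r ∈ B, Inc r) (hB' : ∀ r ∈ B', Inc r) (hr : Red (wordOf B))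
    (hr' : Red (wordOf B')) (hP : PT (ub B) = PT (ub B')) (hlen : B.map length = B'.map length)
    (hsh : B.map length ~ (PT (ub B)).map length) : B = B' := by
  have E : ∀ B : List (List ℕ), (∀ r ∈ B, Inc r) → Red (wordOf B) → B.map length ~ (PT (ub B)).map length →
      gs (ub B) [] = (B.map (fun r => (range r.length).reverse)).flatten := by
    intro B hB hr hsh
    apply f_eq hB
    intro j
    rw [← ub_rev] at hr
    rw [countP_lt_sum, (hsh.map _).sum_eq, ← colsum (PT_tab _)]
    exact Finset.sum_congr rfl (fun i _ => gs_count hr i)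
  have e1 := E B hB hr hsh
  have e2 := E B' hB' hr' (by rw [← hP, ← hlen]; exact hsh)
  have e3 : (B.map (fun r => (range r.length).reverse)) = (B'.map (fun r => (range r.length).reverse)) := by
    have := congrArg (map (fun n => (range n).reverse)) hlen
    simpa [map_map, Function.comp_def] using this
  have hu : ub B = ub B' := gs_inj (by rwa [ub_rev]) (by rwa [ub_rev]) hP (by rw [e1, e2, e3])
  have h1 := eq_iff_flatten_eq.2 ⟨hu, by simpa [map_map, Function.comp_def] using hlen⟩
  exact (map_injective_iff.2 reverse_injective) h1


abbrev Dec (l : List ℕ) : Prop := l.Pairwise (· > ·)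

def U : List ℕ → List ℕ → List ℕ × List ℕ
  | τ, [] => (τ, [])
  | [], s :: σ => (s :: σ, [])
  | t :: τ, s :: σ => if t < s then (s :: (U (t :: τ) σ).1, (U (t :: τ) σ).2)
      else (t :: (U τ σ).1, (if t = s then s - 1 else s) :: (U τ σ).2)

theorem U_nil (σ : List ℕ) : U [] σ = (σ, []) := by cases σ <;> simp [U]

def Gd2 : List ℕ → List ℕ → Prop
  | _, [] => True
  | [], _ :: _ => True
  | t :: τ, s :: σ => if t < s then Gd2 (t :: τ) σ else (t = s → 1 ≤ s ∧ ∃ l, σ = (s - 1) :: l) ∧ Gd2 τ σ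

def OKr : List ℕ → List ℕ → Prop
  | _, [] => True
  | [], _ :: _ => False
  | t :: τ, s :: σ => if t < s then OKr (t :: τ) σ else OKr τ σ

theorem mvl {L S : List ℕ} {y t : ℕ} (h : Inc (L ++ [y])) (hy : y < t) :
    CK (L ++ t :: y :: S) (t :: (L ++ y :: S)) := by
  induction L with
  | nil => exact CK.refl _
  | cons x L ih =>
    rw [cons_append, inc_cons] at h
    refine (CK.cons x (ih h.2)).trans ?_
    cases L with
    | nil => exact CK.k1 S (h.1 y (by simp)) hy
    | cons z L =>
      have h2 := inc_cons.1 h.2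
      exact CK.k1 _ (h.1 z (by simp)) ((h2.1 y (by simp)).trans hy)

theorem un1 {L M : List ℕ} {s t : ℕ} (h : Inc (L ++ s :: M)) (ht : Inc (t :: M)) (hs : s < t) :
    CK (t :: (L ++ s :: M)) (L ++ t :: (M ++ [s])) := by
  have h1 : CK (L ++ t :: (M ++ [s])) (L ++ t :: s :: M) := (ck_small hs ht).left L
  have h2 : Inc (L ++ [s]) := by
    rw [inc_append] at h ⊢
    exact ⟨h.1, by simp, fun a ha b hb => h.2.2 a ha b (by simp at hb; simp [hb])⟩
  exact ((h1.trans (mvl h2 hs))).symm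

theorem un2 {L M : List ℕ} {t : ℕ} (h : Inc (L ++ (t - 1) :: t :: M)) (ht : 1 ≤ t) :
    CK (t :: (L ++ (t - 1) :: t :: M)) (L ++ (t - 1) :: t :: (M ++ [t - 1])) := by
  obtain ⟨t, rfl⟩ : ∃ t', t = t' + 1 := ⟨t - 1, by omega⟩
  simp only [Nat.add_sub_cancel] at *
  have hm := inc_append.1 h
  have h1 : CK (L ++ t :: (t+1) :: (M ++ [t])) (L ++ t :: (t+1) :: t :: M) :=
    ((ck_small (by omega) (inc_cons.1 hm.2.1).2).cons t).left L
  have h2 : CK (L ++ t :: (t+1) :: t :: M) (L ++ (t+1) :: t :: (t+1) :: M) := (CK.br t M).left L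
  have h3 : Inc (L ++ [t]) := by
    rw [inc_append]
    exact ⟨hm.1, by simp, fun a ha b hb => hm.2.2 a ha b (by simp at hb; simp [hb])⟩
  exact ((h1.trans h2).trans (mvl h3 (by omega))).symm

theorem dec_rev {l : List ℕ} (h : Dec l) : Inc l.reverse := by
  rw [Inc, pairwise_reverse]; exact h

theorem U_ck (τ σ C : List ℕ) (hC : Dec (C ++ σ)) (hτ : Dec τ) (hCτ : ∀ c ∈ C, ∀ t ∈ τ, t < c)
    (hr : Red (τ.reverse ++ (C ++ σ).reverse)) :
    CK (τ.reverse ++ (C ++ σ).reverse) ((C ++ (U τ σ).1).reverse ++ (U τ σ).2.reverse) ∧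
      Dec (C ++ (U τ σ).1) ∧ Gd2 τ σ := by
  induction σ generalizing τ C with
  | nil =>
    simp only [U, append_nil, reverse_append, reverse_nil, Gd2, and_true]
    refine ⟨CK.refl _, pairwise_append.2 ⟨by simpa using hC, hτ, hCτ⟩⟩
  | cons s σ ih =>
    cases τ with
    | nil => simp only [U, reverse_nil, nil_append, append_nil, Gd2, and_true]; exact ⟨CK.refl _, hC⟩
    | cons t τ =>
      rw [Dec, pairwise_cons] at hτ
      have hC' := pairwise_append.1 hC
      have hσ := pairwise_cons.1 hC'.2.1
      simp only [U, Gd2]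
      split_ifs with h1 h2
      · have := ih (t :: τ) (C ++ [s]) (by simpa using hC) (pairwise_cons.2 hτ) (by
          intro c hc t' ht'
          rcases mem_append.1 hc with hc | hc
          · exact hCτ c hc t' ht'
          · simp at hc ht'
            rcases ht' with rfl | ht'
            · omega
            · have := hτ.1 t' ht'; omega) (by simpa using hr)
        simpa using this
      · subst h2
        have hd : Dec (C ++ t :: σ) := hC
        have hr1 : Red (t :: ((C ++ t :: σ).reverse)) := by
          have := hr; simp only [reverse_cons, append_assoc] at this; exact this.right
        obtain ⟨hm, ht1⟩ := red_prev (A := []) (B := []) (y := t) (row := (C ++ t :: σ).reverse) (by simpa using hr1)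
          (dec_rev hd) (by simp)
        have hm' : t - 1 ∈ σ := by
          simp only [mem_reverse, mem_append, mem_cons] at hm
          rcases hm with hm | hm | hm
          · have := hC'.2.2 _ hm t (by simp); omega
          · omega
          · exact hm
        obtain ⟨l, rfl⟩ : ∃ l, σ = (t - 1) :: l := by
          cases σ with
          | nil => simp at hm'
          | cons a l =>
            simp only [mem_cons] at hm'
            rcases hm' with rfl | hm'
            · exact ⟨l, rfl⟩
            · have := (pairwise_cons.1 hσ.2).1 _ hm'
              have := hσ.1 a (by simp); omega
        have hu : CK (t :: (C ++ t :: (t - 1) :: l).reverse) ((C ++ t :: (t - 1) :: l).reverse ++ [t - 1]) := by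
          have := un2 (L := l.reverse) (M := C.reverse) (t := t) (by simpa using dec_rev hd) ht1
          simpa using this
        have hck : CK ((t :: τ).reverse ++ (C ++ t :: (t-1) :: l).reverse)
            ((τ.reverse ++ (C ++ t :: (t - 1) :: l).reverse) ++ [t-1]) := by
          have := hu.left τ.reverse
          simpa using this
        have := ih τ (C ++ [t]) (by simpa using hC) hτ.2 (by
          intro c hc t' ht'
          rcases mem_append.1 hc with hc | hc
          · exact hCτ c hc t' (by simp [ht'])
          · simp at hc; subst hc; exact hτ.1 t' ht') (by
            have := (hck.red hr).left; simpa using this)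
        refine ⟨hck.trans ?_, by simpa using this.2.1, fun _ => ⟨ht1, l, rfl⟩, this.2.2⟩
        have := this.1.right [t - 1]
        simpa using this
      · have hts : s < t := by omega
        have hd : Dec (C ++ s :: σ) := hC
        have hd2 : Dec (C ++ [t]) := pairwise_append.2 ⟨hC'.1, by simp, fun a ha b hb => by
          simp at hb; subst hb; exact hCτ a ha b (by simp)⟩
        have hu : CK (t :: (C ++ s :: σ).reverse) ((C ++ t :: σ).reverse ++ [s]) := by
          have := un1 (L := σ.reverse) (M := C.reverse) (t := t) (s := s) (by simpa using dec_rev hd)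
            (by simpa using dec_rev hd2) hts
          simpa using this
        have hck : CK ((t :: τ).reverse ++ (C ++ s :: σ).reverse)
            ((τ.reverse ++ (C ++ t :: σ).reverse) ++ [s]) := by
          have := hu.left τ.reverse
          simpa using this
        have := ih τ (C ++ [t]) (by
          rw [Dec, pairwise_append]
          refine ⟨hd2, hσ.2, fun a ha b hb => ?_⟩
          have := hσ.1 b hb
          rcases mem_append.1 ha with ha | ha
          · exact hC'.2.2 a ha b (by simp [hb])
          · simp at ha; subst ha; omega) hτ.2 (by
          intro c hc t' ht'
          rcases mem_append.1 hc with hc | hc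
          · exact hCτ c hc t' (by simp [ht'])
          · simp at hc; subst hc; exact hτ.1 t' ht') (by
            have := (hck.red hr).left; simpa using this)
        refine ⟨hck.trans ?_, by simpa using this.2.1, fun h => absurd h h2, this.2.2⟩
        have := this.1.right [s]
        simpa using this

theorem U_bot_le (τ σ : List ℕ) : ∀ b ∈ (U τ σ).2, ∃ s ∈ σ, b ≤ s := by
  induction σ generalizing τ with
  | nil => simp [U]
  | cons s σ ih =>
    cases τ with
    | nil => simp [U]
    | cons t τ =>
      simp only [U]
      split_ifs with h1 h2
      · intro b hb; obtain ⟨s', h, h'⟩ := ih _ b hb; exact ⟨s', by simp [h], h'⟩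
      · intro b hb
        rcases mem_cons.1 hb with rfl | hb
        · exact ⟨s, by simp, by omega⟩
        · obtain ⟨s', h, h'⟩ := ih _ b hb; exact ⟨s', by simp [h], h'⟩
      · intro b hb
        rcases mem_cons.1 hb with rfl | hb
        · exact ⟨b, by simp, by omega⟩
        · obtain ⟨s', h, h'⟩ := ih _ b hb; exact ⟨s', by simp [h], h'⟩

theorem U_bot_lt {m : ℕ} (hm : 1 ≤ m) (τ σ : List ℕ) (h1 : ∀ t ∈ τ, t ≤ m) (h2 : ∀ s ∈ σ, s ≤ m) :
    ∀ b ∈ (U τ σ).2, b < m := by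
  induction σ generalizing τ with
  | nil => simp [U]
  | cons s σ ih =>
    cases τ with
    | nil => simp [U]
    | cons t τ =>
      have a1 := h1 t (by simp)
      have a2 := h2 s (by simp)
      simp only [mem_cons, forall_eq_or_imp] at h1 h2
      simp only [U]
      split_ifs with h3 h4
      · exact ih _ (by simpa using h1) h2.2
      · intro b hb
        rcases mem_cons.1 hb with rfl | hb
        · omega
        · exact ih _ h1.2 h2.2 b hb
      · intro b hb
        rcases mem_cons.1 hb with rfl | hb
        · omega
        · exact ih _ h1.2 h2.2 b hb

theorem U_bot_dec (τ σ : List ℕ) (hτ : Dec τ) (hσ : Dec σ) (hg : Gd2 τ σ) (hp : ∀ s ∈ σ, 1 ≤ s) : Dec (U τ σ).2 := by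
  induction σ generalizing τ with
  | nil => simp [U]
  | cons s σ ih =>
    cases τ with
    | nil => simp [U]
    | cons t τ =>
      rw [Dec, pairwise_cons] at hτ hσ
      simp only [mem_cons, forall_eq_or_imp] at hp
      simp only [U, Gd2] at hg ⊢
      split_ifs at hg ⊢ with h3 h4
      · exact ih _ (pairwise_cons.2 hτ) hσ.2 hg hp.2
      · subst h4
        refine pairwise_cons.2 ⟨?_, ih _ hτ.2 hσ.2 hg.2 hp.2⟩
        obtain ⟨-, l, rfl⟩ := hg.1 rfl
        refine U_bot_lt (hp.2 _ (by simp)) _ _ (fun x hx => ?_) (fun x hx => ?_)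
        · have := hτ.1 x hx; omega
        · have := hσ.1 x hx; omega
      · refine pairwise_cons.2 ⟨fun b hb => ?_, ih _ hτ.2 hσ.2 hg.2 hp.2⟩
        obtain ⟨s', h, h'⟩ := U_bot_le _ _ b hb
        have := hσ.1 s' h; show b < s; omega

theorem U_len (τ σ : List ℕ) : (U τ σ).1.length + (U τ σ).2.length = τ.length + σ.length := by
  induction σ generalizing τ with
  | nil => simp [U]
  | cons s σ ih =>
    cases τ with
    | nil => simp [U]
    | cons t τ =>
      simp only [U]
      split_ifs <;> simp only [length_cons] <;> (have := ih τ; have := ih (t :: τ); simp only [length_cons] at *; omega)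

theorem U_sub (τ σ : List ℕ) : τ ⊆ (U τ σ).1 := by
  induction σ generalizing τ with
  | nil => simp [U]
  | cons s σ ih =>
    cases τ with
    | nil => simp
    | cons t τ =>
      simp only [U]
      split_ifs
      · exact subset_cons_of_subset _ (ih _)
      all_goals exact cons_subset_cons _ (ih _)

theorem getLastD_mem' (l : List ℕ) (d : ℕ) : l.getLastD d ∈ d :: l := by
  induction l generalizing d with
  | nil => simp
  | cons a l ih => rw [getLastD_cons]; exact mem_cons_of_mem _ (ih a)

theorem ok_nok {τ σ : List ℕ} (h : ¬ OKr τ σ) (d : ℕ) : σ ≠ [] ∧ σ.getLastD d ∈ (U τ σ).1 := by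
  induction σ generalizing τ d with
  | nil => simp [OKr] at h
  | cons s σ ih =>
    refine ⟨by simp, ?_⟩
    cases τ with
    | nil => simp only [U, getLastD_cons]; exact getLastD_mem' σ s
    | cons t τ =>
      simp only [OKr, U, getLastD_cons] at h ⊢
      split_ifs at h ⊢ <;> exact mem_cons_of_mem _ (ih h _).2

theorem ok_top_ge {τ σ : List ℕ} {q : ℕ} (h : OKr τ σ) (hq : ∀ t ∈ τ, q ≤ t) : ∀ e ∈ (U τ σ).1, q ≤ e := by
  induction σ generalizing τ with
  | nil => simpa [U] using hq
  | cons s σ ih =>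
    cases τ with
    | nil => simp [OKr] at h
    | cons t τ =>
      have hq1 := hq t (by simp)
      have hq2 : ∀ x ∈ τ, q ≤ x := fun x hx => hq x (by simp [hx])
      simp only [OKr, U] at h ⊢
      split_ifs at h ⊢
      · intro e he
        rcases mem_cons.1 he with rfl | he
        · omega
        · exact ih h hq e he
      all_goals
        intro e he
        rcases mem_cons.1 he with rfl | he
        · omega
        · exact ih h hq2 e he

theorem ok_len {τ σ : List ℕ} (h : OKr τ σ) : τ.length ≤ (U τ σ).1.length := by
  induction σ generalizing τ with
  | nil => simp [U]
  | cons s σ ih =>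
    cases τ with
    | nil => simp
    | cons t τ =>
      simp only [OKr, U] at h ⊢
      split_ifs at h ⊢ <;> (have := ih h; simp only [length_cons] at *; omega)

theorem ok_eq {τ σ : List ℕ} (h : OKr τ σ) (hg : Gd2 τ σ) (hτ : Dec τ) (hl : (U τ σ).1.length ≤ τ.length) :
    U τ σ = (τ, σ) := by
  induction σ generalizing τ with
  | nil => simp [U]
  | cons s σ ih =>
    cases τ with
    | nil => simp [OKr] at h
    | cons t τ =>
      rw [Dec, pairwise_cons] at hτ
      simp only [OKr, U, Gd2] at h hl hg ⊢
      split_ifs at h hg hl ⊢ with h1 h2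
      · have := ok_len h; simp only [length_cons] at *; omega
      · have e := ih h hg.2 hτ.2 (by simpa using hl)
        obtain ⟨-, l, rfl⟩ := hg.1 h2
        exfalso
        cases τ with
        | nil => simp [OKr] at h
        | cons t' τ =>
          have ht' := hτ.1 t' (by simp)
          have hg2 := hg.2
          simp only [Gd2] at hg2
          simp only [U] at e
          split_ifs at e hg2 with h3 h4
          · simp at e; omega
          · simp at e; have := hg2.1 h4; omega
          · omega
      · rw [ih h hg.2 hτ.2 (by simpa using hl)]

def W (τ σ : List ℕ) : Prop := ∀ a t b, τ = b ++ t :: a → a.length + 1 ≤ σ.countP (fun s => s < t)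

theorem W_len {τ σ : List ℕ} (hτ : Dec τ) (hσ : Dec σ) (h : W τ σ) : (U τ σ).2.length = τ.length := by
  induction σ generalizing τ with
  | nil =>
    cases τ with
    | nil => simp [U]
    | cons t τ => have := h τ t [] rfl; simp at this
  | cons s σ ih =>
    cases τ with
    | nil => simp [U]
    | cons t τ =>
      rw [Dec, pairwise_cons] at hτ hσ
      simp only [U]
      by_cases h1 : t < s
      · rw [if_pos h1]
        refine ih (pairwise_cons.2 hτ) hσ.2 (fun a t' b e => ?_)
        have := h a t' b e
        have ht : t' ≤ t := by
          have : t' ∈ t :: τ := by rw [e]; simp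
          rcases mem_cons.1 this with rfl | h2
          · rfl
          · exact (hτ.1 t' h2).le
        rwa [countP_cons_of_neg (by simp; omega)] at this
      · rw [if_neg h1]
        simp only [length_cons, Nat.add_right_cancel_iff]
        refine ih hτ.2 hσ.2 (fun a t' b e => ?_)
        have h2 := h a t' (t :: b) (by rw [e]; rfl)
        by_cases h3 : s < t'
        · have h4 := (h τ t [] rfl).trans countP_le_length
          have h5 : σ.countP (fun s => decide (s < t')) = σ.length := by
            rw [countP_eq_length]; intro x hx; have := hσ.1 x hx; simp; omega
          rw [h5]
          have := congrArg length e
          simp at this h4; omega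
        · rwa [countP_cons_of_neg (by simpa using h3)] at h2

theorem W_mono {τ σ σ' : List ℕ} (hn : σ.Nodup) (hs : σ ⊆ σ') (h : W τ σ) : W τ σ' := fun a t b e =>
  (h a t b e).trans ((subperm_of_subset hn hs).countP_le _)

theorem dom_W {τ σ : List ℕ} (hτ : Inc τ) (h : Dom σ τ) : W τ.reverse σ.reverse := by
  intro a t b e
  have e : τ = a.reverse ++ t :: b.reverse := by
    have := congrArg reverse e; simpa using this
  rw [(reverse_perm σ).countP_eq, ← length_reverse (as := a)]
  generalize a.reverse = a at *
  generalize b.reverse = b at *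
  clear * - hτ h e
  induction a generalizing σ τ with
  | nil =>
    subst e
    cases σ with
    | nil => simp at h
    | cons s σ => rw [countP_cons_of_pos (by simpa using h.1)]; simp
  | cons x a ih =>
    subst e
    cases σ with
    | nil => simp at h
    | cons s σ =>
      simp only [cons_append, inc_cons, dom_cons] at hτ h
      have := hτ.1 t (by simp)
      rw [countP_cons_of_pos (by simp; omega)]
      have := ih hτ.2 h.2 rfl
      simp only [length_cons]; omega


def dcr (t s : ℕ) : ℕ := if t = s then s - 1 else s
def RR (p q : ℕ × ℕ) : Prop := q.1 = q.2 → p.1 = p.2 ∧ q.2 = p.2 + 1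

theorem dz_ne (p : ℕ × ℕ) (hp : p.1 ≠ p.2) (ts ss : List ℕ) (hl : ts.length = ss.length)
    (h : (p :: ts.zip ss).IsChain RR) : zipWith dcr ts ss = ss := by
  induction ts generalizing p ss with
  | nil => cases ss <;> simp_all
  | cons t ts ih =>
    cases ss with
    | nil => simp at hl
    | cons s ss =>
      simp only [zip_cons_cons, isChain_cons_cons] at h
      have hts : t ≠ s := fun e => hp (h.1 e).1
      simp only [zipWith_cons_cons, dcr, if_neg hts]
      rw [ih (t, s) hts ss (by simpa using hl) h.2]

theorem dz (x i y : ℕ) (hy : y + 1 = x + i) (ts ss : List ℕ) (hl : ts.length = ss.length)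
    (h : ((y, y) :: ts.zip ss).IsChain RR) : decFirst (bCount2 x i ts ss) ss = zipWith dcr ts ss := by
  induction ts generalizing i y ss with
  | nil => cases ss <;> simp_all [bCount2, decFirst]
  | cons t ts ih =>
    cases ss with
    | nil => simp at hl
    | cons s ss =>
      simp only [zip_cons_cons, isChain_cons_cons] at h
      by_cases hts : t = s
      · subst hts
        have := (h.1 rfl).2
        simp only at this
        rw [bCount2, if_pos (by omega), decFirst, ih (i+1) t (by omega) ss (by simpa using hl) h.2]
        simp [dcr]
      · rw [bCount2, if_neg (by omega), decFirst, zipWith_cons_cons, dz_ne (t, s) hts ts ss (by simpa using hl) h.2]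
        simp [dcr, hts]

theorem lfi_cons (t s : ℕ) (τ σ : List ℕ) : liftFailIdx (t :: τ) (s :: σ) =
    if t < s then some 0 else (liftFailIdx τ σ).map (· + 1) := by
  simp only [liftFailIdx, zip_cons_cons, findIdx?_cons]
  by_cases h : t < s <;> simp [h]

theorem lfi_some {τ σ : List ℕ} {j : ℕ} (h : liftFailIdx τ σ = some j) :
    j < σ.length ∧ j < τ.length ∧ U τ σ = (τ.take j ++ σ.getD j 0 :: (U (τ.drop j) (σ.drop (j+1))).1,
      zipWith dcr (τ.take j) (σ.take j) ++ (U (τ.drop j) (σ.drop (j+1))).2) ∧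
    (OKr τ σ ↔ OKr (τ.drop j) (σ.drop (j+1))) ∧
    (Gd2 τ σ → Dec τ → Gd2 (τ.drop j) (σ.drop (j+1)) ∧
      ((τ.take j).zip (σ.take j) ++ [(σ.getD j 0, σ.getD j 0)]).IsChain (fun p q => RR q p)) := by
  induction σ generalizing τ j with
  | nil => simp [liftFailIdx] at h
  | cons s σ ih =>
    cases τ with
    | nil => simp [liftFailIdx] at h
    | cons t τ =>
      rw [lfi_cons] at h
      by_cases h1 : t < s
      · simp only [if_pos h1, Option.some.injEq] at h
        subst h
        simp [U, OKr, Gd2, h1]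
        exact fun a _ _ => a
      · simp only [if_neg h1, Option.map_eq_some_iff] at h
        obtain ⟨j, h, rfl⟩ := h
        obtain ⟨l1, l2, h2, h3, h4⟩ := ih h
        refine ⟨by simpa using l1, by simpa using l2, ?_, ?_, ?_⟩
        · simp only [U, if_neg h1, h2]
          simp [dcr]
        · simp only [OKr, if_neg h1]; simpa using h3
        · intro hg hd
          simp only [Gd2, if_neg h1] at hg
          rw [Dec, pairwise_cons] at hd
          obtain ⟨h5, h6⟩ := h4 hg.2 hd.2
          refine ⟨by simpa using h5, ?_⟩
          simp only [take_succ_cons, zip_cons_cons, cons_append, getD_cons_succ]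
          rw [isChain_cons]
          refine ⟨?_, h6⟩
          intro q hq he
          obtain ⟨hs1, l, rfl⟩ := hg.1 he
          simp only at he
          cases j with
          | zero => simp at hq; subst hq; simp; omega
          | succ j =>
            cases τ with
            | nil => simp at l2
            | cons t' τ =>
              simp at hq; subst hq
              have := hd.1 t' (by simp)
              rw [lfi_cons] at h
              by_cases h7 : t' < s - 1
              · simp [h7] at h
              · simp only; omega

theorem lfi_none {τ σ : List ℕ} (h : liftFailIdx τ σ = none) :
    (OKr τ σ ↔ σ.length ≤ τ.length) ∧ (σ.length ≤ τ.length → (U τ σ).1.length ≤ τ.length) := by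
  induction σ generalizing τ with
  | nil => simp [OKr, U]
  | cons s σ ih =>
    cases τ with
    | nil => simp [OKr]
    | cons t τ =>
      rw [lfi_cons] at h
      by_cases h1 : t < s
      · simp [h1] at h
      · simp only [if_neg h1, Option.map_eq_none_iff] at h
        simpa [OKr, U, h1] using ih h

theorem okaux {f : ℕ} {τ σ : List ℕ} (hf : σ.length < f) : liftOkAux f τ σ = true ↔ OKr τ σ := by
  induction f generalizing τ σ with
  | zero => omega
  | succ f ih =>
    simp only [liftOkAux]
    cases h : liftFailIdx τ σ with
    | none => simpa using (lfi_none h).1.symm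
    | some j =>
      obtain ⟨h1, -, -, h2, -⟩ := lfi_some h
      rw [h2]; exact ih (by simp; omega)

theorem liftaux {f : ℕ} {τ σ : List ℕ} (hf : σ.length < f) (ho : OKr τ σ) (hg : Gd2 τ σ) (hd : Dec τ) :
    liftPairAuxR f τ σ = U τ σ := by
  induction f generalizing τ σ with
  | zero => omega
  | succ f ih =>
    simp only [liftPairAuxR]
    cases h : liftFailIdx τ σ with
    | none =>
      have := lfi_none h
      simp only
      rw [ok_eq ho hg hd (this.2 (this.1.1 ho))]
    | some j =>
      obtain ⟨h1, h1', h2, h3, h4⟩ := lfi_some h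
      obtain ⟨h5, h6⟩ := h4 hg hd
      simp only
      rw [ih (by simp; omega) (h3.1 ho) h5 (hd.sublist (drop_sublist _ _)), h2]
      congr 2
      have hlen : (τ.take j).length = (σ.take j).length := by simp; omega
      rw [← isChain_reverse] at h6
      simp only [reverse_append, reverse_cons, reverse_nil, nil_append, cons_append] at h6
      have hz : ((τ.take j).zip (σ.take j)).reverse = (τ.take j).reverse.zip (σ.take j).reverse := by
        rw [zip, reverse_zipWith hlen]
      rw [hz] at h6
      have := dz (σ.getD j 0) 1 (σ.getD j 0) rfl _ _ (by simpa using hlen) h6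
      have hb : (if (σ.take j).reverse.headD 0 = σ.getD j 0 + 1 then bCount2 (σ.getD j 0) 1 (τ.take j).reverse (σ.take j).reverse else 0)
          = bCount2 (σ.getD j 0) 1 (τ.take j).reverse (σ.take j).reverse := by
        split_ifs with hc
        · rfl
        · cases e1 : (τ.take j).reverse <;> cases e2 : (σ.take j).reverse <;> simp only [bCount2]
          rw [e2] at hc
          rw [if_neg]
          simp only [headD_cons] at hc; omega
      rw [hb, this, ← reverse_zipWith hlen, reverse_reverse]

/-- U on unreversed rows -/
def UU (τ σ : List ℕ) : List ℕ × List ℕ := ((U τ.reverse σ.reverse).1.reverse, (U τ.reverse σ.reverse).2.reverse)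
def OK (τ σ : List ℕ) : Prop := OKr τ.reverse σ.reverse

theorem inc_rev {l : List ℕ} (h : Inc l) : Dec l.reverse := by rw [Dec, pairwise_reverse]; exact h

theorem UU_ck {τ σ : List ℕ} (h1 : Inc τ) (h2 : Inc σ) (hr : Red (τ ++ σ)) :
    CK (τ ++ σ) ((UU τ σ).1 ++ (UU τ σ).2) ∧ Inc (UU τ σ).1 ∧ Inc (UU τ σ).2 ∧ Gd2 τ.reverse σ.reverse := by
  obtain ⟨a, b, c⟩ := U_ck τ.reverse σ.reverse [] (by simpa using inc_rev h2) (inc_rev h1) (by simp) (by simpa using hr)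
  refine ⟨by simpa [UU] using a, dec_rev (by simpa using b), dec_rev (U_bot_dec _ _ (inc_rev h1) (inc_rev h2) c ?_), c⟩
  intro s hs; exact hr.1 s (by simp at hs; simp [hs])

theorem lift_nok {τ σ : List ℕ} (h : ¬ OK τ σ) : liftPair τ σ = (τ, σ) := by
  rw [liftPair, if_neg]
  rw [okaux (by simp)]; exact h

theorem lift_ok {τ σ : List ℕ} (h1 : Inc τ) (h2 : Inc σ) (hr : Red (τ ++ σ)) (h : OK τ σ) : liftPair τ σ = UU τ σ := by
  have hg := (UU_ck h1 h2 hr).2.2.2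
  rw [liftPair, if_pos]
  · simp only; rw [liftaux (by simp) h hg (inc_rev h1)]; rfl
  · rw [okaux (by simp)]; exact h

theorem lift_ck {τ σ : List ℕ} (h1 : Inc τ) (h2 : Inc σ) (hr : Red (τ ++ σ)) :
    CK (τ ++ σ) ((liftPair τ σ).1 ++ (liftPair τ σ).2) ∧ Inc (liftPair τ σ).1 ∧ Inc (liftPair τ σ).2 := by
  by_cases h : OK τ σ
  · rw [lift_ok h1 h2 hr h]
    have := UU_ck h1 h2 hr
    exact ⟨this.1, this.2.1, this.2.2.1⟩
  · rw [lift_nok h]; exact ⟨CK.refl _, h1, h2⟩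

/-- if the lift changes the pair, then the top is longer, and bounded below -/
theorem lift_ch {τ σ : List ℕ} {q : ℕ} (h1 : Inc τ) (h2 : Inc σ) (hr : Red (τ ++ σ)) (hc : liftPair τ σ ≠ (τ, σ))
    (hq : ∀ t ∈ τ, q ≤ t) : τ.length < (liftPair τ σ).1.length ∧ ∀ e ∈ (liftPair τ σ).1, q ≤ e := by
  by_cases h : OK τ σ
  · have hg := (UU_ck h1 h2 hr).2.2.2
    rw [lift_ok h1 h2 hr h] at hc ⊢
    constructor
    · by_contra hl
      have := ok_eq h hg (inc_rev h1) (by simpa [UU] using hl)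
      exact hc (by simp [UU, this])
    · intro e he
      exact ok_top_ge h (q := q) (by simpa using hq) e (by simpa [UU] using he)
  · exact absurd (lift_nok h) hc

def WW (τ σ : List ℕ) : Prop := W τ.reverse σ.reverse

theorem UU_len {τ σ : List ℕ} (h1 : Inc τ) (h2 : Inc σ) (hw : WW τ σ) :
    (UU τ σ).2.length = τ.length ∧ (UU τ σ).1.length = σ.length := by
  have a := W_len (inc_rev h1) (inc_rev h2) hw
  have b := U_len τ.reverse σ.reverse
  simp [UU] at *; omega

theorem UU_WW {τ σ ρ : List ℕ} (h1 : Inc τ) (hw : WW ρ τ) : WW ρ (UU τ σ).1 := by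
  refine W_mono ?_ ?_ hw
  · exact (inc_rev h1).imp (fun h => (ne_of_gt h))
  · have := U_sub τ.reverse σ.reverse
    simpa [UU] using this

theorem UU_nok {τ σ : List ℕ} (h : ¬ OK τ σ) : ∃ a l, σ = a :: l ∧ a ∈ (UU τ σ).1 := by
  cases σ with
  | nil => exact absurd (by simp [OK, OKr]) h
  | cons a l =>
    refine ⟨a, l, rfl, ?_⟩
    have := (ok_nok h 0).2
    simpa [UU] using this


def EGT (P : List (List ℕ)) : Prop := Tab P ∧ NE P ∧ Red (wordOf P)

theorem EGT.pt {P : List (List ℕ)} (h : EGT P) : PT (wordOf P).reverse = P := tab_PT_word rfl h.1 h.2.1 h.2.2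

theorem egt_PT {u : List ℕ} (h : Red u.reverse) : EGT (PT u) := ⟨PT_tab u, PT_ne u, (PT_ck h).red h⟩

theorem sorted_split {l : List ℕ} (h : l.Pairwise (· ≤ ·)) (m : ℕ) :
    l = l.filter (fun r => !decide (m ≤ r)) ++ l.filter (fun r => decide (m ≤ r)) := by
  induction l with
  | nil => rfl
  | cons a l ih =>
    rw [pairwise_cons] at h
    by_cases ha : m ≤ a
    · have h1 : l.filter (fun r => decide (m ≤ r)) = l := by
        rw [filter_eq_self]; intro x hx; have := h.1 x hx; simp; omega
      have h2 : l.filter (fun r => !decide (m ≤ r)) = [] := by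
        rw [filter_eq_nil_iff]; intro x hx; have := h.1 x hx; simp; omega
      simp [ha, h1, h2]
    · rw [filter_cons_of_pos (by simpa using ha), filter_cons_of_neg (by simpa using ha), cons_append, ← ih h.2]

theorem ss_word {P : List (List ℕ)} (h : EGT P) : ∃ u, Red u.reverse ∧ PT u = P ∧ (gr u).Pairwise (· ≤ ·) := by
  have hw : Red ((wordOf P).reverse).reverse := by simpa using h.2.2
  have hs := pairwise_insertionSort (· ≤ ·) (gr (wordOf P).reverse)
  obtain ⟨u, h1, h2, h3⟩ := gr_surj (adm_sorted hs) h.1 h.2.1 h.2.2 (fun r => by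
    rw [(perm_insertionSort _ _).count_eq, gr_count hw, h.pt])
  exact ⟨u, h1, h2, by rw [h3]; exact hs⟩

theorem red_app {v u : List ℕ} (h : Red (v ++ u).reverse) : Red v.reverse ∧ Red u.reverse := by
  rw [reverse_append] at h; exact ⟨h.right, h.left⟩

theorem ss_suffix {u : List ℕ} (hr : Red u.reverse) (hs : (gr u).Pairwise (· ≤ ·)) (m : ℕ) :
    ∃ v u', u = v ++ u' ∧ (∀ e ∈ u', m ≤ e) ∧ gr u' = (gr u).filter (fun r => decide (m ≤ r)) := by
  have e := sorted_split hs m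
  set k := ((gr u).filter (fun r => !decide (m ≤ r))).length with hk
  have hkl : k ≤ u.length := by rw [← gr_length]; exact length_filter_le _ _
  obtain ⟨g, h1, h2⟩ := gr_app (u.drop k) (u.take k)
  rw [take_append_drop] at h1
  have h3 := append_inj (h1.symm.trans e) (by rw [h2, ← hk]; simp [hkl])
  refine ⟨u.take k, u.drop k, (take_append_drop _ _).symm, ?_, h3.2⟩
  rw [gr_bd (red_app (v := u.take k) (by rw [take_append_drop]; exact hr)).2]
  rw [h3.2]; simp

noncomputable def NN (P : List (List ℕ)) (m : ℕ) : ℕ := (gr (wordOf P).reverse).countP (fun r => decide (m ≤ r))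

theorem nn_eq {u : List ℕ} (h : Red u.reverse) (m : ℕ) : (gr u).countP (fun r => decide (m ≤ r)) = NN (PT u) m := by
  have h2 := egt_PT h
  refine (gr_perm h (by simpa using h2.2.2) h2.pt.symm).countP_eq _

theorem nn_le {v u : List ℕ} {m : ℕ} (h : Red (v ++ u).reverse) (hm : ∀ e ∈ u, m ≤ e) : u.length ≤ NN (PT (v ++ u)) m := by
  rw [← nn_eq h]; exact pre_le h h rfl hm

theorem nn_step {P : List (List ℕ)} (h : EGT P) (m : ℕ) : NN P m = aP P m + NN P (m + 1) := by
  have h1 := gr_count (u := (wordOf P).reverse) (by simpa using h.2.2) m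
  rw [h.pt] at h1
  rw [← h1, NN, NN]
  generalize gr (wordOf P).reverse = l
  induction l with
  | nil => rfl
  | cons a l ih =>
    simp only [countP_cons, count_cons, beq_iff_eq, decide_eq_true_eq, ih]
    split_ifs <;> omega

theorem nn_zero {P : List (List ℕ)} (h : EGT P) {m : ℕ} (hm : ∀ r ∈ col P 0, r < m) : NN P m = 0 := by
  rw [NN, countP_eq_zero]
  intro r hr
  have := (gr_mem (by simpa using h.2.2)).1 hr
  rw [h.pt] at this
  have := hm r this; simp; omega

theorem ck_app {A u v : List ℕ} (h : CK u v) : CK (A ++ u) (A ++ v) := h.left A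

theorem PT_congr {u v : List ℕ} (h : Red u.reverse) (hc : CK u.reverse v.reverse) : PT u = PT v := by
  have := PT_inv hc h; simpa using this

theorem PT_pre {v v' u : List ℕ} (h : Red (v ++ u).reverse) (h' : Red v'.reverse) (hP : PT v = PT v') :
    Red (v' ++ u).reverse ∧ PT (v' ++ u) = PT (v ++ u) := by
  have hv := (red_app h).1
  have c1 := PT_ck hv
  have c2 := PT_ck h'
  rw [hP] at c1
  have c : CK (v ++ u).reverse (v' ++ u).reverse := by
    rw [reverse_append, reverse_append]; exact (c1.trans c2.symm).left _
  exact ⟨c.red h, (PT_congr h c).symm⟩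

theorem gr_rep_dec {u : List ℕ} {p : ℕ} (h : Red u.reverse) (hg : ∀ r ∈ gr u, r = p) : Dec u := by
  rw [Dec, ← isChain_iff_pairwise]
  induction u with
  | nil => simp
  | cons x u ih =>
    obtain ⟨g, h1, h2⟩ := gr_app u [x]
    rw [singleton_append] at h1
    have := ih (red_tail h) (fun r hr => hg r (by rw [h1]; simp [hr]))
    cases u with
    | nil => simp
    | cons y u =>
      rw [isChain_cons_cons]
      refine ⟨?_, this⟩
      by_contra hxy
      have h3 := pieri_ge (P := PT u) (x1 := y) (x2 := x) (PT_tab u) (by omega)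
      obtain ⟨r1, e1, -⟩ := gr_step h
      obtain ⟨r2, e2, -⟩ := gr_step (red_tail h)
      have g1 := gr_gc h e1
      have g2 := gr_gc (red_tail h) e2
      have a1 := hg r1 (by rw [e1]; simp)
      have a2 := hg r2 (by rw [e1, e2]; simp)
      subst a1 a2
      rw [e2, count_cons_self] at g1
      rw [PT_cons] at g1; omega

theorem shape_perm {l l' : List ℕ} (h0 : 0 ∉ l) (h0' : 0 ∉ l')
    (h : ∀ j, l.countP (fun c => decide (j < c)) = l'.countP (fun c => decide (j < c))) : l ~ l' := by
  have key : ∀ (l : List ℕ) j, l.countP (fun c => decide (j < c)) = l.count (j+1) + l.countP (fun c => decide (j + 1 < c)) := by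
    intro l j
    induction l with
    | nil => rfl
    | cons a l ih =>
      simp only [countP_cons, count_cons, beq_iff_eq, decide_eq_true_eq, ih]
      split_ifs <;> omega
  rw [perm_iff_count]
  intro c
  cases c with
  | zero => rw [count_eq_zero.2 h0, count_eq_zero.2 h0']
  | succ j => have := key l j; have := key l' j; have := h j; have := h (j+1); omega

theorem mem_col0 {P : List (List ℕ)} (h : NE P) {e : ℕ} : e ∈ col P 0 ↔ e ∈ P.map (fun r => r.headD 0) := by
  induction P with
  | nil => simp [col]
  | cons r R ih =>
    have := ih (fun x hx => h x (by simp [hx]))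
    have hr := h r (by simp)
    cases r with
    | nil => simp at hr
    | cons a r => simp [col, this]

theorem heads_inc {P : List (List ℕ)} (hT : Tab P) (h : NE P) : Inc (P.map (fun r => r.headD 0)) := by
  rw [Inc, ← isChain_iff_pairwise]
  induction P with
  | nil => simp
  | cons r R ih =>
    have := ih hT.2.2 (fun x hx => h x (by simp [hx]))
    cases R with
    | nil => simp
    | cons r' R =>
      simp only [map_cons, isChain_cons_cons] at this ⊢
      refine ⟨?_, this⟩
      have hd := hT.2.1
      have h1 := h r (by simp)
      have h2 := h r' (by simp)
      cases r with
      | nil => simp at h1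
      | cons a r =>
        cases r' with
        | nil => simp at h2
        | cons b r' => exact hd.1

theorem wordOf_snoc (B : List (List ℕ)) (t : List ℕ) : wordOf (B ++ [t]) = t ++ wordOf B := by simp [wordOf]
theorem ub_snoc (B : List (List ℕ)) (t : List ℕ) : ub (B ++ [t]) = ub B ++ t.reverse := by simp [ub]

theorem ub_red {B : List (List ℕ)} (h : Red (wordOf B)) : Red (ub B).reverse := by rw [ub_rev]; exact h

theorem top_bd {B : List (List ℕ)} {t : List ℕ} {P : List (List ℕ)} {p : ℕ} (hr : Red (wordOf (B ++ [t])))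
    (hP : PT (ub (B ++ [t])) = P) (hp : ∀ r ∈ col P 0, r ≤ p) (ht : ∀ e ∈ t, p ≤ e) : t.length ≤ aP P p := by
  have h1 := ub_red hr
  have hE := egt_PT h1
  rw [ub_snoc] at h1 hP hE
  have := nn_le h1 (m := p) (by simpa using ht)
  rw [hP] at this hE
  rw [nn_step hE, nn_zero hE (m := p + 1) (fun r hr => by have := hp r hr; omega)] at this
  simpa using this

theorem superstd {P : List (List ℕ)} {p : ℕ} (h : EGT P) (hp1 : p ∈ col P 0) (hp2 : ∀ r ∈ col P 0, r ≤ p) :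
    ∃ P2 t, EGT P2 ∧ Inc t ∧ Red (wordOf (P2 ++ [t])) ∧ PT (ub (P2 ++ [t])) = P ∧ t.headD 0 = p ∧ t ≠ [] ∧
      t.length = aP P p ∧ (∀ r, aP P2 r = if r = p then 0 else aP P r) ∧
      (P2 ++ [t]).map length ~ P.map length ∧
      (P2 ++ [t]).map (fun r => r.headD 0) = P.map (fun r => r.headD 0) := by
  obtain ⟨u, hu, hP, hs⟩ := ss_word h
  have hgm : ∀ r ∈ gr u, r ≤ p := fun r hr => hp2 r (by rw [gr_mem hu, hP] at hr; exact hr)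
  have hNp : NN P p = aP P p := by
    rw [nn_step h, nn_zero h (m := p + 1) (fun r hr => by have := hp2 r hr; omega)]; omega
  obtain ⟨u1, u2, rfl, hu2, hg2⟩ := ss_suffix hu hs p
  have hg2' : ∀ r ∈ gr u2, r = p := by
    intro r hr
    rw [hg2, mem_filter] at hr
    have := hgm r hr.1
    have := hr.2
    simp at this; omega
  have hr1 := (red_app hu).1
  have hr2 := (red_app hu).2
  have hl2 : u2.length = aP P p := by
    rw [← hNp, ← gr_length, hg2, ← countP_eq_length_filter, nn_eq hu, hP]
  have hd2 := gr_rep_dec hr2 hg2'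
  have hap : 0 < aP P p := (aP_pos h.1).2 hp1
  have hne : u2 ≠ [] := by rintro rfl; simp at hl2; omega
  have hpm : p ∈ u2 := by
    have : p ∈ gr u2 := by
      have hx : gr u2 ≠ [] := by rw [← length_pos_iff, gr_length, length_pos_iff]; exact hne
      obtain ⟨r, hr⟩ := exists_mem_of_ne_nil _ hx
      have := hg2' r hr; subst this; exact hr
    rw [gr_mem hr2] at this
    exact (pt_mem hr2).2 (col0_mem this)
  have hE2 := egt_PT hr1
  obtain ⟨hr3, hP3⟩ := PT_pre hu (v' := ub (PT u1)) (ub_red hE2.2.2) (by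
    rw [← reverse_reverse (ub (PT u1)), ub_rev, hE2.pt])
  have hub : ub (PT u1 ++ [u2.reverse]) = ub (PT u1) ++ u2 := by simp [ub]
  have hR : Red (wordOf (PT u1 ++ [u2.reverse])) := by rw [← ub_rev, hub]; exact hr3
  -- the key vector of P2
  have key : ∀ m ≤ p, NN (PT u1) m + aP P p = NN P m := by
    intro m hm
    apply le_antisymm
    · obtain ⟨w, hw, hPw, hsw⟩ := ss_word hE2
      obtain ⟨w1, w2, rfl, hw2, hgw⟩ := ss_suffix hw hsw m
      obtain ⟨h4, h5⟩ := PT_pre hu (v' := w1 ++ w2) hw hPw.symm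
      rw [append_assoc] at h4 h5
      have := nn_le h4 (m := m) (by
        intro e he
        rcases mem_append.1 he with he | he
        · exact hw2 e he
        · have := hu2 e he; omega)
      rw [h5, hP, length_append, hl2, ← gr_length, hgw, ← countP_eq_length_filter, nn_eq hw, hPw] at this
      exact this
    · obtain ⟨v1, v2, e, hv2, hgv⟩ := ss_suffix hu hs m
      have hlv : v2.length = NN P m := by
        rw [← gr_length, hgv, ← countP_eq_length_filter, nn_eq hu, hP]
      have hmono : aP P p ≤ NN P m := by
        rw [← hNp, NN, NN]
        exact countP_mono_left (fun r _ => by simp; omega)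
      have hlen := congrArg length e
      simp only [length_append] at hlen
      -- v2 = x ++ u2
      obtain ⟨x, rfl⟩ : ∃ x, v2 = x ++ u2 := by
        have hsuf : u2 <:+ v1 ++ v2 := ⟨u1, e⟩
        obtain ⟨x, hx⟩ := suffix_of_suffix_length_le hsuf (suffix_append v1 v2) (by omega)
        exact ⟨x, hx.symm⟩
      have e' : u1 = v1 ++ x := by
        rw [← append_assoc] at e; exact append_cancel_right e
      subst e'
      have := nn_le hr1 (m := m) (fun y hy => hv2 y (by simp [hy]))
      simp only [length_append] at hlv
      omega
  have hN0 : ∀ m, p ≤ m → NN (PT u1) m = 0 := by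
    intro m hm
    have h1 := key p le_rfl
    have h2 : NN (PT u1) m ≤ NN (PT u1) p := countP_mono_left (fun r _ => by simp; omega)
    omega
  have haP : ∀ r, aP (PT u1) r = if r = p then 0 else aP P r := by
    intro r
    have h1 := nn_step hE2 r
    have h2 := nn_step h r
    rcases lt_trichotomy r p with hr | rfl | hr
    · rw [if_neg (by omega)]
      have := key r hr.le; have := key (r+1) hr; omega
    · rw [if_pos rfl]
      have := hN0 r le_rfl; omega
    · rw [if_neg (by omega)]
      have := hN0 r hr.le
      have : ¬ 0 < aP P r := fun h3 => by
        have := hp2 r ((aP_pos h.1).1 h3); omega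
      omega
  have hcol : ∀ j, (col P j).card = (col (PT u1) j).card + if j < aP P p then 1 else 0 := by
    intro j
    rw [← kc_card h.1, ← kc_card hE2.1]
    split_ifs with hj
    · rw [← Finset.card_insert_of_notMem (a := p)]
      · congr 1
        ext r
        rw [Finset.mem_insert, mem_Kc_iff h.1, mem_Kc_iff hE2.1, haP]
        split_ifs with hrp
        · subst hrp; simp [hj]
        · simp [hrp]
      · rw [mem_Kc_iff hE2.1, haP]; simp
    · rw [add_zero]; congr 1
      ext r
      rw [mem_Kc_iff h.1, mem_Kc_iff hE2.1, haP]
      split_ifs with hrp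
      · subst hrp; simp; omega
      · rfl
  have hhead : u2.reverse.headD 0 = p := by
    have hi := dec_rev hd2
    cases hc : u2.reverse with
    | nil => simp at hc; exact absurd hc hne
    | cons a l =>
      rw [hc] at hi
      have h1 : p ∈ a :: l := by rw [← hc]; simpa using hpm
      have h2 := hu2 a (by rw [← mem_reverse, hc]; simp)
      rcases mem_cons.1 h1 with rfl | h1
      · rfl
      · have := (inc_cons.1 hi).1 p h1; omega
  refine ⟨PT u1, u2.reverse, hE2, dec_rev hd2, hR, by rw [hub, hP3, hP], hhead, by simpa using hne, by simpa using hl2,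
    haP, ?_, ?_⟩
  · apply shape_perm
    · intro h0
      simp only [map_append, map_cons, map_nil, mem_append, mem_map, mem_singleton] at h0
      rcases h0 with ⟨r, hr, h0⟩ | h0
      · exact hE2.2.1 r hr (length_eq_zero_iff.1 h0)
      · rw [length_reverse] at h0; omega
    · intro h0
      obtain ⟨r, hr, h0⟩ := mem_map.1 h0
      exact h.2.1 r hr (length_eq_zero_iff.1 h0)
    · intro j
      have := hcol j
      rw [col_card h.1, col_card hE2.1] at this
      rw [countP_map, countP_map, countP_append]
      simp only [Function.comp_def]
      rw [this, ← hl2]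
      simp [countP_cons]
  · refine Pairwise.eq_of_mem_iff (r := (· < ·)) ?_ (heads_inc h.1 h.2.1) ?_
    · rw [map_append, pairwise_append]
      refine ⟨heads_inc hE2.1 hE2.2.1, by simp, fun a ha b hb => ?_⟩
      simp only [map_cons, map_nil, mem_singleton] at hb
      rw [hb, hhead]
      rw [← mem_col0 hE2.2.1, ← aP_pos hE2.1, haP] at ha
      split_ifs at ha with hap
      · omega
      · have := hp2 a ((aP_pos h.1).1 ha); omega
    · intro a
      rw [← mem_col0 h.2.1, map_append, mem_append, ← mem_col0 hE2.2.1, ← aP_pos h.1, ← aP_pos hE2.1, haP]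
      simp only [map_cons, map_nil, mem_singleton, hhead]
      split_ifs with hap
      · subst hap; simp; omega
      · simp [hap]


abbrev RI (B : List (List ℕ)) : Prop := ∀ r ∈ B, Inc r

theorem liftAt_app (A R : List (List ℕ)) (n : ℕ) : liftAt (A.length + n + 1) (A ++ R) = A ++ liftAt (n + 1) R := by
  induction A with
  | nil => simp
  | cons a A ih =>
    rw [show (a :: A).length + n + 1 = (A.length + n) + 2 by simp; omega]
    simp only [cons_append, liftAt]
    rw [ih]

theorem liftAt_app1 (A D : List (List ℕ)) (c d : List ℕ) : liftAt (A.length + 1) (A ++ c :: d :: D) =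
    A ++ (liftPair d c).2 :: (liftPair d c).1 :: D := by
  have := liftAt_app A (c :: d :: D) 0
  simpa [liftAt] using this

theorem liftAt_ge (B : List (List ℕ)) (i : ℕ) (h : B.length ≤ i) : liftAt i B = B := by
  induction B generalizing i with
  | nil => rcases i with _ | _ | i <;> simp [liftAt]
  | cons r B ih =>
    rcases i with _ | _ | i
    · simp [liftAt]
    · simp at h; subst h; simp [liftAt]
    · simp only [liftAt]; rw [ih]; simpa using h

theorem liftAt_zero (B : List (List ℕ)) : liftAt 0 B = B := by simp [liftAt]

theorem liftAt_snoc (B : List (List ℕ)) (t : List ℕ) (i : ℕ) (h : i + 1 ≤ B.length) :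
    liftAt i (B ++ [t]) = liftAt i B ++ [t] := by
  induction B generalizing i with
  | nil => simp at h
  | cons r B ih =>
    rcases i with _ | _ | i
    · simp [liftAt]
    · cases B with
      | nil => simp at h
      | cons r' B => simp [liftAt]
    · simp only [liftAt, cons_append]; rw [ih]; simpa using h

theorem liftAt_ck (B : List (List ℕ)) (i : ℕ) (hI : RI B) (hr : Red (wordOf B)) :
    CK (wordOf B) (wordOf (liftAt i B)) ∧ RI (liftAt i B) ∧ (liftAt i B).length = B.length := by
  induction B generalizing i with
  | nil => rw [liftAt_ge _ _ (by simp)]; exact ⟨CK.refl _, hI, rfl⟩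
  | cons r B ih =>
    rcases i with _ | _ | i
    · rw [liftAt_zero]; exact ⟨CK.refl _, hI, rfl⟩
    · cases B with
      | nil => rw [liftAt_ge _ _ (by simp)]; exact ⟨CK.refl _, hI, rfl⟩
      | cons r' B =>
        simp only [liftAt, wordOf_cons, append_assoc] at hr ⊢
        obtain ⟨h1, h2, h3⟩ := lift_ck (hI r' (by simp)) (hI r (by simp)) hr.right
        refine ⟨h1.left _, ?_, by simp⟩
        intro x hx
        simp only [mem_cons] at hx
        rcases hx with rfl | rfl | hx
        · exact h3
        · exact h2
        · exact hI x (by simp [hx])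
    · simp only [liftAt, wordOf_cons] at hr ⊢
      obtain ⟨h1, h2, h3⟩ := ih (i + 1) (fun x hx => hI x (by simp [hx])) hr.left
      refine ⟨h1.right _, ?_, by simp [h3]⟩
      intro x hx
      rcases mem_cons.1 hx with rfl | hx
      · exact hI _ (by simp)
      · exact h2 x hx

def fl (i n : ℕ) (T : List (List ℕ)) : List (List ℕ) := (List.range' i n).foldl (fun t k => liftAt k t) T
theorem fl_zero (i : ℕ) (T) : fl i 0 T = T := rfl
theorem fl_succ (i n : ℕ) (T) : fl i (n + 1) T = fl (i + 1) n (liftAt i T) := by simp [fl, range'_succ]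

theorem fl_ck (i n : ℕ) (B : List (List ℕ)) (hI : RI B) (hr : Red (wordOf B)) :
    CK (wordOf B) (wordOf (fl i n B)) ∧ RI (fl i n B) ∧ (fl i n B).length = B.length := by
  induction n generalizing i B with
  | zero => exact ⟨CK.refl _, hI, rfl⟩
  | succ n ih =>
    obtain ⟨h1, h2, h3⟩ := liftAt_ck B i hI hr
    obtain ⟨h4, h5, h6⟩ := ih (i+1) _ h2 (h1.red hr)
    rw [fl_succ]
    exact ⟨h1.trans h4, h5, h6.trans h3⟩

theorem liftAt_len (B : List (List ℕ)) (i : ℕ) : (liftAt i B).length = B.length := by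
  induction B generalizing i with
  | nil => rw [liftAt_ge _ _ (by simp)]
  | cons r B ih =>
    rcases i with _ | _ | i
    · simp [liftAt]
    · cases B <;> simp [liftAt]
    · simp [liftAt, ih]

theorem fl_len (i n : ℕ) (B : List (List ℕ)) : (fl i n B).length = B.length := by
  induction n generalizing i B with
  | zero => rfl
  | succ n ih => rw [fl_succ, ih, liftAt_len]

theorem fl_snoc (i n : ℕ) (B : List (List ℕ)) (t : List ℕ) (h : i + n ≤ B.length) :
    fl i n (B ++ [t]) = fl i n B ++ [t] := by
  induction n generalizing i B with
  | zero => rfl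
  | succ n ih => rw [fl_succ, fl_succ, liftAt_snoc _ _ _ (by omega), ih _ _ (by rw [liftAt_len]; omega)]

theorem faith_snoc (i n : ℕ) (B : List (List ℕ)) (t : List ℕ) (h : i + n ≤ B.length) :
    faithfulAux n i (B ++ [t]) = faithfulAux n i B := by
  induction n generalizing i B with
  | zero => rfl
  | succ n ih =>
    simp only [faithfulAux]
    rw [liftAt_snoc _ _ _ (by omega), ih _ _ (by rw [liftAt_len]; omega)]
    simp only [append_cancel_right_eq]

theorem faith_ind (i n : ℕ) (T : List (List ℕ)) (h : faithfulAux (n + 1) i T = true) :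
    liftAt (i + n) (fl i n T) ≠ fl i n T := by
  induction n generalizing i T with
  | zero =>
    simp only [faithfulAux] at h
    split_ifs at h with h1
    exact h1
  | succ n ih =>
    rw [faithfulAux] at h
    split_ifs at h with h1 h2
    · simp at *
    · rw [fl_succ, show i + (n + 1) = i + 1 + n by omega]
      exact ih _ _ h

theorem faith_top (i j : ℕ) (T : List (List ℕ)) (hj : T.length ≤ j) : faithfulSeq i j T = false := by
  by_contra h
  rw [Bool.not_eq_false, faithfulSeq] at h
  split_ifs at h with h1
  have := faith_ind i (j - i) T (by rw [show j - i + 1 = j + 1 - i by omega]; exact h)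
  apply this
  apply liftAt_ge
  rw [fl_len]; omega

def FM (T : List (List ℕ)) (j : ℕ) : Option (ℕ × ℕ) :=
  ((List.range' 1 j).find? (fun i => faithfulSeq i j T)).map (fun i => (i, j))

theorem fm_none {T : List (List ℕ)} {j : ℕ} (h : ∀ i, faithfulSeq i j T = false) : FM T j = none := by
  simp [FM, h]

theorem findMove_eq (T : List (List ℕ)) : findMove T = (List.range (T.length + 1)).reverse.findSome? (FM T) := rfl

theorem find_snoc {B : List (List ℕ)} {t : List ℕ} (h : ∀ i, faithfulSeq i B.length (B ++ [t]) = false) :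
    findMove (B ++ [t]) = findMove B := by
  rw [findMove_eq, findMove_eq, length_append, length_singleton, range_succ, range_succ, reverse_append, reverse_append]
  simp only [reverse_cons, reverse_nil, nil_append, cons_append, findSome?_cons]
  rw [fm_none (fun i => faith_top i _ _ (by simp)), fm_none h, fm_none (fun i => faith_top i _ _ le_rfl)]
  simp only
  have : ∀ l : List ℕ, (∀ j ∈ l, j < B.length) → l.findSome? (FM (B ++ [t])) = l.findSome? (FM B) := by
    intro l hl
    induction l with
    | nil => rfl
    | cons j l ih =>
      have hj := hl j (by simp)
      rw [findSome?_cons, findSome?_cons, ih (fun j hj => hl j (by simp [hj]))]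
      have : FM (B ++ [t]) j = FM B j := by
        simp only [FM]
        congr 2
        funext i
        simp only [faithfulSeq]
        split_ifs with hij
        · exact faith_snoc _ _ _ _ (by omega)
        · rfl
      rw [this]
  exact this _ (by simp)

/-- class data of a list of rows -/
def InC (B P : List (List ℕ)) : Prop := RI B ∧ Red (wordOf B) ∧ PT (ub B) = P

theorem InC.ck {B B' P : List (List ℕ)} (h : InC B P) (hI : RI B') (hc : CK (wordOf B) (wordOf B')) : InC B' P :=
  ⟨hI, hc.red h.2.1, by rw [← h.2.2]; exact (PT_congr (ub_red h.2.1) (by rw [ub_rev, ub_rev]; exact hc)).symm⟩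

theorem InC.fl {B P : List (List ℕ)} (h : InC B P) (i n : ℕ) : InC (fl i n B) P :=
  h.ck (fl_ck i n B h.1 h.2.1).2.1 (fl_ck i n B h.1 h.2.1).1

theorem wordOf_app (A B : List (List ℕ)) : wordOf (A ++ B) = wordOf B ++ wordOf A := by simp [wordOf]

theorem noMove {B P : List (List ℕ)} {t : List ℕ} {p : ℕ} (h : InC (B ++ [t]) P) (hp : ∀ r ∈ col P 0, r ≤ p)
    (ht : ∀ e ∈ t, p ≤ e) (hl : t.length = aP P p) (i : ℕ) : faithfulSeq i B.length (B ++ [t]) = false := by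
  by_contra hf
  rw [Bool.not_eq_false, faithfulSeq] at hf
  split_ifs at hf with h1
  have := faith_ind i (B.length - i) _ (by rw [show B.length - i + 1 = B.length + 1 - i by omega]; exact hf)
  rw [show i + (B.length - i) = B.length by omega] at this
  have h2 := h.fl i (B.length - i)
  rw [fl_snoc _ _ _ _ (by omega)] at this h2
  have hlen := fl_len i (B.length - i) B
  generalize fl i (B.length - i) B = B' at *
  rw [← hlen] at this
  rcases eq_nil_or_concat B' with rfl | ⟨A, c, rfl⟩
  · exact this (liftAt_zero _)
  · have e := liftAt_app1 A [] c t
    rw [concat_eq_append, append_assoc] at *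
    simp only [length_append, length_singleton, singleton_append] at *
    rw [e] at this
    have h3 := h2.2.1
    rw [wordOf_app] at h3
    have hred : Red (t ++ c) := by have := h3.left; simpa [wordOf] using this
    have hck := liftAt_ck _ (A.length + 1) h2.1 h2.2.1
    rw [e] at hck
    have h4 := h2.ck hck.2.1 hck.1
    obtain ⟨a1, a2⟩ := lift_ch (q := p) (h2.1 t (by simp)) (h2.1 c (by simp)) hred (by
      intro hc; apply this; rw [hc]) ht
    have e2 : A ++ (liftPair t c).2 :: (liftPair t c).1 :: [] = (A ++ [(liftPair t c).2]) ++ [(liftPair t c).1] := by simp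
    rw [e2] at h4
    have := top_bd h4.2.1 h4.2.2 hp a2
    omega

theorem canon_snoc {P P2 : List (List ℕ)} {t : List ℕ} {p : ℕ} (hp : ∀ r ∈ col P 0, r ≤ p) (ht : ∀ e ∈ t, p ≤ e)
    (hl : t.length = aP P p) (hi : Inc t) (hr : Red (wordOf (P2 ++ [t]))) (hP : PT (ub (P2 ++ [t])) = P) (f : ℕ) (B : List (List ℕ))
    (hI : RI B) (hc : CK (wordOf P2) (wordOf B)) : liftCanonAux f (B ++ [t]) = liftCanonAux f B ++ [t] := by
  induction f generalizing B with
  | zero => rfl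
  | succ f ih =>
    have hrB : Red (wordOf B) := by
      rw [wordOf_snoc] at hr; exact hc.red hr.right
    have hIt : RI (B ++ [t]) := by
      intro r hr'
      rcases mem_append.1 hr' with h | h
      · exact hI r h
      · simp at h; subst h; exact hi
    have hck : CK (wordOf (P2 ++ [t])) (wordOf (B ++ [t])) := by
      rw [wordOf_snoc, wordOf_snoc]; exact hc.left t
    have hin : InC (B ++ [t]) P :=
      ⟨hIt, hck.red hr, by rw [← hP]; exact (PT_congr (ub_red hr) (by rw [ub_rev, ub_rev]; exact hck)).symm⟩
    have hfs := find_snoc (noMove hin hp ht hl)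
    simp only [liftCanonAux]
    rw [hfs]
    cases hm : findMove B with
    | none => rfl
    | some ij =>
      obtain ⟨i, j⟩ := ij
      simp only
      have hfl : ∀ T, liftSeq i j T = fl i (j + 1 - i) T := fun T => rfl
      have hij : faithfulSeq i j B = true := by
        rw [findMove_eq] at hm
        obtain ⟨j', -, hj'⟩ := exists_of_findSome?_eq_some hm
        simp only [FM, Option.map_eq_some_iff, Prod.mk.injEq] at hj'
        obtain ⟨i', h1, rfl, rfl⟩ := hj'
        have h2 := find?_some h1
        simpa using h2
      have hj : j < B.length := by
        by_contra hj; rw [faith_top i j B (by omega)] at hij; simp at hij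
      have hle : i ≤ j := by
        by_contra h; simp [faithfulSeq, h] at hij
      rw [hfl, hfl, fl_snoc _ _ _ _ (by omega)]
      obtain ⟨h1, h2, -⟩ := fl_ck i (j+1-i) B hI hrB
      exact ih _ h2 (hc.trans h1)


def sw : List ℕ → List (List ℕ) → List (List ℕ)
  | c, [] => [c]
  | c, d :: D => (UU d c).2 :: sw (UU d c).1 D

def CH : List ℕ → List (List ℕ) → Prop
  | _, [] => True
  | c, d :: D => WW d c ∧ CH d D

def OKp : List ℕ → List (List ℕ) → Prop
  | _, [] => True
  | c, d :: D => OK d c ∧ OKp (UU d c).1 D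

theorem ch_tab {c : List ℕ} {D : List (List ℕ)} (h : Tab (c :: D)) : CH c D := by
  induction D generalizing c with
  | nil => trivial
  | cons d D ih =>
    obtain ⟨h1, h2, h3⟩ := h
    exact ⟨dom_W h3.1 (by simpa using h2), ih h3⟩

theorem ch_up {c d : List ℕ} {D : List (List ℕ)} (hd : Inc d) (h : CH d D) : CH (UU d c).1 D := by
  cases D with
  | nil => trivial
  | cons e D => exact ⟨UU_WW hd h.1, h.2⟩

/-- data of one step -/
theorem step_ck {c d : List ℕ} {D : List (List ℕ)} (hI : RI (c :: d :: D)) (hr : Red (wordOf (c :: d :: D))) :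
    Red (d ++ c) ∧ RI ((UU d c).1 :: D) ∧ Inc (UU d c).2 ∧
      CK (wordOf (c :: d :: D)) (wordOf ((UU d c).1 :: D) ++ (UU d c).2) ∧ Red (wordOf ((UU d c).1 :: D)) := by
  simp only [wordOf_cons, append_assoc] at *
  have h1 : Red (d ++ c) := hr.right
  obtain ⟨a, b, b', -⟩ := UU_ck (hI d (by simp)) (hI c (by simp)) h1
  have hck := CK.left (wordOf D) a
  refine ⟨h1, ?_, b', hck, ?_⟩
  · intro r hr
    rcases mem_cons.1 hr with rfl | h
    · exact b
    · exact hI r (by simp [h])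
  · have := hck.red hr
    rw [← append_assoc] at this
    exact this.left

theorem sw_ck {c : List ℕ} {D : List (List ℕ)} (hI : RI (c :: D)) (hr : Red (wordOf (c :: D))) :
    CK (wordOf (c :: D)) (wordOf (sw c D)) ∧ RI (sw c D) := by
  induction D generalizing c with
  | nil => exact ⟨CK.refl _, hI⟩
  | cons d D ih =>
    obtain ⟨-, h2, h3, h4, h5⟩ := step_ck hI hr
    obtain ⟨a, b⟩ := ih h2 h5
    refine ⟨h4.trans ?_, ?_⟩
    · have e : wordOf (sw c (d :: D)) = wordOf (sw (UU d c).1 D) ++ (UU d c).2 := by rw [sw, wordOf_cons]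
      rw [e]; exact a.right _
    · intro r hr
      rcases mem_cons.1 hr with rfl | h
      · exact h3
      · exact b r h

theorem sw_len {c : List ℕ} {D : List (List ℕ)} (hI : RI (c :: D)) (hr : Red (wordOf (c :: D))) (hC : CH c D) :
    (sw c D).map length = D.map length ++ [c.length] := by
  induction D generalizing c with
  | nil => rfl
  | cons d D ih =>
    obtain ⟨-, h2, h3, h4, h5⟩ := step_ck hI hr
    have hd := hI d (by simp)
    obtain ⟨l1, l2⟩ := UU_len hd (hI c (by simp)) hC.1
    rw [sw, map_cons, ih h2 h5 (ch_up hd hC.2), l1, l2]; rfl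

theorem head_le {l : List ℕ} (h : Inc l) : ∀ e ∈ l, l.headD 0 ≤ e := by
  cases l with
  | nil => simp
  | cons a l =>
    rw [inc_cons] at h
    intro e he
    rcases mem_cons.1 he with rfl | he
    · exact le_rfl
    · exact (h.1 e he).le

theorem ok_ge {τ σ : List ℕ} {q : ℕ} (h : OK τ σ) (hq : ∀ t ∈ τ, q ≤ t) : ∀ e ∈ (UU τ σ).1, q ≤ e := by
  have := ok_top_ge (q := q) h (by simpa using hq)
  simpa [UU] using this

theorem head_mem {l : List ℕ} (h : l ≠ []) : l.headD 0 ∈ l := by cases l <;> simp_all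

theorem ok_head {τ σ : List ℕ} (h1 : Inc τ) (h2 : Inc (UU τ σ).1) (hn : τ ≠ []) (h : OK τ σ) :
    (UU τ σ).1.headD 0 = τ.headD 0 ∧ (UU τ σ).1 ≠ [] := by
  have hs : τ ⊆ (UU τ σ).1 := by
    have := U_sub τ.reverse σ.reverse
    simpa [UU] using this
  have hm := hs (head_mem hn)
  have hne : (UU τ σ).1 ≠ [] := by intro h'; rw [h'] at hm; simp at hm
  exact ⟨le_antisymm (head_le h2 _ hm) (ok_ge h (head_le h1) _ (head_mem hne)), hne⟩

theorem sw_ok {c : List ℕ} {D : List (List ℕ)} (hI : RI (c :: D)) (hr : Red (wordOf (c :: D))) (hn : NE (c :: D))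
    (hh : (sw c D).map (fun r => r.headD 0) = (c :: D).map (fun r => r.headD 0))
    (hs : Inc ((c :: D).map (fun r => r.headD 0))) : OKp c D := by
  induction D generalizing c with
  | nil => trivial
  | cons d D ih =>
    obtain ⟨-, h2, h3, h4, h5⟩ := step_ck hI hr
    rw [sw, map_cons, map_cons, cons.injEq] at hh
    rw [map_cons, inc_cons] at hs
    have hok : OK d c := by
      by_contra hno
      obtain ⟨a, l, rfl, ha⟩ := UU_nok hno
      obtain ⟨h6, h7⟩ := sw_ck h2 h5
      have : a ∈ wordOf (sw (UU d (a :: l)).1 D) := (h6.mem a).1 (by rw [wordOf_cons]; simp [ha])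
      rw [mem_wordOf] at this
      obtain ⟨r, hr1, hr2⟩ := this
      have h8 := head_le (h7 r hr1) a hr2
      have h9 : r.headD 0 ∈ (d :: D).map (fun r => r.headD 0) := by
        rw [← hh.2]; exact mem_map_of_mem (f := fun r : List ℕ => r.headD 0) hr1
      have := hs.1 _ h9
      simp at this; simp at h8; omega
    have hd : d ≠ [] := hn d (by simp)
    obtain ⟨e1, e2⟩ := ok_head (hI d (by simp)) (h2 _ (by simp)) hd hok
    have e3 : ((UU d c).1 :: D).map (fun r => r.headD 0) = (d :: D).map (fun r => r.headD 0) := by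
      rw [map_cons, map_cons, e1]
    refine ⟨hok, ih h2 h5 ?_ ?_ ?_⟩
    · intro r hr
      rcases mem_cons.1 hr with rfl | h
      · exact e2
      · exact hn r (by simp [h])
    · rw [e3]; exact hh.2
    · rw [e3]; exact hs.2

theorem faith_ok {c : List ℕ} {A D : List (List ℕ)} (hI : RI (c :: D)) (hr : Red (wordOf (c :: D))) 
    (hf : faithfulAux D.length (A.length + 1) (A ++ c :: D) = true) : OKp c D := by
  induction D generalizing c A with
  | nil => trivial
  | cons d D ih =>
    obtain ⟨h1, h2, h3, h4, h5⟩ := step_ck hI hr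
    rw [length_cons, faithfulAux] at hf
    simp only [liftAt_app1] at hf
    split_ifs at hf with g1 g2
    · refine ⟨?_, ?_⟩
      · by_contra hno; apply g1; rw [lift_nok hno]
      · rw [length_eq_zero_iff.1 g2]; trivial
    · have hok : OK d c := by
        by_contra hno; apply g1; rw [lift_nok hno]
      rw [lift_ok (hI d (by simp)) (hI c (by simp)) h1 hok] at hf
      refine ⟨hok, ih (A := A ++ [(UU d c).2]) h2 h5 ?_⟩
      simpa using hf

theorem ok_fl {c : List ℕ} {A D : List (List ℕ)} (hI : RI (c :: D)) (hr : Red (wordOf (c :: D))) 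
    (ho : OKp c D) : fl (A.length + 1) D.length (A ++ c :: D) = A ++ sw c D := by
  induction D generalizing c A with
  | nil => rfl
  | cons d D ih =>
    obtain ⟨h1, h2, h3, h4, h5⟩ := step_ck hI hr
    rw [length_cons, fl_succ, liftAt_app1, lift_ok (hI d (by simp)) (hI c (by simp)) h1 ho.1]
    have := ih (A := A ++ [(UU d c).2]) h2 h5 ho.2
    simpa [sw] using this

theorem ok_faith {c : List ℕ} {A D : List (List ℕ)} (hI : RI (c :: D)) (hr : Red (wordOf (c :: D))) 
    (ho : OKp c D) (hC : CH c D) (hl : ∀ d ∈ D, d.length < c.length) (hD : D ≠ []) :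
    faithfulAux D.length (A.length + 1) (A ++ c :: D) = true := by
  induction D generalizing c A with
  | nil => simp at hD
  | cons d D ih =>
    obtain ⟨h1, h2, h3, h4, h5⟩ := step_ck hI hr
    have hd := hI d (by simp)
    obtain ⟨l1, l2⟩ := UU_len hd (hI c (by simp)) hC.1
    rw [length_cons, faithfulAux]
    simp only [liftAt_app1, lift_ok (hI d (by simp)) (hI c (by simp)) h1 ho.1]
    rw [if_neg]
    · split_ifs with g2
      · rfl
      · have := ih (A := A ++ [(UU d c).2]) h2 h5 ho.2 (ch_up hd hC.2) (fun e he => by rw [l2]; exact hl e (by simp [he])) (by rintro rfl; simp at g2)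
        simpa using this
    · intro h
      have := append_cancel_left h
      simp only [cons.injEq] at this
      have h7 := hl d (by simp)
      rw [this.1] at l1; omega

theorem ok_top {q : ℕ} {c : List ℕ} {D : List (List ℕ)} (ho : OKp c D) (h : ∀ e ∈ D.getLastD c, q ≤ e) (y : List ℕ) :
    ∀ e ∈ (sw c D).getLastD y, q ≤ e := by
  induction D generalizing c y with
  | nil => simpa [sw] using h
  | cons d D ih =>
    rw [sw, getLastD_cons]
    rw [getLastD_cons] at h
    apply ih ho.2
    cases D with
    | nil => simp only [getLastD_nil] at *; exact ok_ge ho.1 h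
    | cons e D => rwa [getLastD_cons] at *

theorem gLD (A D : List (List ℕ)) (a d : List ℕ) : (A ++ a :: D).getLastD d = D.getLastD a := by
  induction A generalizing d with
  | nil => rw [nil_append, getLastD_cons]
  | cons b A ih => rw [cons_append, getLastD_cons, ih]

theorem split_last {P : List (List ℕ)} {l : ℕ} (h : l ∈ P.map length) :
    ∃ A s D, P = A ++ s :: D ∧ s.length = l ∧ ∀ d ∈ D, d.length ≠ l := by
  induction P with
  | nil => simp at h
  | cons r R ih =>
    by_cases h' : l ∈ R.map length
    · obtain ⟨A, s, D, rfl, h1, h2⟩ := ih h'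
      exact ⟨r :: A, s, D, rfl, h1, h2⟩
    · refine ⟨[], r, R, rfl, ?_, ?_⟩
      · rw [map_cons, mem_cons] at h
        rcases h with h | h
        · exact h.symm
        · exact absurd h h'
      · intro d hd he; exact h' (he ▸ mem_map_of_mem hd)

theorem tab_len {P : List (List ℕ)} (h : Tab P) : (P.map length).Pairwise (· ≥ ·) := by
  induction P with
  | nil => simp
  | cons r R ih =>
    obtain ⟨h1, h2, h3⟩ := h
    have h4 := ih h3
    rw [map_cons, pairwise_cons]
    refine ⟨?_, h4⟩
    cases R with
    | nil => simp
    | cons s R =>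
      rw [map_cons, pairwise_cons] at h4
      have := h2.len
      simp only [headD_cons] at this
      intro a ha
      rw [map_cons, mem_cons] at ha
      rcases ha with rfl | ha
      · exact this
      · exact (h4.1 a ha).le.trans this

theorem tab_app {A D : List (List ℕ)} (h : Tab (A ++ D)) : Tab D := by
  induction A with
  | nil => exact h
  | cons a A ih => exact ih h.2.2

theorem tab_RI {P : List (List ℕ)} (h : Tab P) : RI P := by
  induction P with
  | nil => simp [RI]
  | cons a A ih =>
    intro r hr
    rcases mem_cons.1 hr with rfl | hr
    · exact h.1
    · exact ih h.2.2 r hr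

theorem phase {P P2 : List (List ℕ)} {t : List ℕ} {p : ℕ} (h : EGT P) (hp : ∀ r ∈ col P 0, r ≤ p)
    (h2 : EGT P2) (hti : Inc t) (hr : Red (wordOf (P2 ++ [t]))) (hP : PT (ub (P2 ++ [t])) = P) (hth : t.headD 0 = p)
    (hl : t.length = aP P p) (hperm : map length (P2 ++ [t]) ~ map length P)
    (hh : map (fun r => r.headD 0) (P2 ++ [t]) = map (fun r => r.headD 0) P) :
    P = P2 ++ [t] ∨ ∃ i j, findMove P = some (i, j) ∧ liftSeq i j P = P2 ++ [t] := by
  obtain ⟨hT, hN, hR⟩ := id h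
  have hRI := tab_RI hT
  have hub : PT (ub P) = P := by
    have := h.pt
    rwa [← ub_rev, reverse_reverse] at this
  have hin : InC P P := ⟨hRI, hR, hub⟩
  have hmem : aP P p ∈ P.map length := by
    rw [← hl]; exact hperm.subset (by simp)
  obtain ⟨A, s, D, hPe, hs, hD⟩ := split_last hmem
  have hlen := tab_len hT
  have hDl : ∀ d ∈ D, d.length < s.length := by
    intro d hd
    rw [hPe, map_append, pairwise_append, map_cons, pairwise_cons] at hlen
    have := hlen.2.1.1 d.length (mem_map_of_mem hd)
    have := hD d hd
    omega
  have hTs : Tab (s :: D) := tab_app (A := A) (by rw [← hPe]; exact hT)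
  have hCs := ch_tab hTs
  have hRIs := tab_RI hTs
  have hrs : Red (wordOf (s :: D)) := by
    rw [hPe, wordOf_app] at hR; exact hR.left
  obtain ⟨ck, ri⟩ := sw_ck hRIs hrs
  have hin2 : InC (A ++ sw s D) P := by
    refine hin.ck ?_ ?_
    · intro r hr
      rcases mem_append.1 hr with h | h
      · exact hRI r (by rw [hPe]; simp [h])
      · exact ri r h
    · rw [hPe, wordOf_app, wordOf_app]; exact ck.right _
  have hsl := sw_len hRIs hrs hCs
  have heq : A ++ sw s D = P2 ++ [t] := by
    refine u_uniq hin2.1 ?_ hin2.2.1 hr (by rw [hin2.2.2, hP]) ?_ ?_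
    · intro r hr
      rcases mem_append.1 hr with h | h
      · exact tab_RI h2.1 r h
      · simp at h; subst h; exact hti
    · rw [map_append, hsl, map_append, map_singleton, hl, ← hs, ← append_assoc]
      congr 1
      refine Perm.eq_of_pairwise (le := (· ≥ ·)) (fun a b _ _ h1 h2 => le_antisymm h2 h1) ?_ (tab_len h2.1) ?_
      · rw [hPe, map_append, map_cons] at hlen
        refine hlen.sublist ?_
        exact (Sublist.refl _).append (sublist_cons_self _ _)
      · rw [hPe, map_append, map_append, map_singleton, map_cons, hl, ← hs] at hperm
        have h5 := hperm.trans perm_middle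
        exact ((perm_cons _).1 ((perm_append_comm (l₁ := [s.length])).trans h5)).symm
    · rw [hin2.2.2, map_append, hsl, hPe, map_append, map_cons]
      exact (perm_append_comm (l₂ := [s.length])).append_left _
  by_cases hD0 : D = []
  · left; subst hD0; rw [hPe]; exact heq
  right
  have hpl : P.length = A.length + D.length + 1 := by rw [hPe]; simp; omega
  have hok : OKp s D := by
    refine sw_ok hRIs hrs (fun r hr => hN r (by rw [hPe]; exact mem_append_right _ hr)) ?_ ?_
    · rw [← heq, hPe, map_append, map_append] at hh
      exact append_cancel_left hh
    · have := heads_inc hT hN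
      rw [hPe, map_append, inc_append] at this
      exact this.2.1
  have hlast : ∀ e ∈ P.getLastD [], p ≤ e := by
    have h3 : P ≠ [] := by rw [hPe]; simp
    have h4 := congrArg (fun l => l.getLastD 0) hh
    rcases eq_nil_or_concat P with h5 | ⟨P', y, h5⟩
    · exact absurd h5 h3
    · rw [h5] at h4 ⊢
      simp at h4 ⊢
      intro e he
      have h6 := head_le (hRI y (by rw [h5]; simp)) e he
      simp at h6
      simp at hth
      omega
  refine ⟨A.length + 1, A.length + D.length, ?_, ?_⟩
  · rw [findMove_eq, hpl, range_succ, reverse_append, range_succ, reverse_append]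
    simp only [reverse_cons, reverse_nil, nil_append, cons_append, findSome?_cons]
    rw [fm_none (fun i => faith_top i _ _ hpl.le)]
    have : FM P (A.length + D.length) = some (A.length + 1, A.length + D.length) := by
      rw [FM, Option.map_eq_some_iff]
      refine ⟨A.length + 1, ?_, rfl⟩
      rw [find?_range'_eq_some]
      have hD1 : 0 < D.length := length_pos_iff.2 hD0
      refine ⟨?_, ?_, ?_⟩
      · rw [faithfulSeq, if_pos (by omega), hPe, show A.length + D.length + 1 - (A.length + 1) = D.length by omega]
        exact ok_faith hRIs hrs hok hCs hDl hD0
      · rw [mem_range'_1]; omega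
      · intro i hi1 hi2
        rw [Bool.not_eq_true', ← Bool.not_eq_true]
        intro hf
        rw [faithfulSeq, if_pos (by omega)] at hf
        obtain ⟨A1, a, A2, hA, hA1⟩ : ∃ A1 a A2, A = A1 ++ a :: A2 ∧ A1.length + 1 = i := by
          have hi3 : i - 1 < A.length := by omega
          refine ⟨A.take (i-1), A[i-1], A.drop (i - 1 + 1), ?_, ?_⟩
          · rw [cons_getElem_drop_succ, take_append_drop]
          · rw [length_take]; omega
        set D0 := A2 ++ s :: D with hD0e
        have hPe' : P = A1 ++ a :: D0 := by rw [hPe, hA]; simp [hD0e]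
        have hDl0 : A.length + D.length + 1 - i = D0.length := by
          rw [hA]; simp [hD0e]; omega
        rw [hDl0, ← hA1, hPe'] at hf
        have hTa : Tab (a :: D0) := tab_app (A := A1) (by rw [← hPe']; exact hT)
        have hra : Red (wordOf (a :: D0)) := by
          rw [hPe', wordOf_app] at hR; exact hR.left
        have hRIa := tab_RI hTa
        have hCa := ch_tab hTa
        have hoka := faith_ok hRIa hra hf
        have hsa := sw_len hRIa hra hCa
        obtain ⟨cka, ria⟩ := sw_ck hRIa hra
        have hin3 : InC (A1 ++ sw a D0) P := by
          refine hin.ck ?_ ?_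
          · intro r hr
            rcases mem_append.1 hr with h | h
            · exact hRI r (by rw [hPe']; simp [h])
            · exact ria r h
          · rw [hPe', wordOf_app, wordOf_app]; exact cka.right _
        have htop := ok_top (q := p) hoka (by
          have : D0.getLastD a = P.getLastD [] := by rw [hPe', gLD A1 D0]
          rw [this]; exact hlast) []
        have hle : a.length ≤ s.length := by
          rcases eq_nil_or_concat (sw a D0) with h5 | ⟨B, y, h5⟩
          · rw [h5] at hsa; simp at hsa
          · rw [h5] at hsa htop hin3
            rw [concat_eq_append] at hsa htop hin3
            rw [map_append, map_singleton] at hsa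
            have h6 := append_inj_right' hsa rfl
            simp at h6
            rw [← append_assoc] at hin3
            have := top_bd hin3.2.1 hin3.2.2 hp (by simpa using htop)
            omega
        have hlena := tab_len hTa
        rw [map_cons, pairwise_cons] at hlena
        -- the next row
        cases hD0c : D0 with
        | nil => simp [hD0e] at hD0c
        | cons d D1 =>
          have hsd : s.length ≤ d.length := by
            cases hA2 : A2 with
            | nil =>
              rw [hD0e, hA2] at hD0c; simp at hD0c; rw [hD0c.1]
            | cons b A3 =>
              rw [hD0e, hA2] at hD0c; simp at hD0c
              have h7 := hlena.2
              rw [hD0e, hA2] at h7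
              simp only [cons_append, map_cons, pairwise_cons] at h7
              rw [← hD0c.1]
              exact h7.1 s.length (by simp)
          have had : a.length ≥ d.length := hlena.1 _ (by rw [hD0c]; simp)
          rw [hD0c] at hra hRIa hCa hf
          obtain ⟨h1, -, -, -, -⟩ := step_ck hRIa hra
          rw [length_cons, faithfulAux] at hf
          simp only [liftAt_app1] at hf
          by_cases g1 : liftPair d a = (d, a)
          · rw [g1] at hf; simp at hf
          · have hda := hRIa d (by simp)
            have haa := hRIa a (by simp)
            have := (lift_ch (q := 0) hda haa h1 g1 (by simp)).1
            have hok : OK d a := by by_contra hno; exact g1 (lift_nok hno)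
            rw [lift_ok hda haa h1 hok, (UU_len hda haa hCa.1).2] at this
            omega
    rw [this]
  · show fl _ _ _ = _
    rw [show A.length + D.length + 1 - (A.length + 1) = D.length by omega, hPe, ok_fl hRIs hrs hok, heq]

theorem canon_nil (f : ℕ) : liftCanonAux f [] = [] := by
  cases f with
  | zero => rfl
  | succ f =>
    have : findMove [] = none := rfl
    rw [liftCanonAux, this]

theorem canon_main (n : ℕ) (P : List (List ℕ)) (h : EGT P) (hn : P.length = n) (f : ℕ) (hf : n ≤ f) :
    RI (liftCanonAux f P) ∧ (liftCanonAux f P).map (fun r => r.headD 0) = P.map (fun r => r.headD 0) ∧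
      (liftCanonAux f P).map length = (P.map (fun r => r.headD 0)).map (aP P) := by
  induction n generalizing P f with
  | zero =>
    rw [length_eq_zero_iff] at hn; subst hn
    simp [canon_nil, RI]
  | succ n ih =>
    obtain ⟨hT, hN, hR⟩ := id h
    have hinc := heads_inc hT hN
    obtain ⟨p, hp1, hp2⟩ : ∃ p ∈ col P 0, ∀ r ∈ col P 0, r ≤ p := by
      have : (col P 0).Nonempty := by
        cases P with
        | nil => simp at hn
        | cons r R => exact ⟨r.headD 0, (mem_col0 hN).2 (by simp)⟩
      exact ⟨_, Finset.max'_mem _ this, fun r hr => Finset.le_max' _ r hr⟩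
    obtain ⟨P2, t, h2, hti, hr, hP, hth, htn, hl, ha, hperm, hh⟩ := superstd h hp1 hp2
    have hlen2 : P2.length = n := by
      have := hperm.length_eq; simp at this; omega
    have hte : ∀ e ∈ t, p ≤ e := by rw [← hth]; exact head_le hti
    have hsn := fun g => canon_snoc hp2 hte hl hti hr hP g P2 (tab_RI h2.1) (CK.refl _)
    have key : ∃ g, n ≤ g ∧ liftCanonAux f P = liftCanonAux g P2 ++ [t] := by
      rcases phase h hp2 h2 hti hr hP hth hl hperm hh with h3 | ⟨i, j, h3, h4⟩
      · refine ⟨f, by omega, ?_⟩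
        rw [← hsn, ← h3]
      · obtain ⟨f, rfl⟩ : ∃ f', f = f' + 1 := ⟨f - 1, by omega⟩
        refine ⟨f, by omega, ?_⟩
        rw [liftCanonAux, h3]
        simp only
        rw [h4, hsn]
    obtain ⟨g, hg, e⟩ := key
    obtain ⟨i1, i2, i3⟩ := ih P2 h2 hlen2 g hg
    rw [e]
    rw [map_append, map_singleton, hth] at hh
    refine ⟨?_, ?_, ?_⟩
    · intro r hr
      rcases mem_append.1 hr with h | h
      · exact i1 r h
      · simp at h; subst h; exact hti
    · rw [map_append, i2, ← hh, map_singleton, hth]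
    · rw [map_append, i3, ← hh, map_append, map_singleton, hl]
      congr 1
      apply map_congr_left
      intro r hr
      rw [ha, if_neg]
      rw [← hh, inc_append] at hinc
      have := hinc.2.2 r hr p (by simp)
      omega


theorem spl_ne (brk : ℕ → ℕ → Bool) (a : ℕ) (l : List ℕ) : splitWhen brk (a :: l) ≠ [] := by
  cases l with
  | nil => simp [splitWhen]
  | cons b l =>
    rw [splitWhen]
    split
    · split <;> simp
    · simp

theorem spl_app (brk : ℕ → ℕ → Bool) (a : ℕ) (r w : List ℕ) (h : (a :: r).IsChain (fun x y => brk x y = false))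
    (hw : ∀ b ∈ w.head?, brk (r.getLastD a) b = true) :
    splitWhen brk (a :: r ++ w) = (a :: r) :: splitWhen brk w := by
  induction r generalizing a with
  | nil =>
    cases w with
    | nil => simp [splitWhen]
    | cons b w =>
      have := hw b (by simp)
      rw [cons_append, nil_append, splitWhen]
      cases hs : splitWhen brk (b :: w) with
      | nil => exact absurd hs (spl_ne _ _ _)
      | cons r rs => simp at this; simp [this]
  | cons b r ih =>
    rw [isChain_cons_cons] at h
    have := ih b h.2 (by rw [getLastD_cons] at hw; exact hw)
    simp only [cons_append] at this ⊢
    rw [splitWhen, this]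
    simp [h.1]

theorem spl_flat (brk : ℕ → ℕ → Bool) (l : List ℕ) : (splitWhen brk l).flatten = l ∧
    ∀ r ∈ splitWhen brk l, r ≠ [] ∧ r.IsChain (fun x y => brk x y = false) := by
  induction l with
  | nil => simp [splitWhen]
  | cons a l ih =>
    cases l with
    | nil => simp [splitWhen]
    | cons b l =>
      rw [splitWhen]
      cases hs : splitWhen brk (b :: l) with
      | nil => exact absurd hs (spl_ne _ _ _)
      | cons r rs =>
        rw [hs] at ih
        obtain ⟨h1, h2⟩ := ih
        simp only
        split_ifs with hb
        · refine ⟨by simpa using h1, ?_⟩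
          intro r' hr'
          rcases mem_cons.1 hr' with rfl | h
          · simp
          · exact h2 _ h
        · refine ⟨by simpa using h1, ?_⟩
          intro r' hr'
          rcases mem_cons.1 hr' with rfl | h
          · refine ⟨by simp, ?_⟩
            obtain ⟨h3, h4⟩ := h2 r (by simp)
            cases r with
            | nil => simp at h3
            | cons c r =>
              simp at h1
              rw [isChain_cons_cons, h1.1]
              exact ⟨by simpa using hb, h1.1 ▸ h4⟩
          · exact h2 _ (by simp [h])

theorem last_ge {a : ℕ} {r : List ℕ} (h : Inc (a :: r)) : a ≤ r.getLastD a := by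
  have := getLastD_mem' r a
  exact head_le h _ this

theorem runs_flat (L : List (List ℕ)) (hI : RI L) (hN : NE L) (hd : L.Pairwise (fun x y => y.headD 0 < x.headD 0)) :
    runs L.flatten = L := by
  induction L with
  | nil => rfl
  | cons r L ih =>
    rw [pairwise_cons] at hd
    have ih := ih (fun r hr => hI r (by simp [hr])) (fun r hr => hN r (by simp [hr])) hd.2
    cases r with
    | nil => exact absurd rfl (hN [] (by simp))
    | cons a r =>
      have hr := hI (a :: r) (by simp)
      rw [runs] at ih ⊢
      rw [flatten_cons, spl_app, ih]
      · have := isChain_iff_pairwise.2 hr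
        exact this.imp (fun x y h => by simpa using h)
      · intro b hb
        cases L with
        | nil => simp at hb
        | cons s L =>
          have hs := hN s (by simp)
          have h1 := hd.1 s (by simp)
          cases s with
          | nil => simp at hs
          | cons c s =>
            simp at hb h1
            have := last_ge hr
            rw [decide_eq_true_iff]; omega

theorem rows_word {P : List (List ℕ)} (hI : RI P) (hN : NE P) (hd : Inc (P.map (fun r => r.headD 0))) :
    runs (wordOf P) = P.reverse := by
  refine runs_flat P.reverse (fun r hr => hI r (by simpa using hr)) (fun r hr => hN r (by simpa using hr)) ?_
  rw [pairwise_reverse]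
  rwa [Inc, pairwise_map] at hd

def hatA : Option ℤ → List ℤ → List ℤ
  | _, [] => []
  | none, r :: L => r :: hatA (some r) L
  | some p, r :: L => min r (p - 1) :: hatA (some (min r (p - 1))) L

theorem hat_eq (L : List ℤ) : hatMins L = hatA none L := by
  have : ∀ (L : List ℤ) (acc : List ℤ) (o : Option ℤ), (L.foldl (fun (acc : List ℤ × Option ℤ) r =>
    let v := match acc.2 with
      | none => r
      | some p => min r (p - 1)
    (acc.1 ++ [v], some v)) (acc, o)).1 = acc ++ hatA o L := by
    intro L
    induction L with
    | nil => intro acc o; simp [hatA]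
    | cons r L ih =>
      intro acc o
      rw [foldl_cons]
      cases o with
      | none => simp only [ih]; simp [hatA]
      | some p => simp only [ih]; simp [hatA]
  have h := this L [] none
  rw [nil_append] at h
  exact h

theorem hat_some (p : ℤ) (L : List ℤ) (h : (p :: L).Pairwise (· > ·)) : hatA (some p) L = L := by
  induction L generalizing p with
  | nil => rfl
  | cons r L ih =>
    rw [pairwise_cons] at h
    have h1 := h.1 r (by simp)
    rw [hatA, min_eq_left (by omega), ih r h.2]

theorem hat_dec (L : List ℤ) (h : L.Pairwise (· > ·)) : hatMins L = L := by
  rw [hat_eq]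
  cases L with
  | nil => rfl
  | cons r L => rw [hatA, hat_some r L h]

theorem find_map (f : ℕ → ℕ) (L : List ℕ) (p : ℕ) :
    (L.map (fun h : ℕ => ((h : ℤ), f h))).find? (fun q => decide (q.1 = (p : ℤ) + 1)) =
      if p + 1 ∈ L then some (((p + 1 : ℕ) : ℤ), f (p + 1)) else none := by
  induction L with
  | nil => simp
  | cons a L ih =>
    rw [map_cons, find?_cons, ih]
    by_cases h : a = p + 1
    · subst h; simp
    · have h' : ¬ ((a : ℤ) = (p : ℤ) + 1) := by omega
      have h'' : ¬ (p + 1 = a) := fun e => h e.symm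
      simp [h', h'']

/-- largest head -/
def mx (P : List (List ℕ)) : ℕ := (P.map (fun r => r.headD 0)).reverse.headD 0
noncomputable def aL (P : List (List ℕ)) : List ℕ := (List.range (mx P)).map (fun i => aP P (i + 1))

theorem egt_pos {P : List (List ℕ)} (h : EGT P) {r : ℕ} (hr : r ∈ col P 0) : 1 ≤ r :=
  h.2.2.1 r (col0_mem hr)

theorem mx_le {P : List (List ℕ)} (h : EGT P) {r : ℕ} (hr : r ∈ col P 0) : r ≤ mx P := by
  have hi := heads_inc h.1 h.2.1
  rw [mem_col0 h.2.1] at hr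
  rw [mx]
  generalize P.map (fun r => r.headD 0) = L at *
  rcases eq_nil_or_concat L with rfl | ⟨L, a, rfl⟩
  · simp at hr
  · rw [concat_eq_append, inc_append] at hi
    simp at hr ⊢
    rcases hr with hr | hr
    · exact (hi.2.2 r hr a (by simp)).le
    · omega

theorem des_lift {P : List (List ℕ)} (h : EGT P) : desWord (liftWord (wordOf P)) = some (aL P) := by
  have hinc := heads_inc h.1 h.2.1
  have hrow : rowsOf (wordOf P) = P := by
    rw [rowsOf, rows_word (tab_RI h.1) h.2.1 hinc, reverse_reverse]
  rw [liftWord, hrow, liftCanon]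
  have hfuel : P.length ≤ P.flatten.length * P.length + 1 := by
    cases P with
    | nil => simp
    | cons r R =>
      have hr := h.2.1 r (by simp)
      have : 1 ≤ ((r :: R).flatten).length := by
        have := length_pos_iff.2 hr
        simp; omega
      nlinarith [(r :: R).length.zero_le]
  obtain ⟨h1, h2, h3⟩ := canon_main _ P h rfl _ hfuel
  generalize liftCanonAux (P.flatten.length * P.length + 1) P = T at *
  have hN : NE T := by
    intro r hr hr0
    have : r.length ∈ T.map length := mem_map_of_mem hr
    rw [h3, mem_map] at this
    obtain ⟨e, he, he2⟩ := this
    rw [← mem_col0 h.2.1, ← aP_pos h.1] at he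
    rw [hr0] at he2; simp at he2; omega
  rw [desWord, rows_word h1 hN (by rw [h2]; exact hinc)]
  have e1 : T.reverse.map (fun r => ((r.headD 0 : ℕ) : ℤ)) = (P.map (fun r => r.headD 0)).reverse.map (fun n : ℕ => (n : ℤ)) := by
    rw [← h2, ← map_reverse, map_map]; rfl
  have e2 : T.reverse.map length = (P.map (fun r => r.headD 0)).reverse.map (aP P) := by
    rw [map_reverse, h3, map_reverse]
  rw [e1, e2, desFromBlocks]
  have hmem : ∀ e, e ∈ (P.map (fun r => r.headD 0)).reverse ↔ 0 < aP P e := by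
    intro e; rw [mem_reverse, ← mem_col0 h.2.1, aP_pos h.1]
  have hp : ∀ e ∈ (P.map (fun r => r.headD 0)).reverse, 1 ≤ e := by
    intro e he; rw [hmem, aP_pos h.1] at he; exact egt_pos h he
  rw [aL, mx]
  have hD : Dec (P.map (fun r => r.headD 0)).reverse := inc_rev hinc
  generalize (P.map (fun r => r.headD 0)).reverse = L at *
  rw [hat_dec]
  · cases L with
    | nil => simp
    | cons a L =>
      rw [if_neg (by simp), if_neg]
      · rw [buildWeakComp, zip_map']
        have hc : ∀ l : List ℕ, (do let a ← l; pure (a : ℤ)) = l.map (fun n : ℕ => (n : ℤ)) := by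
          intro l
          induction l with
          | nil => rfl
          | cons a l ih =>
            rw [map_cons, ← ih]; rfl
        rw [hc, map_map, Option.some.injEq]
        rw [show ((map (fun n : ℕ => (n : ℤ)) (a :: L)).headD 0).toNat = a by simp]
        apply map_congr_left
        intro p hp
        simp only [Function.comp_def]
        rw [find_map]
        by_cases hm : p + 1 ∈ a :: L
        · rw [if_pos hm]
        · rw [if_neg hm]
          rw [hmem] at hm
          simp; omega
      · have : (map (fun n : ℕ => (n : ℤ)) (a :: L)).getLastD 0 = ((L.getLastD a : ℕ) : ℤ) := by
          rw [map_cons, getLastD_cons]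
          clear hp hmem hD e2 e1
          induction L generalizing a with
          | nil => rfl
          | cons b L ih => rw [map_cons, getLastD_cons, ih, getLastD_cons]
        rw [this]
        have := hp _ (getLastD_mem' L a)
        omega
  · rw [pairwise_map]
    exact hD.imp (fun h => by omega)


def pos (r : ℕ) : List ℕ → List ℕ
  | [] => []
  | x :: g => (pos r g).map (· + 1) ++ if x = r then [1] else []

theorem pos_pos (r : ℕ) (g : List ℕ) : ∀ e ∈ pos r g, 1 ≤ e := by
  induction g with
  | nil => simp [pos]
  | cons x g ih =>
    intro e he
    rw [pos, mem_append] at he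
    rcases he with he | he
    · obtain ⟨e', -, rfl⟩ := mem_map.1 he; omega
    · split_ifs at he <;> simp at he; omega

theorem pos_dec (r : ℕ) (g : List ℕ) : Dec (pos r g) := by
  induction g with
  | nil => simp [pos]
  | cons x g ih =>
    rw [pos, Dec, pairwise_append, pairwise_map]
    refine ⟨ih.imp (fun h => by omega), by split_ifs <;> simp, ?_⟩
    intro a ha b hb
    obtain ⟨a', ha', rfl⟩ := mem_map.1 ha
    have := pos_pos r g a' ha'
    split_ifs at hb <;> simp at hb
    omega

theorem pos_mem (r : ℕ) (g : List ℕ) (e : ℕ) : e + 1 ∈ pos r g ↔ g[e]? = some r := by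
  induction g generalizing e with
  | nil => simp [pos]
  | cons x g ih =>
    rw [pos, mem_append]
    cases e with
    | zero =>
      have h0 : ¬ (0 + 1 ∈ (pos r g).map (· + 1)) := by
        intro h
        obtain ⟨a, ha, h2⟩ := mem_map.1 h
        have := pos_pos r g a ha
        omega
      simp only [h0, false_or]
      split_ifs with h <;> simp [h]
    | succ e =>
      rw [getElem?_cons_succ, ← ih]
      have : ¬ (e + 1 + 1 ∈ if x = r then [1] else []) := by split_ifs <;> simp
      simp only [this, or_false, mem_map]
      constructor
      · rintro ⟨a, ha, h⟩
        have : a = e + 1 := by omega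
        exact this ▸ ha
      · intro h; exact ⟨e + 1, h, rfl⟩

theorem pos_cnt (r : ℕ) (g : List ℕ) (e : ℕ) : (pos r g).countP (e < ·) = (g.drop e).count r := by
  induction g generalizing e with
  | nil => simp [pos]
  | cons x g ih =>
    cases e with
    | zero =>
      have h1 := ih 0
      rw [pos, countP_append, countP_map]
      rw [drop_zero, count_cons]
      rw [drop_zero] at h1
      rw [← h1]
      congr 1
      · apply countP_congr
        intro a ha
        have := pos_pos r g a ha
        simp; omega
      · by_cases h : x = r <;> simp [h]
    | succ e =>
      rw [pos, countP_append, countP_map, drop_succ_cons, ← ih]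
      have : countP (fun x => decide (e + 1 < x)) (if x = r then [1] else []) = 0 := by
        split_ifs <;> simp
      rw [this, Nat.add_zero]
      apply countP_congr
      intro a ha
      simp

theorem pos_len (r : ℕ) (g : List ℕ) : (pos r g).length = g.count r := by
  induction g with
  | nil => simp [pos]
  | cons x g ih =>
    rw [pos, count_cons, length_append, length_map, ih]
    by_cases h : x = r <;> simp [h]

theorem dec_cnt {l : List ℕ} (h : Dec l) (e c : ℕ) : c < l.countP (e < ·) ↔ c < l.length ∧ e < l.getD c 0 := by
  induction l generalizing c with
  | nil => simp
  | cons a l ih =>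
    rw [Dec, pairwise_cons] at h
    rw [countP_cons]
    by_cases ha : e < a
    · cases c with
      | zero => simp [ha]
      | succ c => 
        have := ih h.2 c
        simp only [ha, decide_true, if_true, length_cons, getD_cons_succ, Nat.add_lt_add_iff_right]
        exact this
    · have h0 : l.countP (e < ·) = 0 := by
        rw [countP_eq_zero]
        intro b hb
        have := h.1 b hb
        simp; omega
      simp only [h0, ha, decide_false]
      cases c with
      | zero => simp [ha]
      | succ c =>
        have h1 := ih h.2 c
        rw [h0] at h1
        simp at h1 ⊢
        exact h1

theorem dec_idx {l : List ℕ} (h : Dec l) {c : ℕ} (hc : c < l.length) : l.countP (l.getD c 0 < ·) = c := by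
  induction l generalizing c with
  | nil => simp at hc
  | cons a l ih =>
    rw [Dec, pairwise_cons] at h
    rw [countP_cons]
    cases c with
    | zero =>
      rw [getD_cons_zero]
      have h0 : l.countP (a < ·) = 0 := by
        rw [countP_eq_zero]
        intro b hb
        have := h.1 b hb
        simp; omega
      rw [h0]; simp
    | succ c =>
      rw [length_cons] at hc
      rw [getD_cons_succ, ih h.2 (by omega)]
      have : l.getD c 0 < a := by
        apply h.1
        rw [getD_eq_getElem _ _ (by omega)]
        exact getElem_mem _
      simp only [this, decide_true, if_true]

theorem dec_find {l : List ℕ} (h : Dec l) {e : ℕ} (he : e ∈ l) : l.findIdx (fun z => z == e) = l.countP (e < ·) := by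
  induction l with
  | nil => simp at he
  | cons a l ih =>
    rw [Dec, pairwise_cons] at h
    rw [countP_cons, findIdx_cons]
    by_cases ha : a = e
    · subst ha
      have h0 : l.countP (a < ·) = 0 := by
        rw [countP_eq_zero]
        intro b hb
        have := h.1 b hb
        simp; omega
      simp [h0]
    · have he' : e ∈ l := by
        rcases mem_cons.1 he with h | h
        · exact absurd h.symm ha
        · exact h
      have := h.1 e he'
      rw [ih h.2 he']
      have hb : (a == e) = false := by simpa using ha
      simp [hb, this]

theorem skt4 {T : List (List ℕ)} (hd : ∀ r ∈ T, Dec r) :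
    (∀ lo hi, lo < hi → hi < T.length →
      ∀ c, c < (T.getD hi []).length → c < (T.getD lo []).length →
        (T.getD hi []).getD c 0 < (T.getD lo []).getD c 0 →
        ∃ c', c < c' ∧ c' < (T.getD lo []).length ∧
          (T.getD hi []).getD c 0 < (T.getD lo []).getD c' 0) ↔
    ∀ lo hi, lo < hi → hi < T.length → ∀ e ∈ T.getD hi [], (T.getD lo []).countP (e < ·) ≠ (T.getD hi []).countP (e < ·) + 1 := by
  have hdd : ∀ i, i < T.length → Dec (T.getD i []) := by
    intro i hi
    rw [getD_eq_getElem _ _ hi]; exact hd _ (getElem_mem _)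
  constructor
  · intro H lo hi h1 h2 e he heq
    obtain ⟨c, hc, rfl⟩ := getElem_of_mem he
    rw [← getD_eq_getElem _ 0 hc, dec_idx (hdd hi h2) hc] at heq
    obtain ⟨a1, a2⟩ := (dec_cnt (hdd lo (h1.trans h2)) _ c).1 (by rw [heq]; omega)
    obtain ⟨c', b1, b2, b3⟩ := H lo hi h1 h2 c hc a1 a2
    have := (dec_cnt (hdd lo (h1.trans h2)) _ c').2 ⟨b2, b3⟩
    omega
  · intro H lo hi h1 h2 c hc1 hc2 hlt
    have := H lo hi h1 h2 ((T.getD hi []).getD c 0) (by rw [getD_eq_getElem _ _ hc1]; exact getElem_mem _)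
    rw [dec_idx (hdd hi h2) hc1] at this
    have h3 := (dec_cnt (hdd lo (h1.trans h2)) _ c).2 ⟨hc2, hlt⟩
    obtain ⟨b1, b2⟩ := (dec_cnt (hdd lo (h1.trans h2)) ((T.getD hi []).getD c 0) (c + 1)).1 (by omega)
    exact ⟨c + 1, by omega, b1, b2⟩

theorem adm_iff (g : List ℕ) : Adm g ↔ ∀ k r, g[k]? = some r → ∀ r' < r, (g.drop (k + 1)).count r' ≠ (g.drop (k+1)).count r + 1 := by
  induction g with
  | nil => simp [Adm]
  | cons x g ih =>
    rw [Adm, ih]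
    constructor
    · rintro ⟨h1, h2⟩ k r hk
      cases k with
      | zero => simp at hk; subst hk; simpa using h1
      | succ k => simpa using h2 k r (by simpa using hk)
    · intro H
      refine ⟨by simpa using H 0 x (by simp), ?_⟩
      intro k r hk
      simpa using H (k + 1) r (by simpa using hk)

def tb (p : ℕ) (g : List ℕ) : List (List ℕ) := (List.range p).map (fun i => pos (i + 1) g)

theorem tb_getD {p i : ℕ} (g : List ℕ) (h : i < p) : (tb p g).getD i [] = pos (i + 1) g := by
  rw [getD_eq_getElem _ _ (by simpa [tb] using h)]; simp [tb]

theorem tb_len (p : ℕ) (g : List ℕ) : (tb p g).length = p := by simp [tb]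

theorem tb_dec (p : ℕ) (g : List ℕ) : ∀ r ∈ tb p g, Dec r := by
  intro r hr
  obtain ⟨i, -, rfl⟩ := mem_map.1 hr
  exact pos_dec _ _

theorem tb_perm {p : ℕ} {g : List ℕ} (hg : ∀ r ∈ g, 1 ≤ r ∧ r ≤ p) : (tb p g).flatten ~ range' 1 g.length := by
  rw [perm_ext_iff_of_nodup]
  · intro e
    rw [mem_flatten, mem_range'_1]
    constructor
    · rintro ⟨l, hl, he⟩
      obtain ⟨i, -, rfl⟩ := mem_map.1 hl
      have h1 := pos_pos _ _ _ he
      obtain ⟨e, rfl⟩ : ∃ e', e = e' + 1 := ⟨e - 1, by omega⟩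
      rw [pos_mem, getElem?_eq_some_iff] at he
      obtain ⟨h, -⟩ := he
      omega
    · rintro ⟨h1, h2⟩
      obtain ⟨e, rfl⟩ : ∃ e', e = e' + 1 := ⟨e - 1, by omega⟩
      have he : e < g.length := by omega
      have := hg g[e] (getElem_mem _)
      refine ⟨pos g[e] g, mem_map.2 ⟨g[e] - 1, by simp; omega, by rw [Nat.sub_add_cancel this.1]⟩, ?_⟩
      rw [pos_mem, getElem?_eq_getElem he]
  · rw [nodup_flatten]
    refine ⟨fun l hl => (tb_dec p g l hl).imp (fun h => ne_of_gt h), ?_⟩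
    rw [tb, pairwise_map]
    refine (pairwise_lt_range (n := p)).imp ?_
    intro a b hab e h1 h2
    have h3 := pos_pos _ _ _ h1
    obtain ⟨e, rfl⟩ : ∃ e', e = e' + 1 := ⟨e - 1, by omega⟩
    rw [pos_mem] at h1 h2
    rw [h1] at h2; simp at h2; omega
  · exact nodup_range'

theorem skt_iff {p : ℕ} {g a : List ℕ} (hg : ∀ r ∈ g, 1 ≤ r ∧ r ≤ p) (ha : a = (List.range p).map (fun i => g.count (i + 1))) :
    IsSKT a (tb p g) ↔ Adm g := by
  have hlen : (tb p g).map length = a := by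
    rw [ha, tb, map_map]; apply map_congr_left; intro i hi; simp [pos_len]
  have hsum : a.sum = g.length := by
    rw [← hlen, ← length_flatten, (tb_perm hg).length_eq, length_range']
  rw [IsSKT, skt4 (tb_dec p g), adm_iff, tb_len]
  constructor
  · rintro ⟨-, -, -, H⟩ k r hk r' hr'
    have h1 := hg r (mem_of_getElem? hk)
    by_cases h0 : r' = 0
    · subst h0
      rw [count_eq_zero_of_not_mem]
      · omega
      · intro h; have := (hg 0 (mem_of_mem_drop h)).1; omega
    · have := H (r' - 1) (r - 1) (by omega) (by omega) (k + 1) (by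
        rw [tb_getD _ (by omega), Nat.sub_add_cancel h1.1, pos_mem]; exact hk)
      rw [tb_getD _ (by omega), tb_getD _ (by omega), Nat.sub_add_cancel h1.1, Nat.sub_add_cancel (by omega), pos_cnt, pos_cnt] at this
      exact this
  · intro H
    refine ⟨hlen, ?_, by rw [hsum]; exact tb_perm hg, ?_⟩
    · intro r hr
      exact isChain_iff_pairwise.2 (tb_dec p g r hr)
    · intro lo hi h1 h2 e he
      rw [tb_getD _ h2] at he
      rw [tb_getD _ h2, tb_getD _ (h1.trans h2), pos_cnt, pos_cnt]
      have := pos_pos _ _ _ he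
      obtain ⟨e, rfl⟩ : ∃ e', e = e' + 1 := ⟨e - 1, by omega⟩
      rw [pos_mem] at he
      exact H e _ he _ (by omega)

theorem tb_inj {p : ℕ} {g g' : List ℕ} (hg : ∀ r ∈ g, 1 ≤ r ∧ r ≤ p) (hg' : ∀ r ∈ g', 1 ≤ r ∧ r ≤ p) (h : tb p g = tb p g') : g = g' := by
  have key : ∀ r, 1 ≤ r → r ≤ p → pos r g = pos r g' := by
    intro r h1 h2
    have := congrArg (fun T => T.getD (r - 1) []) h
    rwa [tb_getD _ (by omega), tb_getD _ (by omega), Nat.sub_add_cancel h1] at this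
  apply ext_getElem?
  intro k
  apply Option.ext
  intro r
  constructor
  · intro h
    have := hg r (mem_of_getElem? h)
    rw [← pos_mem, ← key r this.1 this.2, pos_mem]; exact h
  · intro h
    have := hg' r (mem_of_getElem? h)
    rw [← pos_mem, key r this.1 this.2, pos_mem]; exact h

theorem tb_row {p : ℕ} {g : List ℕ} (hg : ∀ r ∈ g, 1 ≤ r ∧ r ≤ p) {e : ℕ} (he : e < g.length) :
    rowOf (tb p g) (e + 1) + 1 = g.getD e 0 := by
  rw [getD_eq_getElem _ _ he]
  have h1 := hg g[e] (getElem_mem _)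
  have : rowOf (tb p g) (e + 1) = g[e] - 1 := by
    rw [rowOf, findIdx_eq (by rw [tb_len]; omega)]
    constructor
    · simp only [tb, getElem_map, getElem_range]
      rw [Nat.sub_add_cancel h1.1, contains_iff_mem, pos_mem, getElem?_eq_getElem he]
    · intro j hj
      simp only [tb, getElem_map, getElem_range]
      rw [← Bool.not_eq_true, contains_iff_mem, pos_mem, getElem?_eq_getElem he]
      simp; omega
  rw [this, Nat.sub_add_cancel h1.1]

theorem tb_col {p : ℕ} {g : List ℕ} (hg : ∀ r ∈ g, 1 ≤ r ∧ r ≤ p) {e : ℕ} (he : e < g.length) :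
    colOf (tb p g) (e + 1) = (g.drop (e + 1)).count (g.getD e 0) := by
  have h1 := tb_row hg he
  have h2 := hg (g.getD e 0) (by rw [getD_eq_getElem _ _ he]; exact getElem_mem _)
  rw [colOf, tb_getD _ (by omega), h1, dec_find (pos_dec _ _), pos_cnt]
  rw [pos_mem, getElem?_eq_getElem he, getD_eq_getElem _ _ he]

theorem skt_tb {a : List ℕ} {T : List (List ℕ)} (h : IsSKT a T) :
    ∃ g : List ℕ, (∀ r ∈ g, 1 ≤ r ∧ r ≤ a.length) ∧ tb a.length g = T := by
  obtain ⟨h1, h2, h3, -⟩ := h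
  have hl : T.length = a.length := by rw [← h1, length_map]
  have hnd : T.flatten.Nodup := h3.nodup_iff.2 nodup_range'
  rw [nodup_flatten] at hnd
  have hrow : ∀ i e, (hi : i < T.length) → e ∈ T[i] → rowOf T e = i := by
    intro i e hi he
    rw [rowOf, findIdx_eq hi]
    refine ⟨by rw [contains_iff_mem]; exact he, ?_⟩
    intro j hj
    rw [← Bool.not_eq_true, contains_iff_mem]
    intro hj'
    exact (pairwise_iff_getElem.1 hnd.2 j i (hj.trans hi) hi hj) hj' he
  have hin : ∀ e, e ∈ T.flatten → rowOf T e < T.length := by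
    intro e he
    obtain ⟨l, hl, hel⟩ := mem_flatten.1 he
    obtain ⟨i, hi, rfl⟩ := getElem_of_mem hl
    rw [hrow i e hi hel]; exact hi
  refine ⟨(range' 1 a.sum).map (fun e => rowOf T e + 1), ?_, ?_⟩
  · intro r hr
    obtain ⟨e, he, rfl⟩ := mem_map.1 hr
    have := hin e (h3.mem_iff.2 he)
    omega
  · apply ext_getElem (by rw [tb_len, hl])
    intro i hi1 hi2
    have hdT : Dec T[i] := isChain_iff_pairwise.1 (h2 _ (getElem_mem hi2))
    simp only [tb, getElem_map, getElem_range]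
    refine Perm.eq_of_pairwise (le := (· > ·)) (fun a b _ _ x y => by omega) (pos_dec _ _) hdT ?_
    rw [perm_ext_iff_of_nodup ((pos_dec _ _).imp (fun h => ne_of_gt h)) (hdT.imp (fun h => ne_of_gt h))]
    intro e
    constructor
    · intro he
      have := pos_pos _ _ _ he
      obtain ⟨e, rfl⟩ : ∃ e', e = e' + 1 := ⟨e - 1, by omega⟩
      rw [pos_mem, getElem?_map, Option.map_eq_some_iff] at he
      obtain ⟨e', he1, he2⟩ := he
      rw [getElem?_eq_some_iff] at he1
      obtain ⟨hx, he1⟩ := he1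
      rw [getElem_range'] at he1
      have hm : e + 1 ∈ T.flatten := h3.mem_iff.2 (by rw [mem_range'_1]; simp at hx; omega)
      obtain ⟨l, hl', hel⟩ := mem_flatten.1 hm
      obtain ⟨j, hj, rfl⟩ := getElem_of_mem hl'
      have h5 := hrow j _ hj hel
      have h6 : e' = e + 1 := by omega
      rw [h6, h5] at he2
      have : j = i := by omega
      subst this; exact hel
    · intro he
      have hm : e ∈ range' 1 a.sum := h3.mem_iff.1 (mem_flatten.2 ⟨_, getElem_mem hi2, he⟩)
      rw [mem_range'_1] at hm
      obtain ⟨e, rfl⟩ : ∃ e', e = e' + 1 := ⟨e - 1, by omega⟩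
      rw [pos_mem, getElem?_map, Option.map_eq_some_iff]
      refine ⟨e + 1, ?_, by rw [hrow i _ hi2 he]⟩
      rw [getElem?_eq_some_iff]
      exact ⟨by simp; omega, by rw [getElem_range']; omega⟩


theorem spl_map (brk : ℕ → ℕ → Bool) (f : ℕ → ℕ) (l : List ℕ) :
    splitWhen brk (l.map f) = (splitWhen (fun a b => brk (f a) (f b)) l).map (map f) := by
  induction l with
  | nil => rfl
  | cons a l ih =>
    cases l with
    | nil => simp [splitWhen]
    | cons b l =>
      rw [map_cons] at ih
      rw [map_cons, map_cons, splitWhen, ih, splitWhen]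
      cases splitWhen (fun a b => brk (f a) (f b)) (b :: l) with
      | nil => rfl
      | cons r rs =>
        simp only [map_cons]
        split_ifs <;> rfl

theorem spl_congr (b1 b2 : ℕ → ℕ → Bool) (l : List ℕ) (h : l.IsChain (fun a b => b1 a b = b2 a b)) :
    splitWhen b1 l = splitWhen b2 l := by
  induction l with
  | nil => rfl
  | cons a l ih =>
    cases l with
    | nil => rfl
    | cons b l =>
      rw [isChain_cons_cons] at h
      rw [splitWhen, ih h.2, splitWhen, h.1]

theorem chain_rng {R : ℕ → ℕ → Prop} (n : ℕ) (h : ∀ b, 1 ≤ b → b + 1 ≤ n → R (b + 1) b) : (range' 1 n).reverse.IsChain R := by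
  induction n with
  | zero => simp
  | succ n ih =>
    have ih := ih (fun b h1 h2 => h b h1 (by omega))
    rw [range'_1_concat, reverse_append]
    cases n with
    | zero => simp
    | succ n =>
      rw [range'_1_concat, reverse_append] at ih ⊢
      simp only [reverse_cons, reverse_nil, nil_append, cons_append] at ih ⊢
      rw [isChain_cons_cons]
      refine ⟨?_, ih⟩
      have := h (1 + n) (by omega) (by omega)
      rwa [show 1 + (n + 1) = 1 + n + 1 by omega]

theorem mapdrop (u : List ℕ) (k : ℕ) : (range' (k + 1) (u.length - k)).map (fun b => u.getD (b - 1) 0) = u.drop k := by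
  apply ext_getElem (by simp)
  intro i h1 h2
  simp at h1
  rw [getElem_map, getElem_range', getElem_drop, show k + 1 + 1 * i - 1 = k + i by omega, getD_eq_getElem _ _ (by omega)]

theorem gr_drop (u : List ℕ) (k : ℕ) : gr (u.drop k) = (gr u).drop k := by
  induction k generalizing u with
  | zero => rfl
  | succ k ih =>
    cases u with
    | nil => rfl
    | cons x u => rw [drop_succ_cons, ih]; rfl

theorem red_drop {u : List ℕ} (h : Red u.reverse) (k : ℕ) : Red (u.drop k).reverse := by
  rw [← take_append_drop k u, reverse_append] at h
  exact h.left

theorem pre_rng {n : ℕ} {K : List ℕ} (h : K <+: (range' 1 n).reverse) : ∃ k, ∀ b, b ∈ K ↔ b ∈ range' (k + 1) (n - k) := by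
  have h1 := prefix_iff_eq_take.1 h
  have h2 := h.length_le
  rw [length_reverse, length_range'] at h2
  revert h1 h2
  generalize K.length = j
  intro h1 h2
  refine ⟨n - j, ?_⟩
  intro b
  rw [h1, take_reverse, mem_reverse, length_range', drop_range']
  simp only [mem_range'_1]
  omega

theorem hat_blk {f h : ℕ → ℕ} {F H : List ℕ → ℕ} (Rs : List (List ℕ)) (K : List ℕ) (m : ℕ) (v : ℤ) (hv : v ≤ m)
    (hm : ∀ x, x ≤ m ↔ ∀ b ∈ K, x ≤ f b) (hF : ∀ R ∈ Rs, ∀ x, x ≤ F R ↔ ∀ b ∈ R, x ≤ f b)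
    (hH : ∀ R ∈ Rs, ∀ x, x ≤ H R ↔ ∀ b ∈ R, x ≤ h b)
    (hp : ∀ K', K' <+: K ++ Rs.flatten → ∀ x, (∀ b ∈ K', x ≤ f b) ↔ (∀ b ∈ K', x ≤ h b)) :
    hatA (some v) (Rs.map (fun R => (F R : ℤ))) = hatA (some v) (Rs.map (fun R => (H R : ℤ))) := by
  induction Rs generalizing K m v with
  | nil => rfl
  | cons R Rs ih =>
    have e : min m (F R) = min m (H R) := by
      apply eq_of_forall_le_iff
      intro x
      rw [le_min_iff, le_min_iff, hm, hF R (by simp), hH R (by simp)]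
      have a1 := hp K (prefix_append _ _) x
      have a2 := hp (K ++ R) (by rw [flatten_cons, ← append_assoc]; exact prefix_append _ _) x
      simp only [mem_append, or_imp, forall_and] at a2
      rw [a2, a1]
    have e2 : min (F R : ℤ) (v - 1) = min (H R : ℤ) (v - 1) := by omega
    rw [map_cons, map_cons, hatA, hatA, e2]
    congr 1
    refine ih (K ++ R) (min m (H R)) _ ?_ ?_ (fun R hR => hF R (by simp [hR])) (fun R hR => hH R (by simp [hR])) ?_
    · omega
    · intro x
      rw [← e, le_min_iff, hm, hF R (by simp)]
      simp only [mem_append, or_imp, forall_and]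
    · rw [flatten_cons, ← append_assoc] at hp; exact hp

theorem hat_blk0 {f h : ℕ → ℕ} {F H : List ℕ → ℕ} (Rs : List (List ℕ)) 
    (hF : ∀ R ∈ Rs, ∀ x, x ≤ F R ↔ ∀ b ∈ R, x ≤ f b)
    (hH : ∀ R ∈ Rs, ∀ x, x ≤ H R ↔ ∀ b ∈ R, x ≤ h b)
    (hp : ∀ K', K' <+: Rs.flatten → ∀ x, (∀ b ∈ K', x ≤ f b) ↔ (∀ b ∈ K', x ≤ h b)) :
    hatMins (Rs.map (fun R => (F R : ℤ))) = hatMins (Rs.map (fun R => (H R : ℤ))) := by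
  rw [hat_eq, hat_eq]
  cases Rs with
  | nil => rfl
  | cons R Rs =>
    have e : F R = H R := by
      apply eq_of_forall_le_iff
      intro x
      rw [hF R (by simp), hH R (by simp)]
      exact hp R (by rw [flatten_cons]; exact prefix_append _ _) x
    rw [map_cons, map_cons, hatA, hatA, e]
    congr 1
    exact hat_blk (f := f) (h := h) Rs R (H R) _ le_rfl (by intro x; rw [← e]; exact hF R (by simp) x) (fun R hR => hF R (by simp [hR])) (fun R hR => hH R (by simp [hR])) hp

theorem filt_sum (l : List ℕ) : (l.filter (fun x => decide (x ≠ 0))).sum = l.sum := by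
  induction l with
  | nil => rfl
  | cons a l ih =>
    rw [filter_cons]
    by_cases h : a = 0
    · subst h; simpa using ih
    · simp only [ne_eq, h, not_false_eq_true, decide_true, if_true, sum_cons]; rw [← ih]

theorem rng_sum (b : ℕ → ℕ) (n : ℕ) : ((range n).map b).sum = ∑ i ∈ Finset.range n, b i := by
  induction n with
  | zero => rfl
  | succ n ih => rw [range_succ, map_append, sum_append, ih, Finset.sum_range_succ]; simp

theorem flat_sum (b : ℕ →₀ ℕ) : (flatOf b).sum = ∑ i ∈ Finset.range (b.support.sup id + 1), b i := by
  rw [flatOf, filt_sum, rng_sum]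

theorem ref_sum {β α : List ℕ} (h : Refines β α) : β.sum = α.sum := by
  obtain ⟨bl, rfl, h2⟩ := h
  rw [sum_flatten]
  congr 1
  induction h2 with
  | nil => rfl
  | cons h1 _ ih => rw [map_cons, h1, ih]

theorem slide_pad (d : List ℕ) (k : ℕ) : FSlide (d ++ replicate k 0) = FSlide d := by
  funext b
  have e1 : ∀ j, ((d ++ replicate k 0).take j).sum = (d.take j).sum := by
    intro j; rw [take_append, sum_append, take_replicate]; simp
  have e2 : (d ++ replicate k 0).filter (fun x => decide (x ≠ 0)) = d.filter (fun x => decide (x ≠ 0)) := by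
    rw [filter_append, filter_replicate]; simp
  classical
  simp only [FSlide]
  refine if_congr ?_ rfl rfl
  simp only [e1]
  rw [e2]
  constructor
  · rintro ⟨h1, h2, h3⟩
    refine ⟨?_, h2, h3⟩
    intro i hi
    by_contra hb
    have hs := ref_sum h3
    rw [filt_sum, flat_sum] at hs
    have h4 := h2 d.length
    rw [take_length] at h4
    have hi2 : i ≤ b.support.sup id := Finset.le_sup (f := id) (Finsupp.mem_support_iff.2 hb)
    have h5 : ∑ j ∈ Finset.range d.length, b j + b i ≤ ∑ j ∈ Finset.range (b.support.sup id + 1), b j := by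
      rw [add_comm, ← Finset.sum_insert (by simp; omega)]
      apply Finset.sum_le_sum_of_subset
      intro j hj
      simp only [Finset.mem_insert, Finset.mem_range] at hj ⊢
      omega
    omega
  · rintro ⟨h1, h2, h3⟩
    exact ⟨fun i hi => h1 i (by simp at hi; omega), h2, h3⟩


theorem col_gc {p : ℕ} {u : List ℕ} (hr : Red u.reverse) (hg : ∀ r ∈ gr u, 1 ≤ r ∧ r ≤ p) {e : ℕ} (he : e < u.length) :
    colOf (tb p (gr u)) (e + 1) = gc (u.getD e 0) (PT (u.drop (e + 1))) := by
  have he' : e < (gr u).length := by rw [gr_length]; exact he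
  rw [tb_col hg he']
  have h1 := red_drop hr e
  rw [drop_eq_getElem_cons he] at h1
  have h2 := gr_drop u e
  rw [drop_eq_getElem_cons he, drop_eq_getElem_cons he'] at h2
  rw [getD_eq_getElem _ _ he, getD_eq_getElem _ _ he', gr_gc h1 h2]

theorem brk_eq {p : ℕ} {u : List ℕ} (hr : Red u.reverse) (hg : ∀ r ∈ gr u, 1 ≤ r ∧ r ≤ p) {e : ℕ} (he : e + 1 < u.length) :
    u.getD e 0 ≤ u.getD (e + 1) 0 ↔ colOf (tb p (gr u)) (e + 1) ≤ colOf (tb p (gr u)) (e + 1 + 1) := by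
  rw [col_gc hr hg he, col_gc hr hg (show e < u.length by omega), drop_eq_getElem_cons he, getD_eq_getElem _ _ he, PT_cons]
  constructor
  · intro h; exact pieri_ge (PT_tab _) h
  · intro h
    by_contra h'
    have := pieri_lt (PT_tab (u.drop (e + 1 + 1))) (not_le.1 h')
    omega

theorem runs_tb {p : ℕ} {u : List ℕ} (hr : Red u.reverse) (hg : ∀ r ∈ gr u, 1 ≤ r ∧ r ≤ p) :
    runs u.reverse = (sktRuns (tb p (gr u))).map (map (fun b => u.getD (b - 1) 0)) ∧
      (sktRuns (tb p (gr u))).flatten = (range' 1 u.length).reverse := by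
  have hn : (tb p (gr u)).flatten.length = u.length := by
    rw [(tb_perm hg).length_eq, length_range', gr_length]
  constructor
  · have h0 := mapdrop u 0
    simp only [Nat.sub_zero, Nat.zero_add, drop_zero] at h0
    rw [← h0, ← map_reverse, runs, spl_map, h0, sktRuns, hn]
    congr 1
    apply spl_congr
    apply chain_rng
    intro b h1 h2
    obtain ⟨e, rfl⟩ : ∃ e, b = e + 1 := ⟨b - 1, by omega⟩
    simp only [Nat.add_sub_cancel]
    exact decide_eq_decide.2 (brk_eq hr hg (by omega))
  · rw [sktRuns, hn]; exact (spl_flat _ _).1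

theorem min_row {T : List (List ℕ)} {R : List ℕ} (h : R ≠ []) (x : ℕ) : x ≤ minRow T R ↔ ∀ b ∈ R, x ≤ rowOf T b + 1 := by
  rw [minRow]
  have : (R.map (fun e => rowOf T e + 1)).min? ≠ none := by
    rw [ne_eq, min?_eq_none_iff, map_eq_nil_iff]; exact h
  obtain ⟨m, hm⟩ := Option.ne_none_iff_exists'.1 this
  rw [hm, Option.getD_some, le_min?_iff hm]
  simp

theorem des_eq {p : ℕ} {u : List ℕ} (hr : Red u.reverse) (hg : ∀ r ∈ gr u, 1 ≤ r ∧ r ≤ p) :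
    FSlideO (desSKT (tb p (gr u))) = FSlideO (desWord u.reverse) := by
  obtain ⟨h1, h2⟩ := runs_tb hr hg
  have hne : ∀ R ∈ sktRuns (tb p (gr u)), R ≠ [] := fun R hR => ((spl_flat _ _).2 R hR).1
  have key : desFromBlocks ((sktRuns (tb p (gr u))).map (fun r => ((minRow (tb p (gr u)) r : ℕ) : ℤ)))
    ((sktRuns (tb p (gr u))).map List.length) = desWord u.reverse := by
    rw [desWord, h1, map_map, map_map]
    have e1 : (length ∘ map (fun b => u.getD (b - 1) 0)) = length := by funext R; simp
    rw [e1]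
    have hh := hat_blk0 (f := fun b => u.getD (b - 1) 0) (h := fun b => rowOf (tb p (gr u)) b + 1)
      (F := fun R => (R.map (fun b => u.getD (b - 1) 0)).headD 0) (H := minRow (tb p (gr u)))
      (sktRuns (tb p (gr u))) ?_ ?_ ?_
    · rw [desFromBlocks, desFromBlocks, ← hh]; rfl
    · intro R hR x
      have hR2 : R.map (fun b => u.getD (b - 1) 0) ∈ runs u.reverse := by rw [h1]; exact mem_map_of_mem hR
      have hc := (spl_flat _ _).2 _ hR2
      have hi : Inc (R.map (fun b => u.getD (b - 1) 0)) := by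
        rw [Inc, ← isChain_iff_pairwise]
        exact hc.2.imp (fun a b h => by simpa using h)
      constructor
      · intro hx b hb; exact hx.trans (head_le hi _ (mem_map_of_mem (f := fun b => u.getD (b - 1) 0) hb))
      · intro hx
        obtain ⟨b, hb, hb2⟩ := mem_map.1 (head_mem hc.1)
        exact hb2 ▸ hx b hb
    · intro R hR x; exact min_row (hne R hR) x
    · intro K hK x
      rw [h2] at hK
      obtain ⟨k, hk⟩ := pre_rng hK
      have hb := gr_bd (red_drop hr k) x
      rw [gr_drop, ← mapdrop, ← mapdrop (gr u), gr_length] at hb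
      simp only [mem_map, forall_exists_index, and_imp, forall_apply_eq_imp_iff₂] at hb
      simp only [hk]
      rw [hb]
      apply forall₂_congr
      intro b hb
      rw [mem_range'_1] at hb
      obtain ⟨e, rfl⟩ : ∃ e, b = e + 1 := ⟨b - 1, by omega⟩
      rw [tb_row hg (by rw [gr_length]; omega), Nat.add_sub_cancel]
  rw [desSKT, key]
  cases desWord u.reverse with
  | none => rfl
  | some d => exact slide_pad d _

theorem key_eq {P : List (List ℕ)} (h : EGT P) :
    KeyPoly (aL P) = ∑ᶠ u ∈ {u : List ℕ | Red u.reverse ∧ PT u = P}, FSlideO (desWord u.reverse) := by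
  have hla : (aL P).length = mx P := by simp [aL]
  have hg : ∀ u, Red u.reverse → PT u = P → ∀ r ∈ gr u, 1 ≤ r ∧ r ≤ mx P := by
    intro u hu hP r hr
    rw [gr_mem hu, hP] at hr
    exact ⟨egt_pos h hr, mx_le h hr⟩
  symm
  rw [KeyPoly]
  apply finsum_mem_eq_of_bijOn (fun u => tb (mx P) (gr u))
  · refine ⟨?_, ?_, ?_⟩
    · rintro u ⟨hu, hP⟩
      refine (skt_iff (hg u hu hP) ?_).2 (gr_adm hu)
      rw [aL]
      apply map_congr_left
      intro i hi
      rw [gr_count hu, hP]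
    · rintro u ⟨hu, hP⟩ v ⟨hv, hP'⟩ he
      exact gr_inj hu hv (hP.trans hP'.symm) (tb_inj (hg u hu hP) (hg v hv hP') he)
    · intro T hT
      obtain ⟨g, h1, h2⟩ := skt_tb hT
      rw [hla] at h1 h2
      have hc : aL P = (range (mx P)).map (fun i => g.count (i + 1)) := by
        have := hT.1
        rw [← this, ← h2, tb, map_map]
        apply map_congr_left; intro i hi; simp [pos_len]
      have hA : Adm g := by
        rw [← h2] at hT
        exact (skt_iff h1 hc).1 hT
      have hcount : ∀ r, g.count r = aP P r := by
        intro r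
        by_cases hr : 1 ≤ r ∧ r ≤ mx P
        · have := congrArg (fun l => l.getD (r - 1) 0) hc
          simp only [aL] at this
          rw [getD_eq_getElem _ _ (by simp; omega), getD_eq_getElem _ _ (by simp; omega), getElem_map, getElem_map, getElem_range,
            Nat.sub_add_cancel hr.1] at this
          exact this.symm
        · rw [count_eq_zero.2 (fun hm => hr (h1 r hm))]
          by_contra hn
          have := (aP_pos h.1).1 (Nat.pos_of_ne_zero (Ne.symm hn))
          exact hr ⟨egt_pos h this, mx_le h this⟩
      obtain ⟨u, hu, hP, hgu⟩ := gr_surj hA h.1 h.2.1 h.2.2 hcount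
      exact ⟨u, ⟨hu, hP⟩, by simp only [hgu, h2]⟩
  · rintro u ⟨hu, hP⟩
    exact (des_eq hu (hg u hu hP)).symm

theorem dom_iff (lo hi : List ℕ) : Dom lo hi ↔ hi.length ≤ lo.length ∧ ∀ j < hi.length, lo.getD j 0 < hi.getD j 0 := by
  induction hi generalizing lo with
  | nil => cases lo <;> simp
  | cons b hi ih =>
    cases lo with
    | nil => simp
    | cons a lo =>
      rw [dom_cons, ih]
      constructor
      · rintro ⟨h1, h2, h3⟩
        refine ⟨by simpa using h2, ?_⟩
        intro j hj
        cases j with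
        | zero => simpa using h1
        | succ j => simpa using h3 j (by simpa using hj)
      · rintro ⟨h2, h3⟩
        refine ⟨by simpa using h3 0 (by simp), by simpa using h2, ?_⟩
        intro j hj
        simpa using h3 (j + 1) (by simpa using hj)

theorem iyr (R : List (List ℕ)) : IsIncreasingYoungRows R ↔ (∀ r ∈ R, r.IsChain (· < ·)) ∧
    R.IsChain (fun lo hi => hi.length ≤ lo.length ∧
      ∀ j < hi.length, lo.getD j 0 < hi.getD j 0) := Iff.rfl

theorem tab_iff (P : List (List ℕ)) : Tab P ↔ IsIncreasingYoungRows P := by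
  induction P with
  | nil => rw [iyr]; exact ⟨fun _ => ⟨by simp, by simp⟩, fun _ => trivial⟩
  | cons r R ih =>
    rw [Tab, ih]
    simp only [iyr, ← dom_iff, forall_mem_cons, Inc, ← isChain_iff_pairwise]
    cases R with
    | nil => simp
    | cons s R =>
      rw [headD_cons, isChain_cons_cons]
      constructor
      · rintro ⟨h1, h2, h3, h4⟩; exact ⟨⟨h1, h3⟩, h2, h4⟩
      · rintro ⟨⟨h1, h3⟩, h2, h4⟩; exact ⟨h1, h2, h3, h4⟩


theorem rows_egt {ρ : List ℕ} (h : Red ρ) (hy : IsIncreasingYoungRows (rowsOf ρ)) : EGT (rowsOf ρ) ∧ wordOf (rowsOf ρ) = ρ := by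
  have hw : wordOf (rowsOf ρ) = ρ := by
    rw [wordOf, rowsOf, reverse_reverse]; exact (spl_flat _ _).1
  refine ⟨⟨(tab_iff _).2 hy, ?_, by rw [hw]; exact h⟩, hw⟩
  intro r hr
  rw [rowsOf, mem_reverse] at hr
  exact ((spl_flat _ _).2 r hr).1

theorem egt_rows {P : List (List ℕ)} (h : EGT P) : rowsOf (wordOf P) = P := by
  rw [rowsOf, rows_word (tab_RI h.1) h.2.1 (heads_inc h.1 h.2.1), reverse_reverse]

theorem ck_for {u v : List ℕ} {w : Equiv.Perm ℕ} (h : CK u v) (hu : ReducedWordFor u w) : ReducedWordFor v w :=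
  ⟨h.red hu.1, h.perm ▸ hu.2⟩


/-- For any permutation `w`, the Schubert polynomial satisfies
`𝔖_w = Σ κ_{des(lift(ρ))}`, the sum over reduced words `ρ ∈ R(w)` whose descent
tableau `𝔻(ρ)` is an increasing Young tableau, with `lift(ρ)` the result of the
canonical lifting algorithm applied to `𝔻(ρ)`. -/
theorem schubert_via_lifts (w : Equiv.Perm ℕ) :
    Schubert w =
      ∑ᶠ ρ ∈ {ρ : List ℕ | ReducedWordFor ρ w ∧ IsIncreasingYoungRows (rowsOf ρ)},
        KeyPolyO (desWord (liftWord ρ)) := by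
  set Y := {ρ : List ℕ | ReducedWordFor ρ w ∧ IsIncreasingYoungRows (rowsOf ρ)} with hY
  have hYf : Y.Finite := (finite_red w).subset (fun ρ h => h.1)
  let t : List ℕ → Set (List ℕ) := fun ρ => {σ | Red σ ∧ PT σ.reverse = rowsOf ρ}
  have hsub : ∀ ρ ∈ Y, ∀ σ ∈ t ρ, ReducedWordFor σ w := by
    rintro ρ ⟨h1, h2⟩ σ ⟨h3, h4⟩
    have h5 := rows_egt h1.1 h2
    have h3' : Red σ.reverse.reverse := by rwa [reverse_reverse]
    have hck := PT_ck h3'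
    rw [reverse_reverse, h4, h5.2] at hck
    exact ck_for hck.symm h1
  have hU : {ρ : List ℕ | ReducedWordFor ρ w} = ⋃ ρ ∈ Y, t ρ := by
    ext σ
    simp only [Set.mem_iUnion, exists_prop]
    constructor
    · intro hσ
      have h3' : Red σ.reverse.reverse := by rw [reverse_reverse]; exact hσ.1
      have hE := egt_PT h3'
      have hck := PT_ck h3'
      rw [reverse_reverse] at hck
      refine ⟨wordOf (PT σ.reverse), ⟨ck_for hck hσ, ?_⟩, hσ.1, ?_⟩
      · rw [egt_rows hE]; exact (tab_iff _).1 hE.1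
      · rw [egt_rows hE]
    · rintro ⟨ρ, h1, h2⟩; exact hsub ρ h1 σ h2
  have hD : Y.PairwiseDisjoint t := by
    rintro ρ h1 ρ' h2 hne
    rw [Function.onFun, Set.disjoint_left]
    rintro σ ⟨-, h3⟩ ⟨-, h4⟩
    apply hne
    rw [← (rows_egt h1.1.1 h1.2).2, ← (rows_egt h2.1.1 h2.2).2, ← h3, ← h4]
  rw [Schubert, hU, finsum_mem_biUnion hD hYf (fun ρ hρ => (finite_red w).subset (hsub ρ hρ))]
  apply finsum_mem_congr rfl
  intro ρ hρ
  obtain ⟨hE, hw⟩ := rows_egt hρ.1.1 hρ.2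
  have hd := des_lift hE
  rw [hw] at hd
  rw [hd]
  change _ = KeyPoly _
  rw [key_eq hE]
  apply finsum_mem_eq_of_bijOn reverse
  · refine ⟨?_, reverse_injective.injOn, ?_⟩
    · rintro σ ⟨h1, h2⟩
      exact ⟨by rwa [reverse_reverse], h2⟩
    · rintro u ⟨h1, h2⟩
      exact ⟨u.reverse, ⟨h1, by rwa [reverse_reverse]⟩, reverse_reverse u⟩
  · intro σ _; rw [reverse_reverse]

end EG
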